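/- Let L be a positive-definite integral ternary lattice that is stable at 2. For any n ∈ ℕ that is locally represented by L: if L is odd, then for any odd f ∈ ℕ with H(4 d_L n / f²) ≠ 0, r(4n, gen(L)) / r(n, gen(L)) = (H(16 d_L n / f²) + S_2*(L)·2·H(4 d_L n / f²)) / (H(4 d_L n / f²) + S_2*(L)·2·H(d_L n / f²)); and if L is even, then for any odd f ∈ ℕ with H(d_L n / f²) ≠ 0, r(4n, gen(L)) / r(n, gen(L)) = H(4 d_L n / f²) / H(d_L n / f²). -/

import Mathlib

open scoped BigOperators Classical
open Matrix Filter

noncomputable section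

/-! ## Binary quadratic forms, class numbers, and Hurwitz class numbers -/

/-- `(a,b,c)` represents the primitive positive-definite binary quadratic form
`a x² + b x y + c y²` of discriminant `d`. -/
def IsPrimPosDefBQF (d : ℤ) (f : ℤ × ℤ × ℤ) : Prop :=
  f.2.1 ^ 2 - 4 * f.1 * f.2.2 = d ∧ Int.gcd f.1 (Int.gcd f.2.1 f.2.2) = 1 ∧ 0 < f.1

/-- `SL₂(ℤ)`-equivalence of binary quadratic forms. -/
def BQFEquiv (f g : ℤ × ℤ × ℤ) : Prop :=
  ∃ M : Matrix.SpecialLinearGroup (Fin 2) ℤ,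
    g.1 = f.1 * M 0 0 ^ 2 + f.2.1 * M 0 0 * M 1 0 + f.2.2 * M 1 0 ^ 2 ∧
    g.2.1 = 2 * f.1 * M 0 0 * M 0 1 + f.2.1 * (M 0 0 * M 1 1 + M 0 1 * M 1 0) +
        2 * f.2.2 * M 1 0 * M 1 1 ∧
    g.2.2 = f.1 * M 0 1 ^ 2 + f.2.1 * M 0 1 * M 1 1 + f.2.2 * M 1 1 ^ 2

/-- The class number `h(d)`: the number of `SL₂(ℤ)`-classes of primitive positive-definite
binary quadratic forms of discriminant `d`. -/
def classNum (d : ℤ) : ℕ :=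
  Nat.card (Quot fun f g : {f : ℤ × ℤ × ℤ // IsPrimPosDefBQF d f} => BQFEquiv f.1 g.1)

/-- The number of automorphs `w_d`. -/
def wAut (d : ℤ) : ℕ := if d = -3 then 6 else if d = -4 then 4 else 2

def hurwitzNat (N : ℕ) : ℚ :=
  if 0 < N ∧ (N % 4 = 0 ∨ N % 4 = 3) then
    ∑ f ∈ N.divisors.filter fun f => f ^ 2 ∣ N,
      (classNum (-((N / f ^ 2 : ℕ) : ℤ)) : ℚ) / ((wAut (-((N / f ^ 2 : ℕ) : ℤ)) : ℚ) / 2)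
  else 0

/-- Hurwitz class number, with the convention `H(x) = 0` unless `x` is a positive integer
congruent to `0` or `3 (mod 4)`. -/
def hurwitz (x : ℚ) : ℚ := if x.den = 1 ∧ 0 ≤ x.num then hurwitzNat x.num.toNat else 0

/-! ## Kronecker symbol and fundamental discriminants -/

def kron2 (a : ℤ) : ℤ := if a % 2 = 0 then 0 else if a % 8 = 1 ∨ a % 8 = 7 then 1 else -1

/-- The Kronecker symbol `(a / n)` for `n ∈ ℕ`. -/
def kroneckerSym (a : ℤ) (n : ℕ) : ℤ :=
  kron2 a ^ padicValNat 2 n * jacobiSym a (n / 2 ^ padicValNat 2 n)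

/-- Fundamental discriminants. -/
def IsFundamentalDisc (d : ℤ) : Prop :=
  d % 4 = 1 ∧ Squarefree d ∨ d % 4 = 0 ∧ Squarefree (d / 4) ∧ (d / 4 % 4 = 2 ∨ d / 4 % 4 = 3)

/-! ## Ternary quadratic lattices via Gram matrices -/

abbrev TernMat := Matrix (Fin 3) (Fin 3) ℤ

/-- The quadratic form attached to a Gram matrix. -/
def quadVal {R : Type*} [CommRing R] {k : ℕ} (M : Matrix (Fin k) (Fin k) R) (x : Fin k → R) : R :=
  ∑ i, ∑ j, x i * M i j * x j

/-- `A` is the Gram matrix of a positive-definite integral ternary lattice. -/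
def IsLat (A : TernMat) : Prop := A.IsSymm ∧ ∀ x : Fin 3 → ℤ, x ≠ 0 → 0 < quadVal A x

/-- The number of representations of `n` by the lattice with Gram matrix `A`. -/
def rRep (n : ℤ) (A : TernMat) : ℕ := Nat.card {x : Fin 3 → ℤ // quadVal A x = n}

/-- Isometry of ternary lattices via their Gram matrices. -/
def LatIsom (A B : TernMat) : Prop := ∃ U : TernMat, IsUnit U.det ∧ Uᵀ * A * U = B

/-- The number of automorphs `o(L)`. -/
def numAut (A : TernMat) : ℕ := Nat.card {U : TernMat // IsUnit U.det ∧ Uᵀ * A * U = A}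

def padicMat (p : ℕ) [Fact p.Prime] {k : ℕ} (A : Matrix (Fin k) (Fin k) ℤ) :
    Matrix (Fin k) (Fin k) ℤ_[p] := A.map Int.cast

/-- Isometry of `ℤ_p`-lattices given by Gram matrices. -/
def PadicIsomP (p : ℕ) [Fact p.Prime] {k : ℕ} (M N : Matrix (Fin k) (Fin k) ℤ_[p]) : Prop :=
  ∃ U : Matrix (Fin k) (Fin k) ℤ_[p], IsUnit U.det ∧ Uᵀ * M * U = N

/-- `A ⊗ ℤ_p ≅ B ⊗ ℤ_p`. -/
def PadicLatIsom (p : ℕ) (hp : p.Prime) (A B : TernMat) : Prop :=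
  letI : Fact p.Prime := ⟨hp⟩
  PadicIsomP p (padicMat p A) (padicMat p B)

/-- `B` is (the Gram matrix of a lattice) in the genus of `A`. -/
def InGenus (A B : TernMat) : Prop :=
  IsLat B ∧ ∀ (p : ℕ) (hp : p.Prime), PadicLatIsom p hp A B

/-- The mass `w(L)` of the genus of `A`. -/
def massOf (A : TernMat) : ℝ :=
  ∑ᶠ c : Quot fun B C : {B : TernMat // InGenus A B} => LatIsom B.1 C.1,
    ((numAut (Quot.out c).1 : ℝ))⁻¹

/-- The Siegel–Weil average `r(n, gen(L))`. -/
def rGenus (n : ℤ) (A : TernMat) : ℝ :=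
  (massOf A)⁻¹ *
    ∑ᶠ c : Quot fun B C : {B : TernMat // InGenus A B} => LatIsom B.1 C.1,
      (rRep n (Quot.out c).1 : ℝ) / (numAut (Quot.out c).1 : ℝ)

/-! ## Local invariants -/

/-- `L_p` is isotropic. -/
def IsotropicP (p : ℕ) [Fact p.Prime] (A : TernMat) : Prop :=
  ∃ x : Fin 3 → ℤ_[p], x ≠ 0 ∧ quadVal (padicMat p A) x = 0

/-- The modified Hasse symbol `S_p*(L)`: `1` if `L_p` is isotropic, `-1` if anisotropic. -/
def SpStar (p : ℕ) (A : TernMat) : ℤ :=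
  if h : p.Prime then
    letI : Fact p.Prime := ⟨h⟩
    if IsotropicP p A then 1 else -1
  else 1

/-- The lattice is even: all represented numbers are even. -/
def IsEvenLat (A : TernMat) : Prop := ∀ x : Fin 3 → ℤ, 2 ∣ quadVal A x

/-- The lattice is primitive: its scale ideal is `ℤ`. -/
def IsPrimitiveLat (A : TernMat) : Prop :=
  Finset.univ.gcd (fun ij : Fin 3 × Fin 3 => (A ij.1 ij.2).natAbs) = 1

/-- Stability at a prime `p`. -/
def StableAt (A : TernMat) (p : ℕ) : Prop :=
  padicValInt p A.det ≤ 1 ∧ (p = 2 → (padicValInt 2 A.det = 1 ↔ IsEvenLat A))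

/-- A stable (primitive) ternary lattice. -/
def IsStable (A : TernMat) : Prop := IsPrimitiveLat A ∧ ∀ p : ℕ, p.Prime → StableAt A p

def RepresentedAt (p : ℕ) (hp : p.Prime) (n : ℤ) (A : TernMat) : Prop :=
  letI : Fact p.Prime := ⟨hp⟩
  ∃ x : Fin 3 → ℤ_[p], quadVal (padicMat p A) x = (n : ℤ_[p])

/-- `n` is represented by `L_p` for every prime `p`. -/
def LocallyRepresented (n : ℤ) (A : TernMat) : Prop :=
  ∀ (p : ℕ) (hp : p.Prime), RepresentedAt p hp n A

/-! ## Siegel local densities -/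

/-- The Siegel local density `α_p(n, L)` (here `s = 1`, `t = 3`). -/
def localDensity (p : ℕ) (hp : p.Prime) (n : ℤ) (A : TernMat) : ℝ :=
  limUnder atTop fun r : ℕ =>
    (Nat.card {X : Fin 3 → ZMod (p ^ r) //
        (∑ i, ∑ j, X i * (A i j : ZMod (p ^ r)) * X j) = (n : ZMod (p ^ r))} : ℝ) /
      (p : ℝ) ^ (2 * r)

def localDensityN (p : ℕ) (n : ℤ) (A : TernMat) : ℝ :=
  if h : p.Prime then localDensity p h n A else 0

/-- The value `L(1, χ_a)` of the Dirichlet series attached to the Kronecker symbol `(a/·)`. -/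
def LOne (a : ℤ) : ℝ :=
  limUnder atTop fun N : ℕ =>
    ∑ k ∈ Finset.range N, (kroneckerSym a (k + 1) : ℝ) / (k + 1)

/-! ## Watson transformations (Gram matrix form) -/

/-- The underlying set of `Λ_m(L)` in the coordinates of `L`. -/
def watsonSetG (m : ℕ) (A : TernMat) : Set (Fin 3 → ℤ) :=
  {x | ∀ y : Fin 3 → ℤ, (m : ℤ) ∣ (quadVal A (x + y) - quadVal A y)}

/-- `B` is a Gram matrix for the sublattice `Λ_m(L)` of the lattice `L` with Gram matrix `A`. -/
def IsWatsonGram (m : ℕ) (A B : TernMat) : Prop :=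
  ∃ T : TernMat, Set.range T.mulVec = watsonSetG m A ∧ B = Tᵀ * A * T

/-- `B` is a Gram matrix of the Watson transform `λ_m(L)`: the primitive rescaling of `Λ_m(L)`. -/
def IsLambdaGram (m : ℕ) (A B : TernMat) : Prop :=
  IsPrimitiveLat B ∧
    ∃ (B₀ : TernMat) (c : ℚ), 0 < c ∧ IsWatsonGram m A B₀ ∧
      B.map ((↑) : ℤ → ℚ) = c • B₀.map ((↑) : ℤ → ℚ)

/-- The `3×3` Gram matrix of the orthogonal sum `M ⊥ U`. -/
def blockMat3 {p : ℕ} [Fact p.Prime] (k : ℕ) (hk : k ≤ 3)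
    (M : Matrix (Fin k) (Fin k) ℤ_[p]) (U : Matrix (Fin (3 - k)) (Fin (3 - k)) ℤ_[p]) :
    Matrix (Fin 3) (Fin 3) ℤ_[p] :=
  Matrix.reindex (finSumFinEquiv.trans (finCongr (by omega)))
    (finSumFinEquiv.trans (finCongr (by omega))) (Matrix.fromBlocks M 0 0 U)

end

set_option linter.unusedVariables false
set_option linter.unusedSimpArgs false
set_option linter.style.haveILetI false


/-! ## Part 1: positive definite ternary matrices, finiteness -/

lemma quadVal_eq_dot {R : Type*} [CommRing R] {k : ℕ} (M : Matrix (Fin k) (Fin k) R)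
    (x : Fin k → R) : quadVal M x = x ⬝ᵥ (M *ᵥ x) := by
  simp only [quadVal, dotProduct, mulVec, Finset.mul_sum]
  refine Finset.sum_congr rfl fun i _ => Finset.sum_congr rfl fun j _ => by ring

lemma quadVal_comp {R : Type*} [CommRing R] {k : ℕ} (M U : Matrix (Fin k) (Fin k) R)
    (x : Fin k → R) : quadVal (Uᵀ * M * U) x = quadVal M (U *ᵥ x) := by
  rw [quadVal_eq_dot, quadVal_eq_dot, ← mulVec_mulVec, ← mulVec_mulVec,
    dotProduct_mulVec x Uᵀ, vecMul_transpose]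

lemma quadVal_expand {R : Type*} [CommRing R] (M : Matrix (Fin 3) (Fin 3) R) (h : M.IsSymm)
    (x : Fin 3 → R) : quadVal M x = M 0 0 * x 0 ^ 2 + M 1 1 * x 1 ^ 2 + M 2 2 * x 2 ^ 2 +
      2 * (M 0 1 * x 0 * x 1 + M 0 2 * x 0 * x 2 + M 1 2 * x 1 * x 2) := by
  have h1 := h.apply 0 1
  have h2 := h.apply 0 2
  have h3 := h.apply 1 2
  simp only [quadVal, Fin.sum_univ_three]
  rw [h1, h2, h3]; ring

lemma det_expand {R : Type*} [CommRing R] (M : Matrix (Fin 3) (Fin 3) R) (h : M.IsSymm) :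
    M.det = M 0 0 * M 1 1 * M 2 2 + 2 * M 0 1 * M 0 2 * M 1 2 - M 0 0 * M 1 2 ^ 2
      - M 1 1 * M 0 2 ^ 2 - M 2 2 * M 0 1 ^ 2 := by
  have h1 := h.apply 0 1
  have h2 := h.apply 0 2
  have h3 := h.apply 1 2
  rw [det_fin_three, h1, h2, h3]; ring

lemma quadVal_smul {R : Type*} [CommRing R] {k : ℕ} (M : Matrix (Fin k) (Fin k) R) (c : R)
    (x : Fin k → R) : quadVal M (c • x) = c ^ 2 * quadVal M x := by
  simp only [quadVal, Finset.mul_sum, Pi.smul_apply, smul_eq_mul]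
  refine Finset.sum_congr rfl fun i _ => Finset.sum_congr rfl fun j _ => by ring

lemma symm_comp {R : Type*} [CommRing R] {k : ℕ} {M : Matrix (Fin k) (Fin k) R} (h : M.IsSymm)
    (U : Matrix (Fin k) (Fin k) R) : (Uᵀ * M * U).IsSymm := by
  unfold Matrix.IsSymm
  rw [transpose_mul, transpose_mul, transpose_transpose, h.eq, Matrix.mul_assoc]

lemma IsLat.pos00 {A : TernMat} (h : IsLat A) : 0 < A 0 0 := by
  have := h.2 ![1, 0, 0] (by intro h; simpa using congrFun h 0)
  rw [quadVal_expand _ h.1] at this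
  simpa using this

lemma IsLat.pos2 {A : TernMat} (h : IsLat A) : 0 < A 0 0 * A 1 1 - A 0 1 ^ 2 := by
  have h0 := h.pos00
  have := h.2 ![-A 0 1, A 0 0, 0] (by intro h; have := congrFun h 1; simp at this; omega)
  rw [quadVal_expand _ h.1] at this
  simp at this
  have h2 : 0 < A 0 0 * (A 0 0 * A 1 1 - A 0 1 ^ 2) := by linarith
  exact pos_of_mul_pos_right h2 h0.le

lemma IsLat.det_pos {A : TernMat} (h : IsLat A) : 0 < A.det := by
  have h0 := h.pos2
  have := h.2 ![A 0 1 * A 1 2 - A 0 2 * A 1 1, A 0 1 * A 0 2 - A 0 0 * A 1 2,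
    A 0 0 * A 1 1 - A 0 1 ^ 2] (by
      intro h; have := congrFun h 2; simp at this; omega)
  rw [quadVal_expand _ h.1] at this
  simp at this
  have h2 : 0 < (A 0 0 * A 1 1 - A 0 1 ^ 2) * A.det := by
    rw [det_expand _ h.1]; linarith
  exact pos_of_mul_pos_right h2 h0.le

/-- entrywise criterion -/
lemma isLat_of_minors {A : TernMat} (hs : A.IsSymm) (h0 : 0 < A 0 0)
    (h1 : 0 < A 0 0 * A 1 1 - A 0 1 ^ 2) (h2 : 0 < A.det) : IsLat A := by
  refine ⟨hs, fun x hx => ?_⟩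
  rw [det_expand _ hs] at h2
  rw [quadVal_expand _ hs]
  set D := A 0 0 * A 1 1 - A 0 1 ^ 2 with hD
  have key : A 0 0 * D * (A 0 0 * x 0 ^ 2 + A 1 1 * x 1 ^ 2 + A 2 2 * x 2 ^ 2 +
      2 * (A 0 1 * x 0 * x 1 + A 0 2 * x 0 * x 2 + A 1 2 * x 1 * x 2)) =
      D * (A 0 0 * x 0 + A 0 1 * x 1 + A 0 2 * x 2) ^ 2 +
      (D * x 1 + (A 0 0 * A 1 2 - A 0 1 * A 0 2) * x 2) ^ 2 +
      A 0 0 * (A 0 0 * A 1 1 * A 2 2 + 2 * A 0 1 * A 0 2 * A 1 2 - A 0 0 * A 1 2 ^ 2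
      - A 1 1 * A 0 2 ^ 2 - A 2 2 * A 0 1 ^ 2) * x 2 ^ 2 := by
    rw [hD]; ring
  set d := A 0 0 * A 1 1 * A 2 2 + 2 * A 0 1 * A 0 2 * A 1 2 - A 0 0 * A 1 2 ^ 2
      - A 1 1 * A 0 2 ^ 2 - A 2 2 * A 0 1 ^ 2
  have hp : 0 < A 0 0 * D := mul_pos h0 h1
  refine pos_of_mul_pos_right ?_ hp.le
  rw [key]
  have t1 : 0 ≤ D * (A 0 0 * x 0 + A 0 1 * x 1 + A 0 2 * x 2) ^ 2 := by positivity
  have t2 := sq_nonneg (D * x 1 + (A 0 0 * A 1 2 - A 0 1 * A 0 2) * x 2)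
  have t3 : 0 ≤ A 0 0 * d * x 2 ^ 2 := by positivity
  by_contra hneg
  have e3 : A 0 0 * d * x 2 ^ 2 = 0 := by linarith
  have x2 : x 2 = 0 := by
    have : A 0 0 * d ≠ 0 := by positivity
    simpa [this] using e3
  have e2 : (D * x 1 + (A 0 0 * A 1 2 - A 0 1 * A 0 2) * x 2) ^ 2 = 0 := by linarith
  have x1 : x 1 = 0 := by
    have : D ≠ 0 := h1.ne'
    simpa [x2, this] using e2
  have e1 : D * (A 0 0 * x 0 + A 0 1 * x 1 + A 0 2 * x 2) ^ 2 = 0 := by linarith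
  have x0 : x 0 = 0 := by
    simpa [x2, x1, h1.ne', h0.ne'] using e1
  exact hx (by ext i; fin_cases i <;> simp [x0, x1, x2])

/-- change of basis keeps positive-definiteness -/
lemma IsLat.comp {A : TernMat} (h : IsLat A) {U : TernMat} (hU : U.det ≠ 0) :
    IsLat (Uᵀ * A * U) := by
  refine ⟨symm_comp h.1 U, fun x hx => ?_⟩
  rw [quadVal_comp]
  refine h.2 _ fun h0 => hx ?_
  exact Matrix.eq_zero_of_mulVec_eq_zero hU h0

lemma unit_det_ne {U : TernMat} (h : IsUnit U.det) : U.det ≠ 0 := h.ne_zero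

lemma IsLat.bound2 {A : TernMat} (h : IsLat A) (x : Fin 3 → ℤ) :
    A.det * x 2 ^ 2 ≤ (A 0 0 * A 1 1 - A 0 1 ^ 2) * quadVal A x := by
  have h0 := h.pos00
  have h1 := h.pos2
  rw [det_expand _ h.1, quadVal_expand _ h.1]
  set D := A 0 0 * A 1 1 - A 0 1 ^ 2 with hD
  have key : A 0 0 * (D * (A 0 0 * x 0 ^ 2 + A 1 1 * x 1 ^ 2 + A 2 2 * x 2 ^ 2 +
      2 * (A 0 1 * x 0 * x 1 + A 0 2 * x 0 * x 2 + A 1 2 * x 1 * x 2)) -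
      (A 0 0 * A 1 1 * A 2 2 + 2 * A 0 1 * A 0 2 * A 1 2 - A 0 0 * A 1 2 ^ 2
      - A 1 1 * A 0 2 ^ 2 - A 2 2 * A 0 1 ^ 2) * x 2 ^ 2) =
      D * (A 0 0 * x 0 + A 0 1 * x 1 + A 0 2 * x 2) ^ 2 +
      (D * x 1 + (A 0 0 * A 1 2 - A 0 1 * A 0 2) * x 2) ^ 2  := by
    rw [hD]; ring
  have t1 : 0 ≤ D * (A 0 0 * x 0 + A 0 1 * x 1 + A 0 2 * x 2) ^ 2 := by positivity
  have t2 := sq_nonneg (D * x 1 + (A 0 0 * A 1 2 - A 0 1 * A 0 2) * x 2)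
  have t3 := add_nonneg t1 t2
  rw [← key] at t3
  have t4 := nonneg_of_mul_nonneg_right t3 h0
  linarith

/-- permute coordinates -/
lemma IsLat.perm {A : TernMat} (h : IsLat A) (e : Fin 3 ≃ Fin 3) : IsLat (A.submatrix e e) := by
  refine ⟨?_, fun x hx => ?_⟩
  · unfold Matrix.IsSymm
    rw [transpose_submatrix, h.1.eq]
  · have : quadVal (A.submatrix e e) x = quadVal A (x ∘ e.symm) := by
      unfold quadVal
      conv_rhs => rw [← Equiv.sum_comp e]
      refine Finset.sum_congr rfl fun i _ => ?_
      conv_rhs => rw [← Equiv.sum_comp e]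
      simp
    rw [this]
    refine h.2 _ fun h0 => hx ?_
    ext i
    simpa using congrFun h0 (e i)

lemma quadVal_perm (A : TernMat) (e : Fin 3 ≃ Fin 3) (x : Fin 3 → ℤ) :
    quadVal (A.submatrix e e) (x ∘ e) = quadVal A x := by
  unfold quadVal
  conv_rhs => rw [← Equiv.sum_comp e]
  refine Finset.sum_congr rfl fun i _ => ?_
  conv_rhs => rw [← Equiv.sum_comp e]
  simp

lemma IsLat.bound {A : TernMat} (h : IsLat A) : ∃ C : ℤ, 0 ≤ C ∧ ∀ x : Fin 3 → ℤ, ∀ i,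
    x i ^ 2 ≤ C * quadVal A x := by
  have key : ∀ i, ∃ C : ℤ, 0 ≤ C ∧ ∀ x : Fin 3 → ℤ, x i ^ 2 ≤ C * quadVal A x := by
    intro i
    have hp := h.perm (Equiv.swap i 2)
    set B := A.submatrix (Equiv.swap i 2) (Equiv.swap i 2) with hB
    refine ⟨B 0 0 * B 1 1 - B 0 1 ^ 2, hp.pos2.le, fun x => ?_⟩
    have := hp.bound2 (x ∘ Equiv.swap i 2)
    rw [quadVal_perm] at this
    have h1 := hp.det_pos
    simp only [Function.comp, Equiv.swap_apply_right] at this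
    nlinarith [sq_nonneg (x i)]
  choose C hC hCx using key
  refine ⟨∑ i, C i, Finset.sum_nonneg fun i _ => hC i, fun x i => (hCx i x).trans ?_⟩
  have hq : 0 ≤ quadVal A x := by
    by_cases hx : x = 0
    · subst hx; simp [quadVal]
    · exact (h.2 x hx).le
  exact mul_le_mul_of_nonneg_right (Finset.single_le_sum (fun i _ => hC i) (Finset.mem_univ i)) hq

lemma IsLat.finite_le {A : TernMat} (h : IsLat A) (n : ℤ) :
    {x : Fin 3 → ℤ | quadVal A x ≤ n}.Finite := by
  obtain ⟨C, hC, hb⟩ := h.bound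
  refine (Set.finite_Icc (fun _ => -(C * n)) (fun _ => C * n) : (Set.Icc (fun _ : Fin 3 => -(C * n)) (fun _ => C * n)).Finite).subset ?_
  intro x hx
  have hx' : quadVal A x ≤ n := hx
  have h2 : ∀ i, |x i| ≤ C * n := fun i => by
    have h3 := (hb x i).trans (mul_le_mul_of_nonneg_left hx' hC)
    have h4 : |x i| ≤ x i ^ 2 := by
      rw [← sq_abs]
      rcases (abs_nonneg (x i)).eq_or_lt with h | h
      · rw [← h]; norm_num
      · nlinarith
    exact h4.trans h3
  exact ⟨fun i => (abs_le.mp (h2 i)).1, fun i => (abs_le.mp (h2 i)).2⟩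

lemma IsLat.finite_eq {A : TernMat} (h : IsLat A) (n : ℤ) :
    {x : Fin 3 → ℤ | quadVal A x = n}.Finite :=
  (h.finite_le n).subset fun _ hx => le_of_eq hx

/-- Finite number of matrices `P` with `Pᵀ A P = B`. -/
lemma IsLat.finite_hom {A : TernMat} (h : IsLat A) (B : TernMat) :
    {P : TernMat | Pᵀ * A * P = B}.Finite := by
  have : (Set.pi Set.univ fun j : Fin 3 => {x : Fin 3 → ℤ | quadVal A x = B j j}).Finite :=
    Set.Finite.pi fun j => h.finite_eq _
  refine (this.preimage (f := fun P : TernMat => Pᵀ) (fun P _ Q _ h => ?_)).subset ?_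
  · exact Matrix.transpose_injective h
  · intro P hP j _
    have hP : Pᵀ * A * P = B := hP
    simp only [Set.mem_ofPred_eq]
    rw [← hP]
    simp only [quadVal, Matrix.mul_apply, Matrix.transpose_apply, Finset.sum_mul]
    rw [Finset.sum_comm]

lemma numAut_pos {A : TernMat} (h : IsLat A) : 0 < numAut A := by
  have : Finite {U : TernMat // IsUnit U.det ∧ Uᵀ * A * U = A} :=
    ((h.finite_hom A).subset fun U hU => hU.2 : {U : TernMat | IsUnit U.det ∧ Uᵀ * A * U = A}.Finite)
  have : Nonempty {U : TernMat // IsUnit U.det ∧ Uᵀ * A * U = A} := ⟨⟨1, by simp⟩⟩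
  exact Nat.card_pos

lemma LatIsom.refl (A : TernMat) : LatIsom A A := ⟨1, by simp⟩

lemma LatIsom.symm {A B : TernMat} (h : LatIsom A B) : LatIsom B A := by
  obtain ⟨U, hU, rfl⟩ := h
  refine ⟨U⁻¹, by rw [Matrix.isUnit_nonsing_inv_det_iff]; exact hU, ?_⟩
  rw [transpose_nonsing_inv]
  have hU' : IsUnit Uᵀ.det := by rwa [det_transpose]
  rw [Matrix.mul_assoc, Matrix.mul_assoc, Matrix.mul_assoc, Matrix.mul_nonsing_inv _ hU,
    Matrix.mul_one, ← Matrix.mul_assoc, Matrix.nonsing_inv_mul _ hU', Matrix.one_mul]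

lemma LatIsom.trans {A B C : TernMat} (h : LatIsom A B) (h' : LatIsom B C) : LatIsom A C := by
  obtain ⟨U, hU, rfl⟩ := h
  obtain ⟨V, hV, rfl⟩ := h'
  exact ⟨U * V, by rw [det_mul]; exact hU.mul hV, by
    simp only [transpose_mul, Matrix.mul_assoc]⟩

lemma LatIsom.det_eq {A B : TernMat} (h : LatIsom A B) : B.det = A.det := by
  obtain ⟨U, hU, rfl⟩ := h
  rw [det_mul, det_mul, det_transpose]
  rcases Int.isUnit_iff.mp hU with h | h <;> rw [h] <;> ring

lemma LatIsom.isLat {A B : TernMat} (h : LatIsom A B) (hA : IsLat A) : IsLat B := by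
  obtain ⟨U, hU, rfl⟩ := h
  exact hA.comp hU.ne_zero

lemma comp_apply' {R : Type*} [CommRing R] (U A : Matrix (Fin 3) (Fin 3) R) (i j : Fin 3) :
    (Uᵀ * A * U) i j = ∑ k, ∑ l, U k i * A k l * U l j := by
  simp only [Matrix.mul_apply, Matrix.transpose_apply, Finset.sum_mul]
  rw [Finset.sum_comm]

/-- First size used for reduction. -/
def redMinor (C : TernMat) : ℤ := C 0 0 * C 1 1 - C 0 1 ^ 2

lemma shear01 {C : TernMat} (hs : C.IsSymm) (k : ℤ) : ∃ C', LatIsom C C' ∧ C' 0 0 = C 0 0 ∧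
    C' 0 1 = C 0 1 + k * C 0 0 ∧ redMinor C' = redMinor C := by
  have h1 := hs.apply 0 1
  refine ⟨_, ⟨!![1, k, 0; 0, 1, 0; 0, 0, 1], by simp [det_fin_three], rfl⟩, ?_, ?_, ?_⟩
  all_goals
    simp only [redMinor, comp_apply', Fin.sum_univ_three]
    simp
    try rw [h1]
    try ring

lemma shear12 {C : TernMat} (hs : C.IsSymm) (k : ℤ) : ∃ C', LatIsom C C' ∧ C' 0 0 = C 0 0 ∧
    C' 0 1 = C 0 1 ∧ C' 1 1 = C 1 1 ∧ C' 0 2 = C 0 2 + k * C 0 1 ∧ C' 1 2 = C 1 2 + k * C 1 1 := by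
  refine ⟨_, ⟨!![1, 0, 0; 0, 1, k; 0, 0, 1], by simp [det_fin_three], rfl⟩, ?_, ?_, ?_, ?_, ?_⟩
  all_goals
    simp only [comp_apply', Fin.sum_univ_three]
    simp
    try ring

lemma shear2 {C : TernMat} (hs : C.IsSymm) (x y : ℤ) : ∃ C', LatIsom C C' ∧ C' 0 0 = C 0 0 ∧
    C' 0 1 = C 0 1 ∧ C' 1 1 = C 1 1 ∧ C' 0 2 = C 0 2 + x * C 0 0 + y * C 0 1 ∧
    C' 1 2 = C 1 2 + x * C 0 1 + y * C 1 1 := by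
  have h1 := hs.apply 0 1
  refine ⟨_, ⟨!![1, 0, x; 0, 1, y; 0, 0, 1], by simp [det_fin_three], rfl⟩, ?_, ?_, ?_, ?_, ?_⟩
  all_goals
    simp only [comp_apply', Fin.sum_univ_three]
    simp
    try rw [h1]
    try ring

lemma swap01 (C : TernMat) : ∃ C', LatIsom C C' ∧ C' 0 0 = C 1 1 ∧
    C' 0 1 = C 1 0 ∧ C' 1 1 = C 0 0 := by
  refine ⟨_, ⟨!![0, 1, 0; 1, 0, 0; 0, 0, 1], by simp [det_fin_three], rfl⟩, ?_, ?_, ?_⟩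
  all_goals
    simp only [comp_apply', Fin.sum_univ_three]
    simp

lemma swap12 (C : TernMat) : ∃ C', LatIsom C C' ∧ C' 0 0 = C 0 0 ∧
    C' 0 1 = C 0 2 ∧ C' 1 1 = C 2 2 := by
  refine ⟨_, ⟨!![1, 0, 0; 0, 0, 1; 0, 1, 0], by simp [det_fin_three], rfl⟩, ?_, ?_, ?_⟩
  all_goals
    simp only [comp_apply', Fin.sum_univ_three]
    simp

lemma exists_bal (a m : ℤ) (hm : 0 < m) : ∃ k : ℤ, |2 * (a + k * m)| ≤ m := by
  refine ⟨-((2 * a + m) / (2 * m)), ?_⟩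
  have h1 := Int.emod_add_mul_ediv (2 * a + m) (2 * m)
  have h2 := Int.emod_nonneg (2 * a + m) (by omega : (2 * m) ≠ 0)
  have h3 := Int.emod_lt_of_pos (2 * a + m) (by omega : 0 < 2 * m)
  set q := (2 * a + m) / (2 * m)
  rw [abs_le]
  constructor <;> nlinarith

lemma four_sq_le {x D : ℤ} (h : |2 * x| ≤ D) : 4 * x ^ 2 ≤ D ^ 2 := by
  have h1 : |2 * x| ^ 2 ≤ D ^ 2 := pow_le_pow_left₀ (abs_nonneg _) h 2
  rw [sq_abs] at h1
  linarith

lemma red_b2 {X D y e : ℤ} (hD : 0 < D) (h : D ≤ X) (hi : X * D - y = e) (hy : 4 * y ≤ D ^ 2) :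
    3 * D ^ 2 ≤ 4 * e := by
  have := mul_le_mul_of_nonneg_right h hD.le
  linarith

lemma red_b4 {a D d : ℤ} (q0 : 0 < a) (q1 : 0 < D) (hd : 0 < d) (b1 : 3 * a ^ 2 ≤ 4 * D)
    (b2 : 3 * D ^ 2 ≤ 4 * (a * d)) : a ≤ 3 * d := by
  have h1 : (3 * a ^ 2) ^ 2 ≤ (4 * D) ^ 2 := pow_le_pow_left₀ (by positivity) b1 2
  have h5 : a * (27 * a ^ 3) ≤ a * (64 * d) := by linarith
  have h6 := le_of_mul_le_mul_left h5 q0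
  have h7 : a ≤ a ^ 3 := le_self_pow₀ q0 (by norm_num)
  linarith

lemma red_b5 {a D d : ℤ} (q1 : 0 < D) (hd : 0 < d) (h : a ≤ 3 * d)
    (b2 : 3 * D ^ 2 ≤ 4 * (a * d)) : D ≤ 4 * d ^ 2 := by
  have h7 : D ≤ D ^ 2 := le_self_pow₀ q1 (by norm_num)
  have := mul_le_mul_of_nonneg_right h hd.le
  linarith

lemma exists_reduced {B : TernMat} (hB : IsLat B) : ∃ C, LatIsom B C ∧ C 0 0 ≤ 3 * B.det ∧
    redMinor C ≤ 4 * B.det ^ 2 ∧ |2 * C 0 1| ≤ C 0 0 ∧ 0 ≤ C 0 2 ∧ C 0 2 < redMinor C ∧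
    0 ≤ C 1 2 ∧ C 1 2 < redMinor C := by
  -- choose a minimal element
  have hex : ∃ N : ℕ, ∃ C, LatIsom B C ∧ (C 0 0 + redMinor C).toNat = N := ⟨_, B, LatIsom.refl B, rfl⟩
  obtain ⟨C0, hC0, hN⟩ := Nat.find_spec hex
  have hmin : ∀ C, LatIsom B C → C0 0 0 + redMinor C0 ≤ C 0 0 + redMinor C := by
    intro C hC
    have h1 := Nat.find_min' hex ⟨C, hC, rfl⟩
    rw [← hN] at h1
    have p1 := (hC.isLat hB).pos00
    have p2 := (hC.isLat hB).pos2
    unfold redMinor at *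
    omega
  have p0 := (hC0.isLat hB).pos00
  obtain ⟨k, hk⟩ := exists_bal (C0 0 1) (C0 0 0) p0
  obtain ⟨C1, hC1, e00, e01, eM⟩ := shear01 (hC0.isLat hB).1 k
  rw [← e01, ← e00] at hk
  have hBC1 := hC0.trans hC1
  have hl1 := hBC1.isLat hB
  obtain ⟨j, hj⟩ := exists_bal (C1 0 0 * C1 1 2 - C1 0 1 * C1 0 2) (redMinor C1) hl1.pos2
  obtain ⟨C2, hC2, f00, f01, f11, f02, f12⟩ := shear12 hl1.1 j
  have hBC2 := hBC1.trans hC2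
  have hl2 := hBC2.isLat hB
  have hM2 : redMinor C2 = redMinor C1 := by unfold redMinor; rw [f00, f01, f11]
  have hj2 : |2 * (C2 0 0 * C2 1 2 - C2 0 1 * C2 0 2)| ≤ redMinor C2 := by
    rw [hM2]
    convert hj using 3
    rw [f00, f01, f02, f12]; unfold redMinor; ring
  rw [← f00, ← f01] at hk
  have hmin2 : ∀ C, LatIsom B C → C2 0 0 + redMinor C2 ≤ C 0 0 + redMinor C := by
    rw [f00, hM2, e00, eM]; exact hmin
  have q0 := hl2.pos00
  have q1 : 0 < redMinor C2 := hl2.pos2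
  have qd := hl2.det_pos
  have hd : C2.det = B.det := hBC2.det_eq
  -- swaps
  obtain ⟨S, hS, s00, s01, s11⟩ := swap01 C2
  have i1 := hmin2 S (hBC2.trans hS)
  obtain ⟨T, hT, t00, t01, t11⟩ := swap12 C2
  have i2 := hmin2 T (hBC2.trans hT)
  have c10 := hl2.1.apply 0 1
  have hMS : redMinor S = redMinor C2 := by unfold redMinor; rw [s00, s01, s11, c10]; ring
  have hMT : redMinor T = C2 0 0 * C2 2 2 - C2 0 2 ^ 2 := by unfold redMinor; rw [t00, t01, t11]
  have i1' : C2 0 0 ≤ C2 1 1 := by rw [s00, hMS] at i1; linarith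
  have i2' : redMinor C2 ≤ C2 0 0 * C2 2 2 - C2 0 2 ^ 2 := by rw [t00, hMT] at i2; linarith
  have idn : (C2 0 0 * C2 2 2 - C2 0 2 ^ 2) * redMinor C2 - (C2 0 0 * C2 1 2 - C2 0 1 * C2 0 2) ^ 2
      = C2 0 0 * B.det := by
    rw [← hd, det_expand _ hl2.1]; unfold redMinor; ring
  have sq1 := four_sq_le hj2
  have sq2 := four_sq_le hk
  have b1 : 3 * C2 0 0 ^ 2 ≤ 4 * redMinor C2 :=
    red_b2 q0 i1' (by unfold redMinor; ring) sq2
  have b2 : 3 * redMinor C2 ^ 2 ≤ 4 * (C2 0 0 * B.det) := red_b2 q1 i2' idn sq1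
  have hdpos : 0 < B.det := by rw [← hd]; exact qd
  have b4 := red_b4 q0 q1 hdpos b1 b2
  have b5 := red_b5 q1 hdpos b4 b2
  clear sq1 sq2 b1 b2 idn
  set a := C2 0 0 with ha
  set D := redMinor C2 with hD
  -- final shear
  set s := C2 0 2 / D
  set t := C2 1 2 / D
  obtain ⟨C3, hC3, g00, g01, g11, g02, g12⟩ :=
    shear2 hl2.1 (-(C2 1 1 * s - C2 0 1 * t)) (-(a * t - C2 0 1 * s))
  have hM3 : redMinor C3 = D := by rw [hD]; unfold redMinor; rw [g00, g01, g11]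
  have hDe : D = a * C2 1 1 - C2 0 1 ^ 2 := rfl
  have g02' : C3 0 2 = C2 0 2 % D := by
    rw [Int.emod_def]
    change _ = _ - D * s
    rw [g02, ← ha]
    linear_combination s * hDe
  have g12' : C3 1 2 = C2 1 2 % D := by
    rw [Int.emod_def]
    change _ = _ - D * t
    rw [g12]
    linear_combination t * hDe
  refine ⟨C3, hBC2.trans hC3, by rw [g00]; exact b4, by rw [hM3]; exact b5, by rw [g00, g01]; exact hk,
    ?_, ?_, ?_, ?_⟩
  · rw [g02']; exact Int.emod_nonneg _ q1.ne'
  · rw [g02', hM3]; exact Int.emod_lt_of_pos _ q1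
  · rw [g12']; exact Int.emod_nonneg _ q1.ne'
  · rw [g12', hM3]; exact Int.emod_lt_of_pos _ q1

/-- The finite set of reduced matrices of given determinant. -/
def redSet (d : ℤ) : Set TernMat := {C | IsLat C ∧ C.det = d ∧ C 0 0 ≤ 3 * d ∧
    redMinor C ≤ 4 * d ^ 2 ∧ |2 * C 0 1| ≤ C 0 0 ∧ 0 ≤ C 0 2 ∧ C 0 2 < redMinor C ∧
    0 ≤ C 1 2 ∧ C 1 2 < redMinor C}

lemma redSet_finite (d : ℤ) : (redSet d).Finite := by
  let K : ℤ := 3 * d + 4 * d ^ 2 + 9 * d ^ 2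
  let φ : TernMat → ℤ × ℤ × ℤ × ℤ × ℤ := fun C => (C 0 0, C 0 1, C 1 1, C 0 2, C 1 2)
  have hfin : (Set.Icc (-K) K ×ˢ Set.Icc (-K) K ×ˢ Set.Icc (-K) K ×ˢ Set.Icc (-K) K ×ˢ
      Set.Icc (-K) K : Set (ℤ × ℤ × ℤ × ℤ × ℤ)).Finite := by
    have := Set.finite_Icc (-K) K
    exact this.prod (this.prod (this.prod (this.prod this)))
  refine Set.Finite.of_finite_image (f := φ) (hfin.subset ?_) ?_
  · rintro _ ⟨C, ⟨hl, hd, h1, h2, h3, h4, h5, h6, h7⟩, rfl⟩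
    have p0 := hl.pos00
    have p1 : 0 < redMinor C := hl.pos2
    have p2 := hl.det_pos
    rw [hd] at p2
    have h3' := abs_le.mp h3
    have hm : redMinor C = C 0 0 * C 1 1 - C 0 1 ^ 2 := rfl
    have c11 : 0 < C 1 1 := by
      have : 0 < C 0 0 * C 1 1 := by nlinarith [sq_nonneg (C 0 1)]
      exact pos_of_mul_pos_right this p0.le
    have c11' : C 1 1 ≤ 4 * d ^ 2 + 9 * d ^ 2 := by
      have : C 1 1 ≤ C 0 0 * C 1 1 := by nlinarith
      have h9 : C 0 1 ^ 2 ≤ 9 * d ^ 2 := by nlinarith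
      nlinarith
    simp only [φ, K, Set.mem_prod, Set.mem_Icc]
    have := sq_nonneg d
    refine ⟨⟨?_, ?_⟩, ⟨?_, ?_⟩, ⟨?_, ?_⟩, ⟨?_, ?_⟩, ?_, ?_⟩ <;> linarith
  · rintro C hC C' hC' he
    obtain ⟨hl, hd, -⟩ := hC
    obtain ⟨hl', hd', -⟩ := hC'
    simp only [φ, Prod.mk.injEq] at he
    obtain ⟨e1, e2, e3, e4, e5⟩ := he
    have e6 : C 2 2 = C' 2 2 := by
      have p2 := hl.pos2
      rw [det_expand _ hl.1] at hd
      rw [det_expand _ hl'.1, ← e1, ← e2, ← e3, ← e4, ← e5] at hd'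
      have : (C 0 0 * C 1 1 - C 0 1 ^ 2) * C 2 2 = (C 0 0 * C 1 1 - C 0 1 ^ 2) * C' 2 2 := by
        linear_combination hd - hd'
      exact mul_left_cancel₀ p2.ne' this
    have a1 := hl.1.apply 0 1
    have a2 := hl.1.apply 0 2
    have a3 := hl.1.apply 1 2
    have b1 := hl'.1.apply 0 1
    have b2 := hl'.1.apply 0 2
    have b3 := hl'.1.apply 1 2
    ext i j
    fin_cases i <;> fin_cases j <;> simp_all

lemma finite_quot_of_det {p : TernMat → Prop} {d : ℤ} (hp : ∀ B, p B → IsLat B ∧ B.det = d) :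
    Finite (Quot fun B C : {B : TernMat // p B} => LatIsom B.1 C.1) := by
  have hch : ∀ c : Quot fun B C : {B : TernMat // p B} => LatIsom B.1 C.1,
      ∃ C ∈ redSet d, LatIsom (Quot.out c).1 C := by
    intro c
    obtain ⟨hl, hd⟩ := hp _ (Quot.out c).2
    obtain ⟨C, hC, h⟩ := exists_reduced hl
    rw [hd] at h
    exact ⟨C, ⟨hC.isLat hl, hC.det_eq.trans hd, h⟩, hC⟩
  choose f hf hf2 using hch
  have := (redSet_finite d).to_subtype
  refine Finite.of_injective (fun c => (⟨f c, hf c⟩ : redSet d)) fun c c' h => ?_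
  have h' : f c = f c' := congrArg Subtype.val h
  rw [← Quot.out_eq c, ← Quot.out_eq c']
  refine Quot.sound ((hf2 c).trans ?_)
  rw [h']; exact (hf2 c').symm


/-- A complete irredundant system of representatives. -/
def RepSys (p : TernMat → Prop) {ι : Type*} (E : ι → TernMat) : Prop :=
  (∀ i, p (E i)) ∧ (∀ B, p B → ∃ i, LatIsom (E i) B) ∧ ∀ i j, LatIsom (E i) (E j) → i = j

/-- Factorization property. -/
def FacProp (q : TernMat → Prop) (A : TernMat) {α : Type*} (T : α → TernMat) : Prop :=
  (∀ a, ∃ G, q G ∧ (T a)ᵀ * A * T a = (2 : ℤ) • G) ∧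
  (∀ P G, q G → Pᵀ * A * P = (2 : ℤ) • G → ∃ a U, IsUnit U.det ∧ P = T a * U) ∧
  (∀ a b U, IsUnit U.det → T a = T b * U → a = b) ∧ ∀ a, (T a).det ≠ 0

/-- The set of scaled homs. -/
abbrev Hom2 (A B : TernMat) := {P : TernMat // Pᵀ * A * P = (2 : ℤ) • B}

/-- isometries -/
abbrev Isos (A B : TernMat) := {U : TernMat // IsUnit U.det ∧ Uᵀ * A * U = B}

lemma finite_Hom2 {A : TernMat} (hA : IsLat A) (B : TernMat) : Finite (Hom2 A B) :=
  (hA.finite_hom ((2 : ℤ) • B)).to_subtype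

lemma finite_Isos {A : TernMat} (hA : IsLat A) (B : TernMat) : Finite (Isos A B) :=
  ((hA.finite_hom B).subset (fun U hU => hU.2) : {U : TernMat | IsUnit U.det ∧ Uᵀ * A * U = B}.Finite).to_subtype

lemma unit_inv {U : TernMat} (h : IsUnit U.det) : IsUnit (U⁻¹).det ∧ U * U⁻¹ = 1 ∧ U⁻¹ * U = 1 :=
  ⟨by rw [det_nonsing_inv]; exact h.ringInverse, mul_nonsing_inv _ h, nonsing_inv_mul _ h⟩

lemma comp_comp (U V A : TernMat) : (U * V)ᵀ * A * (U * V) = Vᵀ * (Uᵀ * A * U) * V := by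
  rw [transpose_mul]; simp only [Matrix.mul_assoc]

lemma card_Isos {A B : TernMat} (h : LatIsom A B) : Nat.card (Isos A B) = numAut B := by
  obtain ⟨W, hW, e⟩ := h
  obtain ⟨h1, h2, h3⟩ := unit_inv hW
  unfold numAut
  refine Nat.card_congr ⟨fun U => ⟨W⁻¹ * U.1, ?_, ?_⟩, fun V => ⟨W * V.1, ?_, ?_⟩, ?_, ?_⟩
  · rw [det_mul]; exact h1.mul U.2.1
  · have e2 : (W⁻¹)ᵀ * B * W⁻¹ = A := by rw [← e, ← comp_comp, h2]; simp
    rw [comp_comp, e2]; exact U.2.2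
  · rw [det_mul]; exact hW.mul V.2.1
  · rw [comp_comp, e]; exact V.2.2
  · intro U; ext1; simp only; rw [← Matrix.mul_assoc, h2, Matrix.one_mul]
  · intro U; ext1; simp only; rw [← Matrix.mul_assoc, h3, Matrix.one_mul]

lemma card_Isos_zero {A B : TernMat} (h : ¬LatIsom A B) : Nat.card (Isos A B) = 0 := by
  have : IsEmpty (Isos A B) := ⟨fun U => h ⟨U.1, U.2⟩⟩
  exact Nat.card_of_isEmpty

lemma mul_left_cancel_det {T U V : TernMat} (hT : T.det ≠ 0) (h : T * U = T * V) : U = V := by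
  have h2 := congrArg (fun M => T.adjugate * M) h
  simp only [← Matrix.mul_assoc, adjugate_mul, Matrix.smul_mul, Matrix.one_mul] at h2
  exact smul_right_injective _ hT h2

lemma two_smul_inj {A B : TernMat} (h : (2 : ℤ) • A = (2 : ℤ) • B) : A = B :=
  smul_right_injective _ (two_ne_zero) h

lemma sum_one_side {q : TernMat → Prop} {κ : Type*} [Fintype κ] {L : κ → TernMat}
    (hL : RepSys q L) (hq : ∀ B, q B → IsLat B) {A : TernMat} (hA : IsLat A) {α : Type*} [Fintype α]
    {T : α → TernMat} (hT : FacProp q A T) (w : TernMat → ℝ)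
    (hw : ∀ P U, IsUnit U.det → w (P * U) = w P) :
    ∑ j, (∑ᶠ P : Hom2 A (L j), w P.1) / (numAut (L j) : ℝ) = ∑ a, w (T a) := by
  obtain ⟨h1, h2, h3, h4⟩ := hT
  choose G hG eG using h1
  have key : ∀ j, ∑ᶠ P : Hom2 A (L j), w P.1 = ∑ a, w (T a) * (Nat.card (Isos (G a) (L j)) : ℝ) := by
    intro j
    have := fun a => finite_Isos (hq _ (hG a)) (L j)
    letI := fun a => Fintype.ofFinite (Isos (G a) (L j))
    have := finite_Hom2 hA (L j)
    letI := Fintype.ofFinite (Hom2 A (L j))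
    let φ : (Σ a, Isos (G a) (L j)) → Hom2 A (L j) := fun x => ⟨T x.1 * x.2.1, by
      rw [comp_comp, eG, Matrix.mul_smul, Matrix.smul_mul, x.2.2.2]⟩
    have hφ : Function.Bijective φ := by
      constructor
      · rintro ⟨a, U, hU, eU⟩ ⟨b, V, hV, eV⟩ h
        have h' : T a * U = T b * V := congrArg Subtype.val h
        obtain ⟨i1, i2, i3⟩ := unit_inv hU
        have hab : a = b := by
          refine h3 a b (V * U⁻¹) (by rw [det_mul]; exact hV.mul i1) ?_
          rw [← Matrix.mul_assoc, ← h', Matrix.mul_assoc, i2, Matrix.mul_one]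
        subst hab
        have := mul_left_cancel_det (h4 a) h'
        subst this
        rfl
      · rintro ⟨P, hP⟩
        obtain ⟨a, U, hU, e⟩ := h2 P (L j) (hL.1 j) hP
        refine ⟨⟨a, U, hU, ?_⟩, ?_⟩
        · subst e
          rw [comp_comp, eG, Matrix.mul_smul, Matrix.smul_mul] at hP
          exact two_smul_inj hP
        · ext1; exact e.symm
    rw [finsum_eq_sum_of_fintype]
    rw [← Function.Bijective.sum_comp hφ (fun P => w P.1)]
    rw [Fintype.sum_sigma]
    refine Finset.sum_congr rfl fun a _ => ?_
    simp only [φ]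
    rw [Finset.sum_congr rfl (fun U _ => hw (T a) U.1 U.2.1)]
    rw [Finset.sum_const, Nat.card_eq_fintype_card]
    simp [mul_comm]
  simp_rw [key, Finset.sum_div]
  rw [Finset.sum_comm]
  refine Finset.sum_congr rfl fun a _ => ?_
  obtain ⟨j0, hj0⟩ := hL.2.1 (G a) (hG a)
  rw [Finset.sum_eq_single j0]
  · rw [card_Isos hj0.symm, mul_div_assoc, div_self, mul_one]
    exact_mod_cast (numAut_pos (hq _ (hL.1 j0))).ne'
  · intro j _ hj
    rw [card_Isos_zero]
    · simp
    · intro h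
      exact hj (hL.2.2 j j0 (hj0.trans h).symm)
  · simp

lemma dual_exists {A B : TernMat} {d : ℤ} (hd : d ≠ 0) (hA : A.det = 2 * d) (hB : B.det = d)
    {P : TernMat} (hP : Pᵀ * A * P = (2 : ℤ) • B) :
    ∃ P', P * P' = (2 : ℤ) • (1 : TernMat) ∧ P' * P = (2 : ℤ) • (1 : TernMat) ∧ P'ᵀ * B * P' = (2 : ℤ) • A := by
  have h1 := congrArg Matrix.det hP
  rw [det_mul, det_mul, det_transpose, det_smul, hA, hB] at h1
  simp at h1
  have h2 : P.det ^ 2 = 4 := by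
    have : d * (P.det ^ 2) = d * 4 := by linarith
    exact mul_left_cancel₀ hd this
  have h3 : P.det = 2 ∨ P.det = -2 := by
    have : (P.det - 2) * (P.det + 2) = 0 := by linear_combination h2
    rcases mul_eq_zero.mp this with h | h
    · left; linarith
    · right; linarith
  have key : ∃ P', P * P' = (2 : ℤ) • (1 : TernMat) ∧ P' * P = (2 : ℤ) • (1 : TernMat) := by
    rcases h3 with h | h
    · exact ⟨P.adjugate, by rw [mul_adjugate, h], by rw [adjugate_mul, h]⟩
    · exact ⟨-P.adjugate, by rw [Matrix.mul_neg, mul_adjugate, h]; simp,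
        by rw [Matrix.neg_mul, adjugate_mul, h]; simp⟩
  obtain ⟨P', e1, e2⟩ := key
  refine ⟨P', e1, e2, ?_⟩
  apply two_smul_inj
  have : P'ᵀ * ((2 : ℤ) • B) * P' = (2:ℤ) • ((2 : ℤ) • A) := by
    rw [← hP, ← comp_comp, e1, transpose_smul, transpose_one, Matrix.smul_mul, Matrix.one_mul,
      Matrix.mul_smul, Matrix.mul_one]
  rw [Matrix.mul_smul, Matrix.smul_mul] at this
  exact this


lemma scal_symm {P P' : TernMat} (h : P * P' = (2 : ℤ) • (1 : TernMat)) : P' * P = (2 : ℤ) • (1 : TernMat) := by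
  have h0 : P.det ≠ 0 := by
    intro h0
    have := congrArg Matrix.det h
    rw [det_mul, h0, det_smul] at this
    simp at this
  apply mul_left_cancel_det h0
  rw [← Matrix.mul_assoc, h, Matrix.smul_mul, Matrix.one_mul, Matrix.mul_smul, Matrix.mul_one]

lemma hom2_dual {A B P P' : TernMat} (h : P * P' = (2 : ℤ) • (1 : TernMat))
    (hP : Pᵀ * A * P = (2 : ℤ) • B) : P'ᵀ * B * P' = (2 : ℤ) • A := by
  apply two_smul_inj
  have : P'ᵀ * ((2 : ℤ) • B) * P' = (2:ℤ) • ((2 : ℤ) • A) := by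
    rw [← hP, ← comp_comp, h, transpose_smul, transpose_one, Matrix.smul_mul, Matrix.one_mul,
      Matrix.mul_smul, Matrix.mul_one]
  rw [Matrix.mul_smul, Matrix.smul_mul] at this
  exact this

theorem dcount {p q : TernMat → Prop} {ι κ : Type*} [Fintype ι] [Fintype κ] {E : ι → TernMat}
    {L : κ → TernMat} (hE : RepSys p E) (hL : RepSys q L) (hp : ∀ B, p B → IsLat B)
    (hq : ∀ B, q B → IsLat B) {d : ℤ} (hd : d ≠ 0) (hdE : ∀ i, (E i).det = 2 * d)
    (hdL : ∀ j, (L j).det = d) {α β : Type*} [Fintype α] [Fintype β]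
    {T : α → TernMat} {S : β → TernMat} (hT : ∀ i, FacProp q (E i) T) (hS : ∀ j, FacProp p (L j) S)
    (hS2 : ∀ b, ∃ S', S b * S' = (2 : ℤ) • (1 : TernMat))
    (w w' : TernMat → TernMat → ℝ)
    (hw : ∀ A P U, IsUnit U.det → w A (P * U) = w A P)
    (hw' : ∀ A P U, IsUnit U.det → w' A (P * U) = w' A P)
    (hww : ∀ A B P P', p A → q B → Pᵀ * A * P = (2 : ℤ) • B → P'ᵀ * B * P' = (2 : ℤ) • A →
      P * P' = (2 : ℤ) • (1 : TernMat) → P' * P = (2 : ℤ) • (1 : TernMat) → w A P = w' B P') :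
    ∑ i, (∑ a, w (E i) (T a)) / (numAut (E i) : ℝ) =
    ∑ j, (∑ b, w' (L j) (S b)) / (numAut (L j) : ℝ) := by
  have key : ∀ i j, ∑ᶠ P : Hom2 (E i) (L j), w (E i) P.1 = ∑ᶠ P : Hom2 (L j) (E i), w' (L j) P.1 := by
    intro i j
    have hP := fun P : Hom2 (E i) (L j) => dual_exists hd (hdE i) (hdL j) P.2
    choose f f1 f2 f3 using hP
    refine finsum_eq_of_bijective (fun P => ⟨f P, f3 P⟩) ⟨?_, ?_⟩ ?_
    · intro P Q h
      have h' : f P = f Q := congrArg Subtype.val h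
      ext1
      have hdet : (f P).det ≠ 0 := by
        intro h0
        have := congrArg Matrix.det (f1 P)
        rw [det_mul, h0, det_smul] at this
        simp at this
      apply mul_left_cancel_det hdet
      rw [f2]
      rw [h', f2]
    · rintro ⟨P', hP'⟩
      obtain ⟨b, U, hU, e⟩ := (hS j).2.1 P' (E i) (hE.1 i) hP'
      obtain ⟨S', hS'⟩ := hS2 b
      obtain ⟨i1, i2, i3⟩ := unit_inv hU
      have e1 : P' * (U⁻¹ * S') = (2 : ℤ) • (1 : TernMat) := by
        rw [e, Matrix.mul_assoc, ← Matrix.mul_assoc U, i2, Matrix.one_mul, hS']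
      refine ⟨⟨U⁻¹ * S', hom2_dual e1 hP'⟩, ?_⟩
      ext1
      have hdet : (U⁻¹ * S').det ≠ 0 := by
        intro h0
        have := congrArg Matrix.det e1
        rw [det_mul, h0, det_smul] at this
        simp at this
      apply mul_left_cancel_det hdet
      change (U⁻¹ * S') * f _ = _
      have := f1 ⟨U⁻¹ * S', hom2_dual e1 hP'⟩
      rw [this, scal_symm e1]
    · intro P
      exact hww _ _ _ _ (hE.1 i) (hL.1 j) P.2 (f3 P) (f1 P) (f2 P)
  have h1 := fun i => sum_one_side hL hq (hp _ (hE.1 i)) (hT i) (w (E i)) (hw _)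
  have h2 := fun j => sum_one_side hE hp (hq _ (hL.1 j)) (hS j) (w' (L j)) (hw' _)
  simp_rw [← h1, ← h2, Finset.sum_div]
  rw [Finset.sum_comm]
  refine Finset.sum_congr rfl fun j _ => Finset.sum_congr rfl fun i _ => ?_
  rw [key i j, div_div, div_div, mul_comm]

lemma isos_symm {A B U : TernMat} (hU : IsUnit U.det) (e : Uᵀ * A * U = B) :
    (U⁻¹)ᵀ * B * U⁻¹ = A := by
  rw [← e, ← comp_comp, (unit_inv hU).2.1]; simp

lemma numAut_congr {A B : TernMat} (h : LatIsom A B) : numAut A = numAut B := by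
  rw [← card_Isos h, ← card_Isos h.symm]
  refine Nat.card_congr ⟨fun U => ⟨U.1⁻¹, (unit_inv U.2.1).1, isos_symm U.2.1 U.2.2⟩,
    fun U => ⟨U.1⁻¹, (unit_inv U.2.1).1, isos_symm U.2.1 U.2.2⟩, ?_, ?_⟩
  · intro U; ext1; exact nonsing_inv_nonsing_inv _ U.2.1
  · intro U; ext1; exact nonsing_inv_nonsing_inv _ U.2.1

/-- The class quotient. -/
abbrev ClassQuot (p : TernMat → Prop) := Quot fun B C : {B : TernMat // p B} => LatIsom B.1 C.1

lemma classQuot_eq {p : TernMat → Prop} (B C : {B : TernMat // p B}) :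
    (Quot.mk _ B : ClassQuot p) = Quot.mk _ C ↔ LatIsom B.1 C.1 := by
  constructor
  · intro h
    have h2 := Quot.eqvGen_exact h
    clear h
    induction h2 with
    | rel x y h => exact h
    | refl x => exact LatIsom.refl _
    | symm x y _ ih => exact ih.symm
    | trans x y z _ _ i1 i2 => exact i1.trans i2
  · intro h; exact Quot.sound h

lemma classQuot_out {p : TernMat → Prop} (B : {B : TernMat // p B}) :
    LatIsom (Quot.out (Quot.mk _ B : ClassQuot p)).1 B.1 :=
  (classQuot_eq _ _).mp (Quot.out_eq _)

lemma exists_repSys {p N : TernMat → Prop} (hp : ∀ B C, p B → LatIsom B C → p C)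
    (hN : ∀ B, p B → ∃ C, LatIsom B C ∧ N C) :
    ∃ E : ClassQuot p → TernMat, RepSys p E ∧ (∀ c, N (E c)) ∧ ∀ c, LatIsom (Quot.out c).1 (E c) := by
  choose f hf hf' using hN
  refine ⟨fun c => f (Quot.out c).1 (Quot.out c).2, ⟨?_, ?_, ?_⟩, fun c => hf' _ _, fun c => hf _ _⟩
  · intro c; exact hp _ _ (Quot.out c).2 (hf _ _)
  · intro B hB
    refine ⟨Quot.mk _ ⟨B, hB⟩, (hf _ _).symm.trans (classQuot_out ⟨B, hB⟩)⟩
  · intro c c' h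
    have := ((hf _ (Quot.out c).2).trans h).trans (hf _ (Quot.out c').2).symm
    rw [← Quot.out_eq c, ← Quot.out_eq c']
    exact (classQuot_eq _ _).mpr this

lemma finsum_class {p : TernMat → Prop} [Fintype (ClassQuot p)] {E : ClassQuot p → TernMat}
    (hE : ∀ c, LatIsom (Quot.out c).1 (E c)) (f : TernMat → ℝ)
    (hf : ∀ B C, LatIsom B C → f B = f C) :
    ∑ᶠ c : ClassQuot p, f (Quot.out c).1 / (numAut (Quot.out c).1 : ℝ) =
      ∑ c, f (E c) / (numAut (E c) : ℝ) := by
  rw [finsum_eq_sum_of_fintype]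
  refine Finset.sum_congr rfl fun c _ => ?_
  rw [hf _ _ (hE c), numAut_congr (hE c)]

lemma rRep_congr {A B : TernMat} (n : ℤ) (h : LatIsom A B) : rRep n A = rRep n B := by
  obtain ⟨U, hU, rfl⟩ := h
  obtain ⟨h1, h2, h3⟩ := unit_inv hU
  unfold rRep
  refine Nat.card_congr ⟨fun x => ⟨U⁻¹ *ᵥ x.1, ?_⟩, fun x => ⟨U *ᵥ x.1, ?_⟩, ?_, ?_⟩
  · rw [quadVal_comp, mulVec_mulVec, h2, one_mulVec]; exact x.2
  · rw [← quadVal_comp]; exact x.2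
  · intro x; ext1; simp [h2]
  · intro x; ext1; simp [h3]

lemma rGenus_ratio_sum {A : TernMat} [Fintype (ClassQuot (InGenus A))] {E : ClassQuot (InGenus A) → TernMat}
    (hA : InGenus A A)
    (hE : ∀ c, LatIsom (Quot.out c).1 (E c)) (n m : ℤ) :
    rGenus m A / rGenus n A = (∑ c, (rRep m (E c) : ℝ) / (numAut (E c) : ℝ)) /
      (∑ c, (rRep n (E c) : ℝ) / (numAut (E c) : ℝ)) := by
  unfold rGenus
  have h0 : massOf A ≠ 0 := by
    unfold massOf
    rw [finsum_eq_sum_of_fintype]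
    apply ne_of_gt
    refine Finset.sum_pos (fun c _ => ?_) ⟨Quot.mk _ ⟨A, hA⟩, Finset.mem_univ _⟩
    have := numAut_pos (Quot.out c).2.1
    positivity
  rw [mul_div_mul_left _ _ (inv_ne_zero h0)]
  rw [finsum_class hE (fun B => (rRep m B : ℝ)) (fun B C h => by rw [rRep_congr m h]),
    finsum_class hE (fun B => (rRep n B : ℝ)) (fun B C h => by rw [rRep_congr n h])]


lemma shear_gen (C : TernMat) {i j : Fin 3} (hij : i ≠ j) (k : ℤ) : ∃ C', LatIsom C C' ∧
    ∀ a b, C' a b = C a b + (if b = j then k * C a i else 0) + (if a = j then k * C i b else 0)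
      + (if a = j ∧ b = j then k ^ 2 * C i i else 0) := by
  refine ⟨_, ⟨Matrix.transvection i j k, by rw [det_transvection_of_ne _ _ hij]; exact isUnit_one, rfl⟩, ?_⟩
  intro a b
  simp only [Matrix.transvection, transpose_add, transpose_one, Matrix.add_mul, Matrix.mul_add, Matrix.one_mul,
    Matrix.mul_one, Matrix.add_apply, transpose_single]
  have h1 : (C * single i j k) a b = if b = j then k * C a i else 0 := by
    split_ifs with h
    · subst h; simp [mul_comm]
    · simp [h, Ne.symm h]
  have h2 : (single j i k * C) a b = if a = j then k * C i b else 0 := by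
    split_ifs with h
    · subst h; simp
    · simp [h, Ne.symm h]
  have h3 : (single j i k * C * single i j k) a b = if a = j ∧ b = j then k ^ 2 * C i i else 0 := by
    by_cases hb : b = j
    · subst hb
      by_cases ha : a = b
      · subst ha; simp; ring
      · simp [ha, Ne.symm ha]
    · simp [hb, Ne.symm hb]
  rw [h1, h2, h3]; ring

lemma perm_gen (C : TernMat) (e : Equiv.Perm (Fin 3)) : ∃ C', LatIsom C C' ∧
    ∀ a b, C' a b = C (e a) (e b) := by
  refine ⟨_, ⟨(1 : TernMat).submatrix id e, ?_, rfl⟩, ?_⟩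
  · have := Matrix.det_permute' e (1 : TernMat)
    rw [this]; simp
  · intro a b
    rw [comp_apply']
    simp [Matrix.one_apply, Fin.sum_univ_three]

/-- Normalized even matrices. -/
def NormE (E : TernMat) : Prop := E.IsSymm ∧ 2 ∣ E 0 0 ∧ 2 ∣ E 1 1 ∧ 2 ∣ E 2 2 ∧ ¬ 2 ∣ E 0 1 ∧
  4 ∣ E 0 2 ∧ 4 ∣ E 1 2

/-- Normalized odd matrices. -/
def NormL (L : TernMat) : Prop := L.IsSymm ∧ 4 ∣ L 0 0 ∧ 4 ∣ L 1 1 ∧ ¬ 2 ∣ L 2 2 ∧ ¬ 2 ∣ L 0 1 ∧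
  2 ∣ L 0 2 ∧ 2 ∣ L 1 2

lemma LatIsom.symmMat {A B : TernMat} (h : LatIsom A B) (hA : A.IsSymm) : B.IsSymm := by
  obtain ⟨U, hU, rfl⟩ := h
  exact symm_comp hA U

/-- even diagonal -/
def EvD (E : TernMat) : Prop := 2 ∣ E 0 0 ∧ 2 ∣ E 1 1 ∧ 2 ∣ E 2 2

lemma evD_of_even {E : TernMat} (h : IsEvenLat E) : EvD E := by
  have := fun i => h (Pi.single i 1)
  refine ⟨?_, ?_, ?_⟩
  · simpa [quadVal, Fin.sum_univ_three] using this 0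
  · simpa [quadVal, Fin.sum_univ_three] using this 1
  · simpa [quadVal, Fin.sum_univ_three] using this 2

lemma even_of_evD {E : TernMat} (hs : E.IsSymm) (h : EvD E) : IsEvenLat E := by
  intro x
  rw [quadVal_expand E hs]
  obtain ⟨⟨a, ha⟩, ⟨b, hb⟩, ⟨c, hc⟩⟩ := h
  rw [ha, hb, hc]
  refine ⟨a * x 0 ^ 2 + b * x 1 ^ 2 + c * x 2 ^ 2 + E 0 1 * x 0 * x 1 + E 0 2 * x 0 * x 2 + E 1 2 * x 1 * x 2, by ring⟩

lemma LatIsom.even {A B : TernMat} (h : LatIsom A B) (hA : IsEvenLat A) : IsEvenLat B := by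
  obtain ⟨U, hU, rfl⟩ := h
  intro x
  rw [quadVal_comp]; exact hA _

lemma exists_normE {E : TernMat} (hs : E.IsSymm) (he : IsEvenLat E) {d : ℤ} (hd : E.det = 2 * d)
    (hodd : ¬ 2 ∣ d) : ∃ C, LatIsom E C ∧ NormE C := by
  have hstep : ∃ C, LatIsom E C ∧ ¬ 2 ∣ C 0 1 := by
    by_contra hno
    push Not at hno
    have e01 := hno E (LatIsom.refl E)
    obtain ⟨C1, h1, f1⟩ := perm_gen E (Equiv.swap 1 2)
    have e02 := hno C1 h1
    obtain ⟨C2, h2, f2⟩ := perm_gen E (Equiv.swap 0 2)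
    have e12 := hno C2 h2
    rw [f1] at e02
    rw [f2] at e12
    have i0 : (Equiv.swap (1 : Fin 3) 2) 0 = 0 := by decide
    have i1 : (Equiv.swap (1 : Fin 3) 2) 1 = 2 := by decide
    have j0 : (Equiv.swap (0 : Fin 3) 2) 0 = 2 := by decide
    have j1 : (Equiv.swap (0 : Fin 3) 2) 1 = 1 := by decide
    rw [i0, i1] at e02
    rw [j0, j1, hs.apply] at e12
    obtain ⟨⟨a, ha⟩, ⟨b, hb⟩, ⟨c, hc⟩⟩ := evD_of_even he
    obtain ⟨x, hx⟩ := e01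
    obtain ⟨y, hy⟩ := e02
    obtain ⟨z, hz⟩ := e12
    apply hodd
    rw [det_expand _ hs, ha, hb, hc, hx, hy, hz] at hd
    refine ⟨2 * (a * b * c + 2 * x * y * z - a * z ^ 2 - b * y ^ 2 - c * x ^ 2), ?_⟩
    linarith
  obtain ⟨C, hC, h01⟩ := hstep
  have hCs := hC.symmMat hs
  have hCe := evD_of_even (hC.even he)
  -- clear
  set D := C 0 0 * C 1 1 - C 0 1 ^ 2 with hD
  have hDodd : D ^ 2 % 8 = 1 := by
    have : D % 2 = 1 := by
      obtain ⟨a, ha⟩ := hCe.1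
      have h1 : C 0 1 % 2 = 1 := by omega
      rw [hD, ha, Int.sub_emod, pow_two, Int.mul_emod (C 0 1), h1, Int.mul_assoc]
      omega
    have h8 : D % 8 = 1 ∨ D % 8 = 3 ∨ D % 8 = 5 ∨ D % 8 = 7 := by omega
    rcases h8 with h | h | h | h <;> simp [pow_two, Int.mul_emod, h]
  obtain ⟨C', hC', g00, g01, g11, g02, g12⟩ := shear2 hCs
    (-D * (C 1 1 * C 0 2 - C 0 1 * C 1 2)) (-D * (C 0 0 * C 1 2 - C 0 1 * C 0 2))
  have hT := hC.trans hC'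
  have hE' := evD_of_even (hT.even he)
  have hdvd : (4 : ℤ) ∣ 1 - D ^ 2 := by omega
  refine ⟨C', hT, hT.symmMat hs, hE'.1, hE'.2.1, hE'.2.2, by rwa [g01], ?_, ?_⟩
  · rw [g02]
    have : C 0 2 + -D * (C 1 1 * C 0 2 - C 0 1 * C 1 2) * C 0 0 + -D * (C 0 0 * C 1 2 - C 0 1 * C 0 2) * C 0 1 = C 0 2 * (1 - D ^ 2) := by
      rw [hD]; ring
    rw [this]; exact hdvd.mul_left _
  · rw [g12]
    have : C 1 2 + -D * (C 1 1 * C 0 2 - C 0 1 * C 1 2) * C 0 1 + -D * (C 0 0 * C 1 2 - C 0 1 * C 0 2) * C 1 1 = C 1 2 * (1 - D ^ 2) := by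
      rw [hD]; ring
    rw [this]; exact hdvd.mul_left _

lemma odd_sq_mod8 {D : ℤ} (h : ¬ 2 ∣ D) : 8 ∣ D ^ 2 - 1 := by
  have h8 : D % 8 = 1 ∨ D % 8 = 3 ∨ D % 8 = 5 ∨ D % 8 = 7 := by omega
  have : D ^ 2 % 8 = 1 := by rcases h8 with h | h | h | h <;> simp [pow_two, Int.mul_emod, h]
  omega

lemma exists_normL {L : TernMat} (hs : L.IsSymm) (hodd : ¬ 2 ∣ L.det) {v : Fin 3 → ℤ}
    {i : Fin 3} (hv : ¬ 2 ∣ v i) (hq : 4 ∣ quadVal L v) : ∃ C, LatIsom L C ∧ NormL C := by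
  have detodd : ∀ {C : TernMat}, LatIsom L C → ¬ 2 ∣ C.det := by
    intro C h; rwa [h.det_eq]
  -- step 1
  have s1 : ∃ C, LatIsom L C ∧ 4 ∣ C 0 0 := by
    obtain ⟨C1, h1, f1⟩ := perm_gen L (Equiv.swap 0 i)
    have hq1 : 4 ∣ quadVal C1 (v ∘ Equiv.swap 0 i) := by
      have : C1 = L.submatrix (Equiv.swap 0 i) (Equiv.swap 0 i) := by ext a b; simp [f1]
      rw [this, quadVal_perm]; exact hq
    set u := v ∘ Equiv.swap 0 i with hu
    have hu0 : ¬ 2 ∣ u 0 := by simpa [hu] using hv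
    obtain ⟨C2, h2, f2⟩ := shear_gen C1 (show (1 : Fin 3) ≠ 0 by decide) (u 0 * u 1)
    obtain ⟨C3, h3, f3⟩ := shear_gen C2 (show (2 : Fin 3) ≠ 0 by decide) (u 0 * u 2)
    refine ⟨C3, (h1.trans h2).trans h3, ?_⟩
    have hs1 := h1.symmMat hs
    have e1 := hs1.apply 0 1
    have e2 := hs1.apply 0 2
    have e3 := hs1.apply 1 2
    rw [f3]; simp only [f2]; simp
    rw [quadVal_expand _ hs1] at hq1
    obtain ⟨a, ha⟩ := odd_sq_mod8 hu0
    obtain ⟨b, hb⟩ := hq1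
    refine ⟨b * u 0 ^ 2 - C1 0 0 * (2 * a * (u 0 ^2 +1))
      - 2 * C1 0 1 * u 0 * u 1 * 2 * a - 2 * C1 0 2 * u 0 * u 2 * 2 * a, ?_⟩
    rw [e1, e2, e3]
    linear_combination (u 0 ^ 2) * hb - (C1 0 0 * (u 0 ^ 2 + 1) + 2 * C1 0 1 * u 0 * u 1 + 2 * C1 0 2 * u 0 * u 2) * ha
  -- step 2
  have s2 : ∃ C, LatIsom L C ∧ 4 ∣ C 0 0 ∧ ¬ 2 ∣ C 0 1 := by
    obtain ⟨C, hC, h0⟩ := s1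
    by_cases h1 : 2 ∣ C 0 1
    · obtain ⟨C1, g1, f1⟩ := perm_gen C (Equiv.swap 1 2)
      have i0 : (Equiv.swap (1 : Fin 3) 2) 0 = 0 := by decide
      have i1 : (Equiv.swap (1 : Fin 3) 2) 1 = 2 := by decide
      refine ⟨C1, hC.trans g1, by rwa [f1, i0], ?_⟩
      rw [f1, i0, i1]
      intro h2
      apply detodd hC
      rw [det_expand _ (hC.symmMat hs)]
      obtain ⟨a, ha⟩ := h0
      obtain ⟨b, hb⟩ := h1
      obtain ⟨c, hc⟩ := h2
      rw [ha, hb, hc]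
      exact ⟨2 * a * C 1 1 * C 2 2 + 4 * b * c * C 1 2 - 2 * a * C 1 2 ^ 2 - C 1 1 * 2 * c ^ 2 - C 2 2 * 2 * b ^ 2, by ring⟩
    · exact ⟨C, hC, h0, h1⟩
  -- step 3
  have s3 : ∃ C, LatIsom L C ∧ 4 ∣ C 0 0 ∧ ¬ 2 ∣ C 0 1 ∧ 2 ∣ C 0 2 ∧ ¬ 2 ∣ C 2 2 := by
    obtain ⟨C, hC, h0, h1⟩ := s2
    obtain ⟨C1, g1, f1⟩ := shear_gen C (show (1 : Fin 3) ≠ 2 by decide) (-(C 0 1 * C 0 2))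
    have a00 : C1 0 0 = C 0 0 := by rw [f1]; simp
    have a01 : C1 0 1 = C 0 1 := by rw [f1]; simp
    have a02 : 2 ∣ C1 0 2 := by
      rw [f1]; simp
      obtain ⟨a, ha⟩ := odd_sq_mod8 h1
      exact ⟨-(4 * a * C 0 2), by linear_combination (-C 0 2) * ha⟩
    refine ⟨C1, hC.trans g1, by rwa [a00], by rwa [a01], a02, ?_⟩
    intro h22
    apply detodd (hC.trans g1)
    rw [det_expand _ ((hC.trans g1).symmMat hs)]
    obtain ⟨a, ha⟩ := h0
    obtain ⟨b, hb⟩ := a02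
    obtain ⟨c, hc⟩ := h22
    rw [a00, ha, hb, hc]
    exact ⟨2 * a * C1 1 1 * (2 * c) + 2 * C1 0 1 * b * C1 1 2 - 2 * a * C1 1 2 ^ 2 - C1 1 1 * 2 * b ^ 2 - c * C1 0 1 ^ 2, by ring⟩
  have s4 : ∃ C, LatIsom L C ∧ 4 ∣ C 0 0 ∧ ¬ 2 ∣ C 0 1 ∧ 2 ∣ C 0 2 ∧ ¬ 2 ∣ C 2 2 ∧ 2 ∣ C 1 1 := by
    obtain ⟨C, hC, h0, h1, h2, h3⟩ := s3
    by_cases h4 : 2 ∣ C 1 1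
    · exact ⟨C, hC, h0, h1, h2, h3, h4⟩
    obtain ⟨C1, g1, f1⟩ := shear_gen C (show (2 : Fin 3) ≠ 1 by decide) 1
    have e3 := (hC.symmMat hs).apply 1 2
    refine ⟨C1, hC.trans g1, ?_, ?_, ?_, ?_, ?_⟩ <;> rw [f1] <;> simp
    · exact h0
    · omega
    · exact h2
    · omega
    · omega
  have s5 : ∃ C, LatIsom L C ∧ 4 ∣ C 0 0 ∧ ¬ 2 ∣ C 0 1 ∧ 2 ∣ C 0 2 ∧ ¬ 2 ∣ C 2 2 ∧ 4 ∣ C 1 1 := by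
    obtain ⟨C, hC, h0, h1, h2, h3, h4⟩ := s4
    by_cases h5 : 4 ∣ C 1 1
    · exact ⟨C, hC, h0, h1, h2, h3, h5⟩
    obtain ⟨C1, g1, f1⟩ := shear_gen C (show (0 : Fin 3) ≠ 1 by decide) 1
    have e3 := (hC.symmMat hs).apply 0 1
    refine ⟨C1, hC.trans g1, ?_, ?_, ?_, ?_, ?_⟩ <;> rw [f1] <;> simp
    · exact h0
    · omega
    · exact h2
    · omega
    · omega
  obtain ⟨C, hC, h0, h1, h2, h3, h4⟩ := s5
  obtain ⟨C1, g1, f1⟩ := shear_gen C (show (0 : Fin 3) ≠ 2 by decide) (C 1 2)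
  have e3 := (hC.symmMat hs).apply 0 1
  have e4 := (hC.symmMat hs).apply 0 2
  refine ⟨C1, hC.trans g1, (hC.trans g1).symmMat hs, ?_, ?_, ?_, ?_, ?_, ?_⟩ <;> rw [f1] <;> simp
  · exact h0
  · exact h4
  · rw [e4]
    have a1 : 2 ∣ C 1 2 * C 0 2 := h2.mul_left _
    have a2 : 2 ∣ C 1 2 ^ 2 * C 0 0 := Dvd.dvd.mul_left (by omega) _
    omega
  · omega
  · have a2 : 2 ∣ C 1 2 * C 0 0 := Dvd.dvd.mul_left (by omega) _
    omega
  · rw [e3]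
    have : C 1 2 + C 1 2 * C 0 1 = C 1 2 * (1 + C 0 1) := by ring
    rw [this]
    exact Dvd.dvd.mul_left (by omega) _


/-- Two classes of lattices linked at 2. -/
structure Linked (p q : TernMat → Prop) (d : ℤ) : Prop where
  dodd : ¬ 2 ∣ d
  pLat : ∀ E, p E → IsLat E
  qLat : ∀ L, q L → IsLat L
  pEven : ∀ E, p E → IsEvenLat E
  pdet : ∀ E, p E → E.det = 2 * d
  qdet : ∀ E, q E → E.det = d
  qiso : ∀ L, q L → ∃ v : Fin 3 → ℤ, ∃ i, ¬ 2 ∣ v i ∧ 4 ∣ quadVal L v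
  pq : ∀ E P L, p E → (P.det = 2 ∨ P.det = -2) → Pᵀ * E * P = (2 : ℤ) • L → q L
  qp : ∀ L P E, q L → (P.det = 4 ∨ P.det = -4) → Pᵀ * L * P = (2 : ℤ) • E → IsEvenLat E → p E
  pcl : ∀ B C, p B → LatIsom B C → p C
  qcl : ∀ B C, q B → LatIsom B C → q C

/-- the three sublattices -/
def TT : Fin 3 → TernMat := ![!![2,0,0;0,1,0;0,0,1], !![1,0,0;0,2,0;0,0,1], !![1,2,0;1,0,0;0,0,1]]
/-- the two overlattices -/
def SS : Fin 2 → TernMat := ![!![1,0,0;0,2,0;0,0,2], !![2,0,0;0,1,0;0,0,2]]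

lemma exists_half {M : TernMat} (h : ∀ i j, 2 ∣ M i j) : ∃ G, M = (2 : ℤ) • G := by
  choose G hG using h
  exact ⟨Matrix.of G, by ext i j; simp [hG]⟩

lemma TT_det (a : Fin 3) : (TT a).det = 2 ∨ (TT a).det = -2 := by
  fin_cases a <;> simp [TT, det_fin_three]

lemma SS_det (a : Fin 2) : (SS a).det = 4 ∨ (SS a).det = -4 := by
  fin_cases a <;> simp [SS, det_fin_three]

lemma par3 : ∀ x y : Fin 3 → ZMod 2, (∀ i j, x i * y j + y i * x j = 0) →
    (∀ i, x i = 0) ∨ (∀ i, y i = 0) ∨ ∀ i, x i = y i := by decide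

lemma par2 : ∀ x y : Fin 3 → ZMod 2, (∀ i j, x i * y j + y i * x j = 0) → (∀ i, x i * y i = 0) →
    (∀ i, x i = 0) ∨ (∀ i, y i = 0) := by decide

lemma zmod2_dvd (a : ℤ) : ((a : ZMod 2) = 0) ↔ 2 ∣ a := by
  have := ZMod.intCast_zmod_eq_zero_iff_dvd a 2
  simpa using this

lemma facE {p q : TernMat → Prop} {d : ℤ} (h : Linked p q d) {E : TernMat} (hE : p E)
    (hn : NormE E) : FacProp q E TT := by
  obtain ⟨hs, e00, e11, e22, e01, e02, e12⟩ := hn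
  have s1 := hs.apply 0 1
  have s2 := hs.apply 0 2
  have s3 := hs.apply 1 2
  have e02' : 2 ∣ E 0 2 := by omega
  have e12' : 2 ∣ E 1 2 := by omega
  refine ⟨?_, ?_, ?_, ?_⟩
  · intro a
    have : ∀ i j, 2 ∣ ((TT a)ᵀ * E * TT a) i j := by
      intro i j
      rw [comp_apply']
      fin_cases a <;> fin_cases i <;> fin_cases j <;> simp [TT, Fin.sum_univ_three, s1, s2, s3] <;> omega
    obtain ⟨G, hG⟩ := exists_half this
    exact ⟨G, h.pq E _ G hE (TT_det a) hG, hG⟩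
  · intro P G hG hP
    have hdet : P.det = 2 ∨ P.det = -2 := by
      have h1 := congrArg Matrix.det hP
      rw [det_mul, det_mul, det_transpose, det_smul, h.pdet _ hE, h.qdet _ hG] at h1
      simp at h1
      have hd : d ≠ 0 := fun h0 => h.dodd (h0 ▸ dvd_zero 2)
      have h2 : d * P.det ^ 2 = d * 4 := by linarith
      have h2 := mul_left_cancel₀ hd h2
      have : (P.det - 2) * (P.det + 2) = 0 := by linear_combination h2
      rcases mul_eq_zero.mp this with h | h
      · left; linarith
      · right; linarith
    have hunit : ∀ a U, P = TT a * U → IsUnit U.det := by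
      intro a U e
      rw [e, det_mul] at hdet
      have h1 := TT_det a
      rw [Int.isUnit_iff]
      rcases h1 with h1 | h1 <;> rw [h1] at hdet <;> omega
    have hpar : ∀ i j, 2 ∣ P 0 i * P 1 j + P 1 i * P 0 j := by
      intro i j
      have h1 := congrFun (congrFun hP i) j
      rw [comp_apply'] at h1
      simp [Fin.sum_univ_three, s1, s2, s3] at h1
      obtain ⟨a, ha⟩ := e00
      obtain ⟨b, hb⟩ := e11
      obtain ⟨c, hc⟩ := e22
      obtain ⟨k, hk⟩ := e02'
      obtain ⟨l, hl⟩ := e12'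
      obtain ⟨m, hm⟩ : ∃ m, E 0 1 = 2 * m + 1 := ⟨E 0 1 / 2, by omega⟩
      rw [ha, hb, hc, hk, hl, hm] at h1
      refine ⟨G i j - (P 0 i * a * P 0 j + P 0 i * m * P 1 j + P 0 i * k * P 2 j +
        (P 1 i * m * P 0 j + P 1 i * b * P 1 j + P 1 i * l * P 2 j) +
        (P 2 i * k * P 0 j + P 2 i * l * P 1 j + P 2 i * c * P 2 j)), ?_⟩
      linear_combination h1
    have hc := par3 (fun i => (P 0 i : ZMod 2)) (fun i => (P 1 i : ZMod 2)) (by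
      intro i j
      have := (zmod2_dvd _).mpr (hpar i j)
      push_cast at this
      exact this)
    rcases hc with hc | hc | hc
    · have h2 : ∀ i, 2 ∣ P 0 i := fun i => (zmod2_dvd _).mp (hc i)
      choose c hc using h2
      have e : P = TT 0 * Matrix.of ![c, P 1, P 2] := by
        ext i j; fin_cases i <;> simp [TT, Matrix.mul_apply, Fin.sum_univ_three, hc]
      exact ⟨0, _, hunit _ _ e, e⟩
    · have h2 : ∀ i, 2 ∣ P 1 i := fun i => (zmod2_dvd _).mp (hc i)
      choose c hc using h2
      have e : P = TT 1 * Matrix.of ![P 0, c, P 2] := by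
        ext i j; fin_cases i <;> simp [TT, Matrix.mul_apply, Fin.sum_univ_three, hc]
      exact ⟨1, _, hunit _ _ e, e⟩
    · have h2 : ∀ i, 2 ∣ P 0 i - P 1 i := fun i => (zmod2_dvd _).mp (by
        push_cast; rw [sub_eq_zero]; exact hc i)
      choose c hc using h2
      have e : P = TT 2 * Matrix.of ![P 1, c, P 2] := by
        ext i j; fin_cases i <;> simp [TT, Matrix.mul_apply, Fin.sum_univ_three]
        rw [← hc j]; ring
      exact ⟨2, _, hunit _ _ e, e⟩
  · intro a b U hU e
    have h00 := congrFun (congrFun e 0) 0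
    have h01 := congrFun (congrFun e 0) 1
    have h10 := congrFun (congrFun e 1) 0
    have h11 := congrFun (congrFun e 1) 1
    fin_cases a <;> fin_cases b <;> simp [TT, Matrix.mul_apply, Fin.sum_univ_three] at h00 h01 h10 h11 ⊢ <;> omega
  · intro a
    have := TT_det a
    omega

lemma facL {p q : TernMat → Prop} {d : ℤ} (h : Linked p q d) {L : TernMat} (hL : q L)
    (hn : NormL L) : FacProp p L SS := by
  obtain ⟨hs, e00, e11, e22, e01, e02, e12⟩ := hn
  have s1 := hs.apply 0 1
  have s2 := hs.apply 0 2
  have s3 := hs.apply 1 2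
  refine ⟨?_, ?_, ?_, ?_⟩
  · intro a
    have : ∀ i j, 2 ∣ ((SS a)ᵀ * L * SS a) i j := by
      intro i j
      rw [comp_apply']
      fin_cases a <;> fin_cases i <;> fin_cases j <;> simp [SS, Fin.sum_univ_three, s1, s2, s3] <;> omega
    have h4 : ∀ i, 4 ∣ ((SS a)ᵀ * L * SS a) i i := by
      intro i
      rw [comp_apply']
      fin_cases a <;> fin_cases i <;> simp [SS, Fin.sum_univ_three, s1, s2, s3] <;> omega
    obtain ⟨G, hG⟩ := exists_half this
    refine ⟨G, h.qp L _ G hL (SS_det a) hG ?_, hG⟩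
    have hGs : G.IsSymm := by
      have := symm_comp hs (SS a)
      rw [hG] at this
      apply two_smul_inj
      rw [← transpose_smul]; exact this
    apply even_of_evD hGs
    rw [hG] at h4
    simp at h4
    have h40 := h4 0
    have h41 := h4 1
    have h42 := h4 2
    refine ⟨?_, ?_, ?_⟩ <;> omega
  · intro P G hG hP
    have hdet : P.det = 4 ∨ P.det = -4 := by
      have h1 := congrArg Matrix.det hP
      rw [det_mul, det_mul, det_transpose, det_smul, h.pdet _ hG, h.qdet _ hL] at h1
      simp at h1
      have hd : d ≠ 0 := fun h0 => h.dodd (h0 ▸ dvd_zero 2)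
      have h2 : d * P.det ^ 2 = d * 16 := by linarith
      have h2 := mul_left_cancel₀ hd h2
      have : (P.det - 4) * (P.det + 4) = 0 := by linear_combination h2
      rcases mul_eq_zero.mp this with h | h
      · left; linarith
      · right; linarith
    have hunit : ∀ a U, P = SS a * U → IsUnit U.det := by
      intro a U e
      rw [e, det_mul] at hdet
      have h1 := SS_det a
      rw [Int.isUnit_iff]
      rcases h1 with h1 | h1 <;> rw [h1] at hdet <;> omega
    obtain ⟨a, ha⟩ := e00
    obtain ⟨b, hb⟩ := e11
    obtain ⟨c, hc⟩ : ∃ m, L 2 2 = 2 * m + 1 := ⟨L 2 2 / 2, by omega⟩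
    obtain ⟨k, hk⟩ := e02
    obtain ⟨l, hl⟩ := e12
    obtain ⟨m, hm⟩ : ∃ m, L 0 1 = 2 * m + 1 := ⟨L 0 1 / 2, by omega⟩
    have hev := evD_of_even (h.pEven _ hG)
    have hev' : ∀ i, 2 ∣ G i i := by
      intro i; fin_cases i
      · exact hev.1
      · exact hev.2.1
      · exact hev.2.2
    have hij : ∀ i j, _ := fun i j => congrFun (congrFun hP i) j
    simp only [comp_apply', Fin.sum_univ_three, s1, s2, s3, ha, hb, hc, hk, hl, hm, Matrix.smul_apply] at hij
    have hz : ∀ i, 2 ∣ P 2 i := by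
      intro i
      have h1 := hij i i
      have : 2 ∣ (P 2 i) ^ 2 := by
        refine ⟨G i i - (P 0 i * 2 * a * P 0 i + 2 * P 0 i * m * P 1 i + P 0 i * P 1 i + 2 * P 0 i * k * P 2 i +
          (P 1 i * 2 * b * P 1 i + 2 * P 1 i * l * P 2 i) + P 2 i * c * P 2 i), ?_⟩
        simp only [smul_eq_mul] at h1
        linear_combination h1
      exact Int.prime_two.dvd_of_dvd_pow this
    choose z hz using hz
    have hxy : ∀ i, 2 ∣ P 0 i * P 1 i := by
      intro i
      have h1 := hij i i
      obtain ⟨g, hg⟩ := hev' i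
      simp only [smul_eq_mul, hg, hz] at h1
      refine ⟨g - (P 0 i * a * P 0 i + P 0 i * m * P 1 i + P 0 i * k * z i * 2 +
          (P 1 i * b * P 1 i + 2 * P 1 i * l * z i) + z i * (2 * c + 1) * z i), ?_⟩
      have h2 : 2 * (P 0 i * P 1 i) = 2 * (2 * (g - (P 0 i * a * P 0 i + P 0 i * m * P 1 i + P 0 i * k * z i * 2 +
          (P 1 i * b * P 1 i + 2 * P 1 i * l * z i) + z i * (2 * c + 1) * z i))) := by
        linear_combination h1
      linarith
    have hpar : ∀ i j, 2 ∣ P 0 i * P 1 j + P 1 i * P 0 j := by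
      intro i j
      have h1 := hij i j
      simp only [smul_eq_mul, hz] at h1
      refine ⟨G i j - (P 0 i * 2 * a * P 0 j + P 0 i * m * P 1 j + P 1 i * m * P 0 j + 2 * P 0 i * k * z j + 2 * z i * k * P 0 j +
          P 1 i * 2 * b * P 1 j + 2 * P 1 i * l * z j + 2 * z i * l * P 1 j + 2 * z i * (2 * c + 1) * z j), ?_⟩
      linear_combination h1
    have hc := par2 (fun i => (P 0 i : ZMod 2)) (fun i => (P 1 i : ZMod 2)) (by
      intro i j
      have := (zmod2_dvd _).mpr (hpar i j)
      push_cast at this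
      exact this) (by
      intro i
      have := (zmod2_dvd _).mpr (hxy i)
      push_cast at this
      exact this)
    rcases hc with hc | hc
    · have h2 : ∀ i, 2 ∣ P 0 i := fun i => (zmod2_dvd _).mp (hc i)
      choose c hc using h2
      have e : P = SS 1 * Matrix.of ![c, P 1, z] := by
        ext i j; fin_cases i <;> simp [SS, Matrix.mul_apply, Fin.sum_univ_three, hc, hz]
      exact ⟨1, _, hunit _ _ e, e⟩
    · have h2 : ∀ i, 2 ∣ P 1 i := fun i => (zmod2_dvd _).mp (hc i)
      choose c hc using h2
      have e : P = SS 0 * Matrix.of ![P 0, c, z] := by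
        ext i j; fin_cases i <;> simp [SS, Matrix.mul_apply, Fin.sum_univ_three, hc, hz]
      exact ⟨0, _, hunit _ _ e, e⟩
  · intro a b U hU e
    have h00 := congrFun (congrFun e 0) 0
    have h11 := congrFun (congrFun e 1) 1
    fin_cases a <;> fin_cases b <;> simp [SS, Matrix.mul_apply, Fin.sum_univ_three] at h00 h11 ⊢ <;> omega
  · intro a
    have := SS_det a
    omega

lemma SS_scal (b : Fin 2) : ∃ S', SS b * S' = (2 : ℤ) • (1 : TernMat) := by
  fin_cases b
  · refine ⟨!![2,0,0;0,1,0;0,0,1], ?_⟩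
    ext i j; fin_cases i <;> fin_cases j <;> simp [SS, Matrix.mul_apply, Fin.sum_univ_three]
  · refine ⟨!![1,0,0;0,2,0;0,0,1], ?_⟩
    ext i j; fin_cases i <;> fin_cases j <;> simp [SS, Matrix.mul_apply, Fin.sum_univ_three]


/-- Number of vectors of norm `n` satisfying `c`. -/
noncomputable def cnt (A : TernMat) (n : ℤ) (c : (Fin 3 → ℤ) → Prop) : ℝ :=
  (Set.ncard {y | quadVal A y = n ∧ c y} : ℝ)

/-- the finset of vectors of norm n -/
noncomputable def vecs {A : TernMat} (h : IsLat A) (n : ℤ) : Finset (Fin 3 → ℤ) := (h.finite_eq n).toFinset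

lemma mem_vecs {A : TernMat} (h : IsLat A) (n : ℤ) (x : Fin 3 → ℤ) : x ∈ vecs h n ↔ quadVal A x = n := by
  simp [vecs]

lemma cnt_eq {A : TernMat} (h : IsLat A) (n : ℤ) (c : (Fin 3 → ℤ) → Prop) :
    cnt A n c = ∑ y ∈ vecs h n, if c y then (1 : ℝ) else 0 := by
  have : {y | quadVal A y = n ∧ c y} = ((vecs h n).filter c : Finset (Fin 3 → ℤ)) := by
    ext y; simp [mem_vecs]
  unfold cnt
  rw [this, Set.ncard_coe_finset, Finset.card_filter]
  push_cast; rfl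

lemma cnt_true (A : TernMat) (n : ℤ) : cnt A n (fun _ => True) = rRep n A := by
  unfold cnt rRep
  simp only [and_true]
  rfl

lemma cnt_congr {A : TernMat} (n : ℤ) {c c' : (Fin 3 → ℤ) → Prop}
    (h : ∀ y, quadVal A y = n → (c y ↔ c' y)) : cnt A n c = cnt A n c' := by
  unfold cnt
  congr 2
  ext y
  simp only [Set.mem_ofPred_eq]
  exact and_congr_right (h y)

/-- change of lattice -/
lemma cnt_bij {A B : TernMat} {n m : ℤ} {c c' : (Fin 3 → ℤ) → Prop} {P : TernMat} (hP : P.det ≠ 0)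
    (h1 : ∀ z, quadVal B z = m → c' z → quadVal A (P *ᵥ z) = n ∧ c (P *ᵥ z))
    (h2 : ∀ y, quadVal A y = n → c y → ∃ z, P *ᵥ z = y ∧ quadVal B z = m ∧ c' z) :
    cnt A n c = cnt B m c' := by
  unfold cnt
  congr 1
  symm
  refine Set.ncard_congr (fun z _ => P *ᵥ z) ?_ ?_ ?_
  · rintro z ⟨hz, hc⟩; exact h1 z hz hc
  · intro z z' _ _ h
    have h0 : P *ᵥ (z - z') = 0 := by rw [mulVec_sub, sub_eq_zero]; exact h
    have h3 := Matrix.eq_zero_of_mulVec_eq_zero hP h0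
    exact sub_eq_zero.mp h3
  · rintro y ⟨hy, hc⟩
    obtain ⟨z, e, hz⟩ := h2 y hy hc
    exact ⟨z, hz, e⟩

lemma range_mul_unit (P U : TernMat) (hU : IsUnit U.det) (y : Fin 3 → ℤ) :
    (∃ z, (P * U) *ᵥ z = y) ↔ ∃ z, P *ᵥ z = y := by
  constructor
  · rintro ⟨z, rfl⟩; exact ⟨U *ᵥ z, by rw [mulVec_mulVec]⟩
  · rintro ⟨z, rfl⟩
    exact ⟨U⁻¹ *ᵥ z, by rw [mulVec_mulVec, Matrix.mul_assoc, (unit_inv hU).2.1, Matrix.mul_one]⟩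

lemma det_of_scal {P P' : TernMat} (h : P * P' = (2 : ℤ) • (1 : TernMat)) : P.det ≠ 0 ∧ P'.det ≠ 0 := by
  have := congrArg Matrix.det h
  rw [det_mul, det_smul] at this
  simp at this
  constructor <;> intro h0 <;> rw [h0] at this <;> simp at this

lemma quadVal_hom2 {A B P : TernMat} (h : Pᵀ * A * P = (2 : ℤ) • B) (z : Fin 3 → ℤ) :
    quadVal A (P *ᵥ z) = 2 * quadVal B z := by
  rw [← quadVal_comp, h]
  simp [quadVal, Finset.mul_sum]
  refine Finset.sum_congr rfl fun i _ => Finset.sum_congr rfl fun j _ => by ring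

section
variable {p q : TernMat → Prop} {d : ℤ} {ι κ : Type*} [Fintype ι] [Fintype κ] {E : ι → TernMat}
  {L : κ → TernMat}

theorem dcount' (h : Linked p q d) (hE : RepSys p E) (hL : RepSys q L) (nE : ∀ i, NormE (E i))
    (nL : ∀ j, NormL (L j)) (w w' : TernMat → TernMat → ℝ)
    (hw : ∀ A P U, IsUnit U.det → w A (P * U) = w A P)
    (hw' : ∀ A P U, IsUnit U.det → w' A (P * U) = w' A P)
    (hww : ∀ A B P P', p A → q B → Pᵀ * A * P = (2 : ℤ) • B → P'ᵀ * B * P' = (2 : ℤ) • A →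
      P * P' = (2 : ℤ) • (1 : TernMat) → P' * P = (2 : ℤ) • (1 : TernMat) → w A P = w' B P')
    (fE fL : TernMat → ℝ) (hfE : ∀ A, p A → NormE A → ∑ a, w A (TT a) = fE A)
    (hfL : ∀ A, q A → NormL A → ∑ a, w' A (SS a) = fL A) :
    ∑ i, fE (E i) / (numAut (E i) : ℝ) = ∑ j, fL (L j) / (numAut (L j) : ℝ) := by
  have := dcount hE hL h.pLat h.qLat (d := d) (fun h0 => h.dodd (h0 ▸ dvd_zero 2))
    (fun i => h.pdet _ (hE.1 i)) (fun i => h.qdet _ (hL.1 i)) (fun i => facE h (hE.1 i) (nE i))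
    (fun i => facL h (hL.1 i) (nL i)) SS_scal w w' hw hw' hww
  convert this using 2 with i _ j _
  · rw [hfE _ (hE.1 i) (nE i)]
  · rw [hfL _ (hL.1 j) (nL j)]

/-- `y` in radical mod 2 -/
def radE (A : TernMat) (y : Fin 3 → ℤ) : Prop := ∀ i, 2 ∣ (A *ᵥ y) i

lemma rad_iff {A : TernMat} (hA : NormE A) (y : Fin 3 → ℤ) : radE A y ↔ 2 ∣ y 0 ∧ 2 ∣ y 1 := by
  obtain ⟨hs, e00, e11, e22, e01, e02, e12⟩ := hA
  have s1 := hs.apply 0 1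
  have s2 := hs.apply 0 2
  have s3 := hs.apply 1 2
  obtain ⟨a, ha⟩ := e00
  obtain ⟨b, hb⟩ := e11
  obtain ⟨c, hc⟩ := e22
  obtain ⟨k, hk⟩ := e02
  obtain ⟨l, hl⟩ := e12
  obtain ⟨m, hm⟩ : ∃ m, A 0 1 = 2 * m + 1 := ⟨A 0 1 / 2, by omega⟩
  unfold radE
  simp only [Fin.forall_fin_succ, mulVec, dotProduct, Fin.sum_univ_three]
  simp [s1, s2, s3, ha, hb, hc, hk, hl, hm]
  constructor
  · rintro ⟨⟨u, hu⟩, ⟨v, hv⟩, _⟩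
    exact ⟨⟨v - m * y 0 - b * y 1 - 2 * l * y 2, by linear_combination hv⟩,
      ⟨u - m * y 1 - a * y 0 - 2 * k * y 2, by linear_combination hu⟩⟩
  · rintro ⟨⟨u, hu⟩, ⟨v, hv⟩⟩
    rw [hu, hv]
    exact ⟨⟨2 * a * u + (2 * m + 1) * v + 2 * k * y 2, by ring⟩, ⟨(2 * m + 1) * u + 2 * b * v + 2 * l * y 2, by ring⟩,
      ⟨4 * k * u + 4 * l * v + c * y 2, by ring⟩⟩

lemma range_TT0 (y : Fin 3 → ℤ) : (∃ z, TT 0 *ᵥ z = y) ↔ 2 ∣ y 0 := by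
  constructor
  · rintro ⟨z, rfl⟩; simp [TT, mulVec, dotProduct, Fin.sum_univ_three]
  · rintro ⟨k, hk⟩
    refine ⟨![k, y 1, y 2], ?_⟩
    ext i; fin_cases i <;> simp [TT, mulVec, dotProduct, Fin.sum_univ_three, hk]

lemma range_TT1 (y : Fin 3 → ℤ) : (∃ z, TT 1 *ᵥ z = y) ↔ 2 ∣ y 1 := by
  constructor
  · rintro ⟨z, rfl⟩; simp [TT, mulVec, dotProduct, Fin.sum_univ_three]
  · rintro ⟨k, hk⟩
    refine ⟨![y 0, k, y 2], ?_⟩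
    ext i; fin_cases i <;> simp [TT, mulVec, dotProduct, Fin.sum_univ_three, hk]

lemma range_TT2 (y : Fin 3 → ℤ) : (∃ z, TT 2 *ᵥ z = y) ↔ 2 ∣ y 0 - y 1 := by
  constructor
  · rintro ⟨z, rfl⟩; simp [TT, mulVec, dotProduct, Fin.sum_univ_three]
  · rintro ⟨k, hk⟩
    refine ⟨![y 1, k, y 2], ?_⟩
    ext i; fin_cases i <;> simp [TT, mulVec, dotProduct, Fin.sum_univ_three]
    linarith

lemma range_SS0 (y : Fin 3 → ℤ) : (∃ z, SS 0 *ᵥ z = y) ↔ 2 ∣ y 1 ∧ 2 ∣ y 2 := by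
  constructor
  · rintro ⟨z, rfl⟩; simp [SS, mulVec, dotProduct, Fin.sum_univ_three]
  · rintro ⟨⟨k, hk⟩, ⟨l, hl⟩⟩
    refine ⟨![y 0, k, l], ?_⟩
    ext i; fin_cases i <;> simp [SS, mulVec, dotProduct, Fin.sum_univ_three, hk, hl]

lemma range_SS1 (y : Fin 3 → ℤ) : (∃ z, SS 1 *ᵥ z = y) ↔ 2 ∣ y 0 ∧ 2 ∣ y 2 := by
  constructor
  · rintro ⟨z, rfl⟩; simp [SS, mulVec, dotProduct, Fin.sum_univ_three]
  · rintro ⟨⟨k, hk⟩, ⟨l, hl⟩⟩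
    refine ⟨![k, y 1, l], ?_⟩
    ext i; fin_cases i <;> simp [SS, mulVec, dotProduct, Fin.sum_univ_three, hk, hl]

theorem core1 (h : Linked p q d) (hE : RepSys p E) (hL : RepSys q L) (nE : ∀ i, NormE (E i))
    (nL : ∀ j, NormL (L j)) (m : ℤ) :
    ∑ i, (rRep (2 * m) (E i) + 2 * cnt (E i) (2 * m) (radE (E i))) / (numAut (E i) : ℝ) =
    ∑ j, (2 * rRep m (L j) : ℝ) / (numAut (L j) : ℝ) := by
  refine dcount' h hE hL nE nL (fun A P => cnt A (2 * m) (fun y => ∃ z, P *ᵥ z = y))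
    (fun B P' => rRep m B) ?_ ?_ ?_ (fun A => rRep (2 * m) A + 2 * cnt A (2 * m) (radE A)) (fun B => 2 * rRep m B) ?_ ?_
  · intro A P U hU
    exact cnt_congr _ fun y _ => range_mul_unit P U hU y
  · intros; rfl
  · intro A B P P' hA hB e1 e2 e3 e4
    rw [← cnt_true]
    refine cnt_bij (det_of_scal e3).1 ?_ ?_
    · intro z hz _
      exact ⟨by rw [quadVal_hom2 e1, hz], z, rfl⟩
    · rintro y hy ⟨z, rfl⟩
      rw [quadVal_hom2 e1] at hy
      exact ⟨z, rfl, by linarith, trivial⟩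
  · intro A hA nA
    have hl := h.pLat A hA
    rw [← cnt_true]
    simp only [Fin.sum_univ_three, cnt_eq hl, range_TT0, range_TT1, range_TT2, rad_iff nA]
    rw [← Finset.sum_add_distrib, ← Finset.sum_add_distrib, Finset.mul_sum, ← Finset.sum_add_distrib]
    refine Finset.sum_congr rfl fun y _ => ?_
    by_cases h0 : 2 ∣ y 0 <;> by_cases h1 : 2 ∣ y 1
    · have : 2 ∣ y 0 - y 1 := by omega
      simp only [h0, h1, this]; norm_num
    · have : ¬ 2 ∣ y 0 - y 1 := by omega
      simp only [h0, h1, this]; norm_num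
    · have : ¬ 2 ∣ y 0 - y 1 := by omega
      simp only [h0, h1, this]; norm_num
    · have : 2 ∣ y 0 - y 1 := by omega
      simp only [h0, h1, this]; norm_num
  · intro A hA nA
    simp

lemma normL_four {A : TernMat} (hA : NormL A) {z : Fin 3 → ℤ} (h4 : 4 ∣ quadVal A z) :
    2 ∣ z 2 ∧ (2 ∣ z 0 ∨ 2 ∣ z 1) := by
  obtain ⟨hs, e00, e11, e22, e01, e02, e12⟩ := hA
  rw [quadVal_expand _ hs] at h4
  obtain ⟨a, ha⟩ := e00
  obtain ⟨b, hb⟩ := e11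
  obtain ⟨c, hc⟩ : ∃ m, A 2 2 = 2 * m + 1 := ⟨A 2 2 / 2, by omega⟩
  obtain ⟨k, hk⟩ := e02
  obtain ⟨l, hl⟩ := e12
  obtain ⟨m, hm⟩ : ∃ m, A 0 1 = 2 * m + 1 := ⟨A 0 1 / 2, by omega⟩
  obtain ⟨t, ht⟩ := h4
  rw [ha, hb, hc, hk, hl, hm] at ht
  have hz : 2 ∣ z 2 := by
    apply Int.prime_two.dvd_of_dvd_pow (n := 2)
    refine ⟨2 * t - 2 * a * z 0 ^ 2 - 2 * b * z 1 ^ 2 - c * z 2 ^ 2 - (2 * m + 1) * z 0 * z 1 - 2 * k * z 0 * z 2 - 2 * l * z 1 * z 2, ?_⟩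
    linear_combination ht
  refine ⟨hz, ?_⟩
  obtain ⟨u, hu⟩ := hz
  rw [hu] at ht
  apply Int.prime_two.dvd_or_dvd
  refine ⟨t - a * z 0 ^ 2 - b * z 1 ^ 2 - (2 * c + 1) * u ^ 2 - m * z 0 * z 1 - 2 * k * z 0 * u - 2 * l * z 1 * u, ?_⟩
  have : 2 * (z 0 * z 1) = 2 * (2 * (t - a * z 0 ^ 2 - b * z 1 ^ 2 - (2 * c + 1) * u ^ 2 - m * z 0 * z 1 - 2 * k * z 0 * u - 2 * l * z 1 * u)) := by
    linear_combination ht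
  linarith

lemma cnt_two {A : TernMat} (n : ℤ) (c : (Fin 3 → ℤ) → Prop) :
    cnt A (4 * n) (fun z => (∀ i, 2 ∣ z i) ∧ c z) = cnt A n (fun z => c ((2 : ℤ) • z)) := by
  refine cnt_bij (P := (2 : ℤ) • (1 : TernMat)) (by rw [det_smul]; simp) ?_ ?_
  · intro z hz hc
    have : ((2 : ℤ) • (1 : TernMat)) *ᵥ z = (2 : ℤ) • z := by rw [smul_mulVec, one_mulVec]
    rw [this]
    refine ⟨by rw [quadVal_smul, hz]; ring, fun i => by simp, hc⟩
  · rintro y hy ⟨h2, hc⟩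
    choose z hz using h2
    have : y = (2 : ℤ) • z := by ext i; simp [hz]
    subst this
    refine ⟨z, by rw [smul_mulVec, one_mulVec], ?_, hc⟩
    rw [quadVal_smul] at hy
    linarith

theorem core2 (h : Linked p q d) (hE : RepSys p E) (hL : RepSys q L) (nE : ∀ i, NormE (E i))
    (nL : ∀ j, NormL (L j)) (m : ℤ) :
    ∑ i, (3 * rRep (2 * m) (E i) : ℝ) / (numAut (E i) : ℝ) =
    ∑ j, (rRep (4 * m) (L j) + rRep m (L j) : ℝ) / (numAut (L j) : ℝ) := by
  refine dcount' h hE hL nE nL (fun A P => rRep (2 * m) A)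
    (fun B P' => cnt B (4 * m) (fun y => ∃ z, P' *ᵥ z = y)) ?_ ?_ ?_ (fun A => 3 * rRep (2 * m) A)
    (fun B => rRep (4 * m) B + rRep m B) ?_ ?_
  · intros; rfl
  · intro A P U hU
    exact cnt_congr _ fun y _ => range_mul_unit P U hU y
  · intro A B P P' hA hB e1 e2 e3 e4
    rw [← cnt_true]
    symm
    refine cnt_bij (det_of_scal e3).2 ?_ ?_
    · intro z hz _
      exact ⟨by rw [quadVal_hom2 e2, hz]; ring, z, rfl⟩
    · rintro y hy ⟨z, rfl⟩
      rw [quadVal_hom2 e2] at hy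
      exact ⟨z, rfl, by linarith, trivial⟩
  · intro A hA nA
    simp
  · intro A hA nA
    have hl := h.qLat A hA
    have e : (rRep m A : ℝ) = cnt A (4 * m) (fun z => (∀ i, 2 ∣ z i) ∧ True) := by
      rw [cnt_two, cnt_true]
    rw [e, ← cnt_true]
    simp only [Fin.sum_univ_two, cnt_eq hl, range_SS0, range_SS1]
    rw [← Finset.sum_add_distrib, ← Finset.sum_add_distrib]
    refine Finset.sum_congr rfl fun y hy => ?_
    have h4 := normL_four nA (z := y) (by rw [(mem_vecs hl _ y).mp hy]; exact dvd_mul_right _ _)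
    have hall : (∀ i, 2 ∣ y i) ↔ 2 ∣ y 0 ∧ 2 ∣ y 1 ∧ 2 ∣ y 2 := by simp [Fin.forall_fin_succ]
    simp only [hall]
    obtain ⟨h2, h01⟩ := h4
    by_cases h0 : 2 ∣ y 0 <;> by_cases h1 : 2 ∣ y 1
    · simp only [h0, h1, h2]; norm_num
    · simp only [h0, h1, h2]; norm_num
    · simp only [h0, h1, h2]; norm_num
    · tauto

end


lemma normE_param {A : TernMat} (hA : NormE A) : ∃ a b c g k l : ℤ, A 0 0 = 2 * a ∧ A 1 1 = 2 * b ∧ A 2 2 = 2 * c ∧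
    A 0 1 = 2 * g + 1 ∧ A 0 2 = 4 * k ∧ A 1 2 = 4 * l ∧ A 1 0 = 2 * g + 1 ∧ A 2 0 = 4 * k ∧ A 2 1 = 4 * l := by
  obtain ⟨hs, ⟨a, ha⟩, ⟨b, hb⟩, ⟨c, hc⟩, e01, ⟨k, hk⟩, ⟨l, hl⟩⟩ := hA
  have s1 := hs.apply 0 1
  have s2 := hs.apply 0 2
  have s3 := hs.apply 1 2
  exact ⟨a, b, c, A 0 1 / 2, k, l, ha, hb, hc, by omega, hk, hl, by omega, by omega, by omega⟩

lemma normL_param {A : TernMat} (hA : NormL A) : ∃ a b c g k l : ℤ, A 0 0 = 4 * a ∧ A 1 1 = 4 * b ∧ A 2 2 = 2 * c + 1 ∧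
    A 0 1 = 2 * g + 1 ∧ A 0 2 = 2 * k ∧ A 1 2 = 2 * l ∧ A 1 0 = 2 * g + 1 ∧ A 2 0 = 2 * k ∧ A 2 1 = 2 * l := by
  obtain ⟨hs, ⟨a, ha⟩, ⟨b, hb⟩, e22, e01, ⟨k, hk⟩, ⟨l, hl⟩⟩ := hA
  have s1 := hs.apply 0 1
  have s2 := hs.apply 0 2
  have s3 := hs.apply 1 2
  exact ⟨a, b, A 2 2 / 2, A 0 1 / 2, k, l, ha, hb, by omega, by omega, hk, hl, by omega, by omega, by omega⟩

lemma quadVal_full (A : TernMat) (x : Fin 3 → ℤ) : quadVal A x = 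
   x 0 * A 0 0 * x 0 + x 0 * A 0 1 * x 1 + x 0 * A 0 2 * x 2 +
   (x 1 * A 1 0 * x 0 + x 1 * A 1 1 * x 1 + x 1 * A 1 2 * x 2) +
   (x 2 * A 2 0 * x 0 + x 2 * A 2 1 * x 1 + x 2 * A 2 2 * x 2) := by
  simp [quadVal, Fin.sum_univ_three]

lemma tri (t : ℤ) : ∃ s, t * t = t + 2 * s := by
  obtain ⟨k, hk⟩ := Int.even_mul_pred_self t
  exact ⟨k, by linarith⟩

lemma oddsq8 {t : ℤ} (h : ¬ 2 ∣ t) : ∃ s, t * t = 1 + 8 * s := by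
  obtain ⟨s, hs⟩ := odd_sq_mod8 h
  exact ⟨s, by linarith⟩

lemma normE_c_odd {A : TernMat} (hA : NormE A) {d : ℤ} (hd : A.det = 2 * d) (hod : ¬ 2 ∣ d) {c : ℤ} (hc : A 2 2 = 2 * c) : ¬ 2 ∣ c := by
  obtain ⟨a', b', c', g, k, l, h1, h2, h3, h4, h5, h6, h7, h8, h9⟩ := normE_param hA
  obtain rfl : c' = c := by omega
  rw [det_fin_three, h1, h2, h3, h4, h5, h6, h7, h8, h9] at hd
  rintro ⟨c, rfl⟩
  apply hod
  refine ⟨c * (4 * a' * b' - 1 - 4 * (g * g + g)) - 8 * (a' * l * l) - 8 * (b' * k * k) + 8 * (2 * g + 1) * k * l, ?_⟩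
  have : 2 * d = 2 * (2 * (c * (4 * a' * b' - 1 - 4 * (g * g + g)) - 8 * (a' * l * l) - 8 * (b' * k * k) + 8 * (2 * g + 1) * k * l)) := by
    rw [← hd]; ring
  linarith

/-- key congruence for radical vectors -/
lemma rad_mod {A : TernMat} (hA : NormE A) {d : ℤ} (hd : A.det = 2 * d) (hod : ¬ 2 ∣ d)
    {z : Fin 3 → ℤ} {m x y a b : ℤ} (hx : z 0 = 2 * x) (hy : z 1 = 2 * y) (ha : A 0 0 = 2 * a) (hb : A 1 1 = 2 * b)
    (hm : quadVal A z = 2 * m) : (2 ∣ z 2 ∧ 4 ∣ m) ∨ (¬ 2 ∣ z 2 ∧ 8 ∣ d * m + 1 - 4 * ((x + b) * (y + a))) := by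
  obtain ⟨a', b', c, g, k, l, h1, h2, h3, h4, h5, h6, h7, h8, h9⟩ := normE_param hA
  obtain rfl : a' = a := by omega
  obtain rfl : b' = b := by omega
  rw [quadVal_full, hx, hy, h1, h2, h3, h4, h5, h6, h7, h8, h9] at hm
  have hm' : m = 4 * (a' * x * x) + 4 * (b' * y * y) + c * (z 2 * z 2) + 4 * ((2 * g + 1) * x * y) + 8 * (k * x * z 2) + 8 * (l * y * z 2) := by
    have : 2 * m = 2 * (4 * (a' * x * x) + 4 * (b' * y * y) + c * (z 2 * z 2) + 4 * ((2 * g + 1) * x * y) + 8 * (k * x * z 2) + 8 * (l * y * z 2)) := by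
      rw [← hm]; ring
    linarith
  by_cases hz : 2 ∣ z 2
  · left
    refine ⟨hz, ?_⟩
    obtain ⟨w, hw⟩ := hz
    rw [hm', hw]
    exact ⟨a' * x * x + b' * y * y + c * (w * w) + (2 * g + 1) * x * y + 2 * (k * x * (2 * w)) + 2 * (l * y * (2 * w)), by ring⟩
  · right
    refine ⟨hz, ?_⟩
    rw [det_fin_three, h1, h2, h3, h4, h5, h6, h7, h8, h9] at hd
    obtain ⟨s, hs⟩ := oddsq8 hz
    obtain ⟨G, hG⟩ := tri g
    have hd' : d = c * (4 * a' * b' - 1 - 4 * (g * g + g)) - 16 * (a' * l * l) - 16 * (b' * k * k) + 16 * (2 * g + 1) * k * l := by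
      have : 2 * d = 2 * (c * (4 * a' * b' - 1 - 4 * (g * g + g)) - 16 * (a' * l * l) - 16 * (b' * k * k) + 16 * (2 * g + 1) * k * l) := by
        rw [← hd]; ring
      linarith
    have hc : ¬ 2 ∣ c := by
      rintro ⟨c', rfl⟩
      apply hod
      rw [hd']
      exact ⟨c' * (4 * a' * b' - 1 - 4 * (g * g + g)) - 8 * (a' * l * l) - 8 * (b' * k * k) + 8 * (2 * g + 1) * k * l, by ring⟩
    obtain ⟨C, hC⟩ := oddsq8 hc
    obtain ⟨c1, hc1⟩ : ∃ c1, c = 2 * c1 + 1 := ⟨c / 2, by omega⟩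
    obtain ⟨X, hX⟩ := tri x
    obtain ⟨Y, hY⟩ := tri y
    -- d = c(4ab-1) + 8*D, m = c + 4 (a x + b y + x y) + 8*M
    have hD : ∃ D, d = c * (4 * a' * b' - 1) + 8 * D := ⟨-c * (g + G) - 2 * (a' * l * l) - 2 * (b' * k * k) + 2 * (2 * g + 1) * k * l, by
      rw [hd', hG]; ring⟩
    have hM : ∃ M, m = c + 4 * (a' * x + b' * y + x * y) + 8 * M := ⟨a' * X + b' * Y + c * s + g * x * y + k * x * z 2 + l * y * z 2, by
      rw [hm', hs]
      linear_combination 4 * a' * hX + 4 * b' * hY⟩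
    obtain ⟨D, hD⟩ := hD
    obtain ⟨M, hM⟩ := hM
    refine ⟨C * (4 * a' * b' - 1) + D * m + c * (4 * a' * b' - 1) * M + 2 * c * a' * b' * (a' * x + b' * y + x * y)
       - (c1 + 1) * (a' * x + b' * y + x * y), ?_⟩
    have : d * m = (c * c) * (4 * a' * b' - 1) + c * (4 * a' * b' - 1) * (4 * (a' * x + b' * y + x * y)) + 8 * (c * (4 * a' * b' - 1) * M) + 8 * D * m := by
      calc d * m = c * (4 * a' * b' - 1) * m + 8 * D * m := by rw [hD]; ring
        _ = c * (4 * a' * b' - 1) * (c + 4 * (a' * x + b' * y + x * y) + 8 * M) + 8 * D * m := by rw [← hM]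
        _ = _ := by ring
    rw [this, hC]
    linear_combination (-4 * (a' * x + b' * y + x * y)) * hc1

lemma rad_cnt_four {A : TernMat} (hA : NormE A) {d : ℤ} (hd : A.det = 2 * d) (hod : ¬ 2 ∣ d) (m : ℤ) :
    cnt A (2 * (4 * m)) (radE A) = rRep (2 * m) A := by
  have e : (2 * (4 * m)) = 4 * (2 * m) := by ring
  rw [← cnt_true, ← cnt_two (A := A) (2 * m) (fun _ => True), e]
  refine cnt_congr _ fun z hz => ?_
  rw [rad_iff hA]
  simp only [and_true, Fin.forall_fin_succ]
  constructor
  · rintro ⟨⟨x, hx⟩, ⟨y, hy⟩⟩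
    obtain ⟨a, b, c, g, k, l, h1, h2, h3, h4, h5, h6, h7, h8, h9⟩ := normE_param hA
    rcases rad_mod hA hd hod hx hy h1 h2 (m := 4 * m) (by rw [hz]; ring) with h | ⟨_, h⟩
    · exact ⟨⟨x, hx⟩, ⟨y, hy⟩, h.1, fun i => i.elim0⟩
    · exfalso
      have : d * (4 * m) = 4 * (d * m) := by ring
      rw [this] at h
      omega
  · rintro ⟨h0, h1, _⟩
    exact ⟨h0, h1⟩

lemma rad_cnt_zero {A : TernMat} (hA : NormE A) {d : ℤ} (hd : A.det = 2 * d) (hod : ¬ 2 ∣ d) (m : ℤ)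
    (h4 : ¬ 4 ∣ m) (h3 : ¬ 4 ∣ d * m + 1) : cnt A (2 * m) (radE A) = 0 := by
  unfold cnt
  have : {y | quadVal A y = 2 * m ∧ radE A y} = ∅ := by
    ext z
    simp only [Set.mem_ofPred_eq, Set.mem_empty_iff_false, iff_false]
    rintro ⟨hz, hr⟩
    rw [rad_iff hA] at hr
    obtain ⟨⟨x, hx⟩, ⟨y, hy⟩⟩ := hr
    obtain ⟨a, b, c, g, k, l, h1, h2, _⟩ := normE_param hA
    rcases rad_mod hA hd hod hx hy h1 h2 hz with h | ⟨_, h⟩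
    · exact h4 h.2
    · apply h3; omega
  rw [this]; simp

lemma normL_mod {A : TernMat} (hA : NormL A) {d : ℤ} (hd : A.det = d) {z : Fin 3 → ℤ} {m : ℤ}
    (hm : quadVal A z = m) (h3 : 4 ∣ d * m + 1) : ¬ 2 ∣ z 2 ∧ (2 ∣ z 0 ∨ 2 ∣ z 1) ∧ (2 ∣ z 0 → 2 ∣ z 1 → 8 ∣ d * m + 1) := by
  obtain ⟨a, b, c, g, k, l, h1, h2, h3', h4, h5, h6, h7, h8, h9⟩ := normL_param hA
  obtain ⟨G, hG⟩ := tri g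
  have hd' : ∃ D, d = -(2 * c + 1) + 8 * D := ⟨2 * a * b * (2 * c + 1) - 2 * a * l * l - 2 * b * k * k + k * l * (2 * g + 1) - (2 * c + 1) * (g + G), by
    rw [← hd, det_fin_three, h1, h2, h3', h4, h5, h6, h7, h8, h9]
    linear_combination (-4 * (2 * c + 1)) * hG⟩
  obtain ⟨D, hD⟩ := hd'
  rw [quadVal_full, h1, h2, h3', h4, h5, h6, h7, h8, h9] at hm
  obtain ⟨C, hC⟩ := tri c
  have hz : ¬ 2 ∣ z 2 := by
    rintro ⟨w, hw⟩
    have : 2 ∣ m := ⟨2 * a * z 0 * z 0 + 2 * b * z 1 * z 1 + (2 * c + 1) * (w * w) * 2 + (2 * g + 1) * z 0 * z 1 + 4 * k * z 0 * w + 4 * l * z 1 * w, by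
      rw [← hm, hw]; ring⟩
    have : 2 ∣ d * m := Dvd.dvd.mul_left this d
    omega
  obtain ⟨s, hs⟩ := oddsq8 hz
  refine ⟨hz, ?_, ?_⟩
  · by_contra! hc
    obtain ⟨h0, h1⟩ := hc
    obtain ⟨x, hx⟩ : ∃ x, z 0 = 2 * x + 1 := ⟨z 0 / 2, by omega⟩
    obtain ⟨y, hy⟩ : ∃ x, z 1 = 2 * x + 1 := ⟨z 1 / 2, by omega⟩
    have hM : ∃ M, m = 2 * c + 3 + 4 * M := ⟨a * z 0 * z 0 + b * z 1 * z 1 + (2 * c + 1) * 2 * s + g + (2 * g + 1) * (2 * x * y + x + y) + k * z 0 * z 2 + l * z 1 * z 2, by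
      rw [← hm]
      have : z 0 * z 1 = 1 + 2 * (2 * x * y + x + y) := by rw [hx, hy]; ring
      linear_combination (2 * c + 1) * hs + 2 * (2 * g + 1) * this⟩
    obtain ⟨M, hM⟩ := hM
    have e : d * m + 3 = 4 * (2 * D * m - (2 * c + 1) * M - c * c - 2 * c) := by
      calc d * m + 3 = (-(2 * c + 1)) * m + 8 * D * m + 3 := by rw [hD]; ring
        _ = (-(2 * c + 1)) * (2 * c + 3 + 4 * M) + 8 * D * m + 3 := by rw [← hM]
        _ = _ := by ring
    omega
  · rintro ⟨x, hx⟩ ⟨y, hy⟩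
    have hM : ∃ M, m = 2 * c + 1 + 8 * M := ⟨2 * a * x * x + 2 * b * y * y + (2 * c + 1) * s + (2 * g + 1) * x * y + k * x * z 2 + l * y * z 2, by
      rw [← hm, hx, hy]
      linear_combination (2 * c + 1) * hs⟩
    obtain ⟨M, hM⟩ := hM
    refine ⟨D * m - (2 * c + 1) * M - c - C, ?_⟩
    calc d * m + 1 = (-(2 * c + 1)) * m + 8 * D * m + 1 := by rw [hD]; ring
      _ = (-(2 * c + 1)) * (2 * c + 1 + 8 * M) + 8 * D * m + 1 := by rw [← hM]
      _ = _ := by linear_combination (-4) * hC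

section
variable {p q : TernMat → Prop} {d : ℤ} {ι κ : Type*} [Fintype ι] [Fintype κ] {E : ι → TernMat}
  {L : κ → TernMat}

lemma even_unit {U : TernMat} (hU : IsUnit U.det) (v : Fin 3 → ℤ) : (∀ i, 2 ∣ (Uᵀ *ᵥ v) i) ↔ ∀ i, 2 ∣ v i := by
  have key : ∀ (W : TernMat) (v : Fin 3 → ℤ), (∀ i, 2 ∣ v i) → ∀ i, 2 ∣ (W *ᵥ v) i := by
    intro W v hv i
    rw [mulVec, dotProduct]
    exact Finset.dvd_sum fun j _ => Dvd.dvd.mul_left (hv j) _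
  refine ⟨fun h => ?_, key _ v⟩
  have h2 := key (U⁻¹)ᵀ _ h
  rwa [mulVec_mulVec, ← transpose_mul, (unit_inv hU).2.1, transpose_one, one_mulVec] at h2

theorem core4 (h : Linked p q d) (hE : RepSys p E) (hL : RepSys q L) (nE : ∀ i, NormE (E i))
    (nL : ∀ j, NormL (L j)) (m : ℤ) (h3 : 4 ∣ d * m + 1) :
    ∑ i, (3 * cnt (E i) (2 * m) (radE (E i))) / (numAut (E i) : ℝ) =
    ∑ j, (rRep m (L j) + cnt (L j) m (fun z => 2 ∣ z 0 ∧ 2 ∣ z 1)) / (numAut (L j) : ℝ) := by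
  refine dcount' h hE hL nE nL (fun A P => cnt A (2 * m) (fun y => (∃ z, P *ᵥ z = y) ∧ radE A y))
    (fun B P' => cnt B m (fun z => ∀ i, 2 ∣ (P'ᵀ *ᵥ (B *ᵥ z)) i)) ?_ ?_ ?_ (fun A => 3 * cnt A (2 * m) (radE A))
    (fun B => rRep m B + cnt B m (fun z => 2 ∣ z 0 ∧ 2 ∣ z 1)) ?_ ?_
  · intro A P U hU
    exact cnt_congr _ fun y _ => and_congr_left fun _ => range_mul_unit P U hU y
  · intro A P U hU
    refine cnt_congr _ fun y _ => ?_
    rw [transpose_mul, ← mulVec_mulVec, even_unit hU]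
  · intro A B P P' hA hB e1 e2 e3 e4
    have e5 : A * P = P'ᵀ * B := by
      have t3 : P'ᵀ * Pᵀ = (2 : ℤ) • (1 : TernMat) := by rw [← transpose_mul, e3]; simp
      have : (2 : ℤ) • (A * P) = (2 : ℤ) • (P'ᵀ * B) := by
        calc (2 : ℤ) • (A * P) = (P'ᵀ * Pᵀ) * (A * P) := by rw [t3]; simp
          _ = P'ᵀ * (Pᵀ * A * P) := by simp only [Matrix.mul_assoc]
          _ = _ := by rw [e1, Matrix.mul_smul]
      ext i j
      have := congrFun (congrFun this i) j
      simp only [Matrix.smul_apply, smul_eq_mul] at this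
      linarith
    have e6 : ∀ z, radE A (P *ᵥ z) ↔ ∀ i, 2 ∣ (P'ᵀ *ᵥ (B *ᵥ z)) i := by
      intro z
      unfold radE
      rw [mulVec_mulVec, mulVec_mulVec, e5]
    refine cnt_bij (det_of_scal e3).1 ?_ ?_
    · intro z hz hc
      exact ⟨by rw [quadVal_hom2 e1, hz], ⟨z, rfl⟩, (e6 z).mpr hc⟩
    · rintro y hy ⟨⟨z, rfl⟩, hr⟩
      rw [quadVal_hom2 e1] at hy
      exact ⟨z, rfl, by linarith, (e6 z).mp hr⟩
  · intro A hA nA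
    have : ∀ a, cnt A (2 * m) (fun y => (∃ z, TT a *ᵥ z = y) ∧ radE A y) = cnt A (2 * m) (radE A) := by
      intro a
      refine cnt_congr _ fun y _ => ?_
      rw [rad_iff nA]
      fin_cases a
      · have := range_TT0 y; simp at this ⊢; rw [this]; tauto
      · have := range_TT1 y; simp at this ⊢; rw [this]; tauto
      · have := range_TT2 y; simp at this ⊢; rw [this]; intro a b; omega
    simp only [this]
    simp
  · intro A hA nA
    have hl := h.qLat A hA
    have c0 : ∀ z : Fin 3 → ℤ, (∀ i, 2 ∣ ((SS 0)ᵀ *ᵥ (A *ᵥ z)) i) ↔ 2 ∣ z 1 := by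
      intro z
      obtain ⟨a, b, c, g, k, l, h1, h2, h3', h4, h5, h6, h7, h8, h9⟩ := normL_param nA
      simp only [Fin.forall_fin_succ]
      simp [SS, mulVec, dotProduct, Fin.sum_univ_three, h1, h4, h5]
      have : 4 * a * z 0 + (2 * g + 1) * z 1 + 2 * k * z 2 = 2 * (2 * a * z 0 + g * z 1 + k * z 2) + z 1 := by ring
      rw [this]; omega
    have c1 : ∀ z : Fin 3 → ℤ, (∀ i, 2 ∣ ((SS 1)ᵀ *ᵥ (A *ᵥ z)) i) ↔ 2 ∣ z 0 := by
      intro z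
      obtain ⟨a, b, c, g, k, l, h1, h2, h3', h4, h5, h6, h7, h8, h9⟩ := normL_param nA
      simp only [Fin.forall_fin_succ]
      simp [SS, mulVec, dotProduct, Fin.sum_univ_three, h2, h7, h6]
      have : (2 * g + 1) * z 0 + 4 * b * z 1 + 2 * l * z 2 = 2 * (2 * b * z 1 + g * z 0 + l * z 2) + z 0 := by ring
      rw [this]; omega
    rw [← cnt_true]
    simp only [Fin.sum_univ_two, cnt_eq hl, c0, c1]
    rw [← Finset.sum_add_distrib, ← Finset.sum_add_distrib]
    refine Finset.sum_congr rfl fun y hy => ?_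
    obtain ⟨_, h01, _⟩ := normL_mod nA (h.qdet A hA) ((mem_vecs hl _ y).mp hy) h3
    by_cases h0 : 2 ∣ y 0 <;> by_cases h1 : 2 ∣ y 1
    · simp only [h0, h1]; norm_num
    · simp only [h0, h1]; norm_num
    · simp only [h0, h1]; norm_num
    · tauto

lemma e2_zero {A : TernMat} (hA : NormL A) {d : ℤ} (hd : A.det = d) {m : ℤ} (h3 : 4 ∣ d * m + 1) (h8 : ¬ 8 ∣ d * m + 1) :
    cnt A m (fun z => 2 ∣ z 0 ∧ 2 ∣ z 1) = 0 := by
  unfold cnt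
  have : {y | quadVal A y = m ∧ (2 ∣ y 0 ∧ 2 ∣ y 1)} = ∅ := by
    ext z
    simp only [Set.mem_ofPred_eq, Set.mem_empty_iff_false, iff_false]
    rintro ⟨hz, h0, h1⟩
    exact h8 ((normL_mod hA hd hz h3).2.2 h0 h1)
  rw [this]; simp


/-- characteristic condition on a sublattice -/
def charC (A P : TernMat) (y : Fin 3 → ℤ) : Prop := ∀ u, 4 ∣ (P *ᵥ u) ⬝ᵥ (A *ᵥ y) - quadVal A (P *ᵥ u)

lemma condE0 {A : TernMat} (nA : NormE A) {d : ℤ} (hd : A.det = 2 * d) (hod : ¬ 2 ∣ d) (y : Fin 3 → ℤ) {a b : ℤ}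
    (ha : A 0 0 = 2 * a) (hb : A 1 1 = 2 * b) :
    ((∃ z, TT 0 *ᵥ z = y) ∧ charC A (TT 0) y) ↔ ((2 ∣ y 0 ∧ 2 ∣ y 1) ∧ ¬ 2 ∣ y 2) ∧ 2 ∣ y 0 / 2 + b := by
  obtain ⟨a', b', c, g, k, l, h1, h2, h3, h4, h5, h6, h7, h8, h9⟩ := normE_param nA
  obtain rfl : b' = b := by omega
  obtain rfl : a' = a := by omega
  have hc := normE_c_odd nA hd hod h3
  rw [range_TT0]
  unfold charC
  constructor
  · rintro ⟨⟨x, hx⟩, hu⟩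
    have u0 := hu ![1, 0, 0]
    have u1 := hu ![0, 1, 0]
    have u2 := hu ![0, 0, 1]
    simp [TT, mulVec, dotProduct, Fin.sum_univ_three, quadVal_full, h1, h2, h3, h4, h5, h6, h7, h8, h9] at u0 u1 u2
    obtain ⟨w0, h0'⟩ : ∃ w, y 0 = 2 * w := ⟨x, hx⟩
    obtain ⟨w1, h1'⟩ : ∃ w, y 1 = 2 * w := by
      ring_nf at u0; rw [h0'] at u0; ring_nf at u0; exact ⟨y 1 / 2, by omega⟩
    have hy0 : 2 ∣ y 0 := by rw [h0']; exact dvd_mul_right _ _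
    have hy1 : 2 ∣ y 1 := by rw [h1']; exact dvd_mul_right _ _
    have hy2 : ¬ 2 ∣ y 2 := by
      rintro ⟨v, hv⟩
      rw [hv, h0', h1'] at u2
      ring_nf at u2
      omega
    refine ⟨⟨⟨hy0, hy1⟩, hy2⟩, ?_⟩
    obtain ⟨v, hv⟩ : ∃ v, y 2 = 2 * v + 1 := ⟨y 2 / 2, by omega⟩
    have e0 : y 0 / 2 = w0 := by omega
    have e1 : y 1 / 2 = w1 := by omega
    simp only [e0, e1]
    rw [h0', h1', hv] at u0 u1
    ring_nf at u0 u1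
    omega
  · rintro ⟨⟨⟨⟨w0, h0'⟩, ⟨w1, h1'⟩⟩, hy2⟩, ⟨t, ht⟩⟩
    have e0 : y 0 / 2 = w0 := by omega
    have e1 : y 1 / 2 = w1 := by omega
    simp only [e0, e1] at ht
    obtain ⟨v, hv⟩ : ∃ v, y 2 = 2 * v + 1 := ⟨y 2 / 2, by omega⟩
    refine ⟨by omega, ?_⟩
    intro u
    obtain ⟨T0, hT0⟩ := tri (u 0)
    obtain ⟨T1, hT1⟩ := tri (u 1)
    obtain ⟨T2, hT2⟩ := tri (u 2)
    rw [← pow_two] at hT0 hT1 hT2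
    obtain rfl : b' = 2 * t - w0 := by omega
    simp [TT, mulVec, dotProduct, Fin.sum_univ_three, quadVal_full, h1, h2, h3, h4, h5, h6, h7, h8, h9, h0', h1', hv]
    ring_nf
    simp only [hT0, hT1, hT2]
    ring_nf
    omega

lemma condE1 {A : TernMat} (nA : NormE A) {d : ℤ} (hd : A.det = 2 * d) (hod : ¬ 2 ∣ d) (y : Fin 3 → ℤ) {a b : ℤ}
    (ha : A 0 0 = 2 * a) (hb : A 1 1 = 2 * b) :
    ((∃ z, TT 1 *ᵥ z = y) ∧ charC A (TT 1) y) ↔ ((2 ∣ y 0 ∧ 2 ∣ y 1) ∧ ¬ 2 ∣ y 2) ∧ 2 ∣ y 1 / 2 + a := by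
  obtain ⟨a', b', c, g, k, l, h1, h2, h3, h4, h5, h6, h7, h8, h9⟩ := normE_param nA
  obtain rfl : b' = b := by omega
  obtain rfl : a' = a := by omega
  have hc := normE_c_odd nA hd hod h3
  rw [range_TT1]
  unfold charC
  constructor
  · rintro ⟨⟨x, hx⟩, hu⟩
    have u0 := hu ![1, 0, 0]
    have u1 := hu ![0, 1, 0]
    have u2 := hu ![0, 0, 1]
    simp [TT, mulVec, dotProduct, Fin.sum_univ_three, quadVal_full, h1, h2, h3, h4, h5, h6, h7, h8, h9] at u0 u1 u2
    obtain ⟨w1, h1'⟩ : ∃ w, y 1 = 2 * w := ⟨x, hx⟩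
    obtain ⟨w0, h0'⟩ : ∃ w, y 0 = 2 * w := by
      ring_nf at u1; rw [h1'] at u1; ring_nf at u1; exact ⟨y 0 / 2, by omega⟩
    have hy0 : 2 ∣ y 0 := by rw [h0']; exact dvd_mul_right _ _
    have hy1 : 2 ∣ y 1 := by rw [h1']; exact dvd_mul_right _ _
    have hy2 : ¬ 2 ∣ y 2 := by
      rintro ⟨v, hv⟩
      rw [hv, h0', h1'] at u2
      ring_nf at u2
      omega
    refine ⟨⟨⟨hy0, hy1⟩, hy2⟩, ?_⟩
    obtain ⟨v, hv⟩ : ∃ v, y 2 = 2 * v + 1 := ⟨y 2 / 2, by omega⟩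
    have e0 : y 0 / 2 = w0 := by omega
    have e1 : y 1 / 2 = w1 := by omega
    simp only [e0, e1]
    rw [h0', h1', hv] at u0 u1
    ring_nf at u0 u1
    omega
  · rintro ⟨⟨⟨⟨w0, h0'⟩, ⟨w1, h1'⟩⟩, hy2⟩, ⟨t, ht⟩⟩
    have e0 : y 0 / 2 = w0 := by omega
    have e1 : y 1 / 2 = w1 := by omega
    simp only [e0, e1] at ht
    obtain ⟨v, hv⟩ : ∃ v, y 2 = 2 * v + 1 := ⟨y 2 / 2, by omega⟩
    refine ⟨by omega, ?_⟩
    intro u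
    obtain ⟨T0, hT0⟩ := tri (u 0)
    obtain ⟨T1, hT1⟩ := tri (u 1)
    obtain ⟨T2, hT2⟩ := tri (u 2)
    rw [← pow_two] at hT0 hT1 hT2
    obtain rfl : a' = 2 * t - w1 := by omega
    simp [TT, mulVec, dotProduct, Fin.sum_univ_three, quadVal_full, h1, h2, h3, h4, h5, h6, h7, h8, h9, h0', h1', hv]
    ring_nf
    simp only [hT0, hT1, hT2]
    ring_nf
    omega

lemma condE2 {A : TernMat} (nA : NormE A) {d : ℤ} (hd : A.det = 2 * d) (hod : ¬ 2 ∣ d) (y : Fin 3 → ℤ) {a b : ℤ}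
    (ha : A 0 0 = 2 * a) (hb : A 1 1 = 2 * b) :
    ((∃ z, TT 2 *ᵥ z = y) ∧ charC A (TT 2) y) ↔ ((2 ∣ y 0 ∧ 2 ∣ y 1) ∧ ¬ 2 ∣ y 2) ∧ 2 ∣ y 0 / 2 + y 1 / 2 + a + b + 1 := by
  obtain ⟨a', b', c, g, k, l, h1, h2, h3, h4, h5, h6, h7, h8, h9⟩ := normE_param nA
  obtain rfl : b' = b := by omega
  obtain rfl : a' = a := by omega
  have hc := normE_c_odd nA hd hod h3
  rw [range_TT2]
  unfold charC
  constructor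
  · rintro ⟨⟨x, hx⟩, hu⟩
    have u0 := hu ![1, 0, 0]
    have u1 := hu ![0, 1, 0]
    have u2 := hu ![0, 0, 1]
    simp [TT, mulVec, dotProduct, Fin.sum_univ_three, quadVal_full, h1, h2, h3, h4, h5, h6, h7, h8, h9] at u0 u1 u2
    obtain ⟨w1, h1'⟩ : ∃ w, y 1 = 2 * w := by
      have hx' : y 0 = 2 * x + y 1 := by linarith
      rw [hx'] at u1; ring_nf at u1; exact ⟨y 1 / 2, by omega⟩
    obtain ⟨w0, h0'⟩ : ∃ w, y 0 = 2 * w := ⟨y 0 / 2, by omega⟩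
    have hy0 : 2 ∣ y 0 := by rw [h0']; exact dvd_mul_right _ _
    have hy1 : 2 ∣ y 1 := by rw [h1']; exact dvd_mul_right _ _
    have hy2 : ¬ 2 ∣ y 2 := by
      rintro ⟨v, hv⟩
      rw [hv, h0', h1'] at u2
      ring_nf at u2
      omega
    refine ⟨⟨⟨hy0, hy1⟩, hy2⟩, ?_⟩
    obtain ⟨v, hv⟩ : ∃ v, y 2 = 2 * v + 1 := ⟨y 2 / 2, by omega⟩
    have e0 : y 0 / 2 = w0 := by omega
    have e1 : y 1 / 2 = w1 := by omega
    simp only [e0, e1]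
    rw [h0', h1', hv] at u0 u1
    ring_nf at u0 u1
    omega
  · rintro ⟨⟨⟨⟨w0, h0'⟩, ⟨w1, h1'⟩⟩, hy2⟩, ⟨t, ht⟩⟩
    have e0 : y 0 / 2 = w0 := by omega
    have e1 : y 1 / 2 = w1 := by omega
    simp only [e0, e1] at ht
    obtain ⟨v, hv⟩ : ∃ v, y 2 = 2 * v + 1 := ⟨y 2 / 2, by omega⟩
    refine ⟨by omega, ?_⟩
    intro u
    obtain ⟨T0, hT0⟩ := tri (u 0)
    obtain ⟨T1, hT1⟩ := tri (u 1)
    obtain ⟨T2, hT2⟩ := tri (u 2)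
    rw [← pow_two] at hT0 hT1 hT2
    obtain rfl : b' = 2 * t - w0 - w1 - a' - 1 := by omega
    simp [TT, mulVec, dotProduct, Fin.sum_univ_three, quadVal_full, h1, h2, h3, h4, h5, h6, h7, h8, h9, h0', h1', hv]
    ring_nf
    simp only [hT0, hT1, hT2]
    ring_nf
    omega


theorem core5 (h : Linked p q d) (hE : RepSys p E) (hL : RepSys q L) (nE : ∀ i, NormE (E i))
    (nL : ∀ j, NormL (L j)) (m : ℤ) (h8 : 8 ∣ d * m + 1) :
    ∑ i, (2 * cnt (E i) (2 * m) (radE (E i))) / (numAut (E i) : ℝ) =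
    ∑ j, (2 * cnt (L j) m (fun z => 2 ∣ z 0 ∧ 2 ∣ z 1)) / (numAut (L j) : ℝ) := by
  refine dcount' h hE hL nE nL (fun A P => cnt A (2 * m) (fun y => (∃ z, P *ᵥ z = y) ∧ charC A P y))
    (fun B P' => cnt B m (fun z => ∀ u, 2 ∣ u ⬝ᵥ (B *ᵥ z) - quadVal B u)) ?_ ?_ ?_ (fun A => 2 * cnt A (2 * m) (radE A))
    (fun B => 2 * cnt B m (fun z => 2 ∣ z 0 ∧ 2 ∣ z 1)) ?_ ?_
  · intro A P U hU
    refine cnt_congr _ fun y _ => and_congr (range_mul_unit P U hU y) ?_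
    unfold charC
    constructor
    · intro hu u
      obtain ⟨u', hu'⟩ := (range_mul_unit P U hU (P *ᵥ u)).mpr ⟨u, rfl⟩
      rw [← hu']; exact hu u'
    · intro hu u
      rw [← mulVec_mulVec]; exact hu _
  · intros; rfl
  · intro A B P P' hA hB e1 e2 e3 e4
    have e6 : ∀ z, charC A P (P *ᵥ z) ↔ ∀ u, 2 ∣ u ⬝ᵥ (B *ᵥ z) - quadVal B u := by
      intro z
      unfold charC
      refine forall_congr' fun u => ?_
      have : (P *ᵥ u) ⬝ᵥ (A *ᵥ (P *ᵥ z)) = 2 * (u ⬝ᵥ (B *ᵥ z)) := by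
        rw [dotProduct_comm, dotProduct_mulVec, dotProduct_comm, ← mulVec_transpose, mulVec_mulVec, mulVec_mulVec, e1, smul_mulVec, dotProduct_smul]
        simp
      rw [this, quadVal_hom2 e1]
      omega
    refine cnt_bij (det_of_scal e3).1 ?_ ?_
    · intro z hz hc
      exact ⟨by rw [quadVal_hom2 e1, hz], ⟨z, rfl⟩, (e6 z).mpr hc⟩
    · rintro y hy ⟨⟨z, rfl⟩, hr⟩
      rw [quadVal_hom2 e1] at hy
      exact ⟨z, rfl, by linarith, (e6 z).mp hr⟩
  · intro A hA nA
    have hl := h.pLat A hA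
    have hd := h.pdet A hA
    obtain ⟨a, b, c, g, k, l, h1, h2, h3, h4, h5, h6, h7, h8', h9⟩ := normE_param nA
    simp only [Fin.sum_univ_three, cnt_eq hl, rad_iff nA, condE0 nA hd h.dodd _ h1 h2, condE1 nA hd h.dodd _ h1 h2, condE2 nA hd h.dodd _ h1 h2]
    rw [← Finset.sum_add_distrib, ← Finset.sum_add_distrib, Finset.mul_sum]
    refine Finset.sum_congr rfl fun y hy => ?_
    by_cases hr : 2 ∣ y 0 ∧ 2 ∣ y 1
    · have e0 : y 0 = 2 * (y 0 / 2) := by omega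
      have e1 : y 1 = 2 * (y 1 / 2) := by omega
      rcases rad_mod nA hd h.dodd e0 e1 h1 h2 ((mem_vecs hl _ y).mp hy) with ⟨_, hm⟩ | ⟨hy2, hm⟩
      · exfalso
        have : 4 ∣ d * m := Dvd.dvd.mul_left hm d
        omega
      · have hev : 2 ∣ (y 0 / 2 + b) * (y 1 / 2 + a) := by omega
        have hev' := Int.prime_two.dvd_or_dvd hev
        by_cases q0 : 2 ∣ y 0 / 2 + b <;> by_cases q1 : 2 ∣ y 1 / 2 + a
        · have q2 : ¬ 2 ∣ y 0 / 2 + y 1 / 2 + a + b + 1 := by omega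
          simp only [hr, hy2, q0, q1, q2]; norm_num
        · have q2 : 2 ∣ y 0 / 2 + y 1 / 2 + a + b + 1 := by omega
          simp only [hr, hy2, q0, q1, q2]; norm_num
        · have q2 : 2 ∣ y 0 / 2 + y 1 / 2 + a + b + 1 := by omega
          simp only [hr, hy2, q0, q1, q2]; norm_num
        · tauto
    · simp only [hr]; norm_num
  · intro A hA nA
    have hl := h.qLat A hA
    have : cnt A m (fun z => ∀ u, 2 ∣ u ⬝ᵥ (A *ᵥ z) - quadVal A u) = cnt A m (fun z => 2 ∣ z 0 ∧ 2 ∣ z 1) := by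
      refine cnt_congr _ fun z hz => ?_
      obtain ⟨hz2, _, _⟩ := normL_mod nA (h.qdet A hA) hz (by omega)
      obtain ⟨v, hv⟩ : ∃ v, z 2 = 2 * v + 1 := ⟨z 2 / 2, by omega⟩
      obtain ⟨a, b, c, g, k, l, h1, h2, h3, h4, h5, h6, h7, h8', h9⟩ := normL_param nA
      constructor
      · intro hu
        have u0 := hu ![1, 0, 0]
        have u1 := hu ![0, 1, 0]
        simp [mulVec, dotProduct, Fin.sum_univ_three, quadVal_full, h1, h2, h3, h4, h5, h6, h7, h8', h9] at u0 u1
        ring_nf at u0 u1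
        omega
      · rintro ⟨⟨w0, h0'⟩, ⟨w1, h1'⟩⟩ u
        obtain ⟨T2, hT2⟩ := tri (u 2)
        rw [← pow_two] at hT2
        simp [mulVec, dotProduct, Fin.sum_univ_three, quadVal_full, h1, h2, h3, h4, h5, h6, h7, h8', h9, h0', h1', hv]
        ring_nf
        simp only [hT2]
        ring_nf
        omega
    simp only [this]
    simp


theorem core_all (h : Linked p q d) (hE : RepSys p E) (hL : RepSys q L) (nE : ∀ i, NormE (E i))
    (nL : ∀ j, NormL (L j)) (R ρ e : ℤ → ℝ) (hR : ∀ m, R m = ∑ i, (rRep (2 * m) (E i) : ℝ) / (numAut (E i) : ℝ))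
    (hρ : ∀ m, ρ m = ∑ i, cnt (E i) (2 * m) (radE (E i)) / (numAut (E i) : ℝ))
    (he : ∀ m, e m = ∑ j, (rRep m (L j) : ℝ) / (numAut (L j) : ℝ)) (m : ℤ) :
    2 * e m = R m + 2 * ρ m ∧ R (4 * m) = 3 * R m - 2 * ρ m ∧ ρ (4 * m) = R m ∧
    (¬ 4 ∣ m → ¬ 4 ∣ d * m + 1 → ρ m = 0) ∧ (4 ∣ d * m + 1 → ¬ 8 ∣ d * m + 1 → R m = 4 * ρ m) ∧
    (8 ∣ d * m + 1 → R m = 2 * ρ m) := by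
  have i1 : ∀ m, 2 * e m = R m + 2 * ρ m := by
    intro m
    have := core1 h hE hL nE nL m
    simp only [add_div, Finset.sum_add_distrib, mul_div_assoc, ← Finset.mul_sum] at this
    rw [hR, hρ, he]; linarith
  have i2 : ∀ m, 3 * R m = e (4 * m) + e m := by
    intro m
    have := core2 h hE hL nE nL m
    simp only [add_div, Finset.sum_add_distrib, mul_div_assoc, ← Finset.mul_sum] at this
    rw [hR, he, he]; linarith
  have i3 : ∀ m, ρ (4 * m) = R m := by
    intro m
    rw [hρ, hR]
    exact Finset.sum_congr rfl fun i _ => by rw [rad_cnt_four (nE i) (h.pdet _ (hE.1 i)) h.dodd]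
  refine ⟨i1 m, ?_, i3 m, ?_, ?_, ?_⟩
  · have := i1 m
    have := i1 (4 * m)
    have := i2 m
    have := i3 m
    linarith
  · intro h4 h3
    rw [hρ]
    exact Finset.sum_eq_zero fun i _ => by rw [rad_cnt_zero (nE i) (h.pdet _ (hE.1 i)) h.dodd m h4 h3]; simp
  · intro h3 h8
    have := core4 h hE hL nE nL m h3
    have z : ∀ j, cnt (L j) m (fun z => 2 ∣ z 0 ∧ 2 ∣ z 1) = 0 := fun j => e2_zero (nL j) (h.qdet _ (hL.1 j)) h3 h8
    simp only [z, add_zero, mul_div_assoc, ← Finset.mul_sum] at this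
    rw [← hρ, ← he] at this
    have := i1 m
    linarith
  · intro h8
    have t4 := core4 h hE hL nE nL m (by omega)
    have t5 := core5 h hE hL nE nL m h8
    simp only [add_div, Finset.sum_add_distrib, mul_div_assoc, ← Finset.mul_sum] at t4 t5
    rw [← hρ, ← he] at t4
    rw [← hρ] at t5
    have := i1 m
    linarith

end


section
variable {p : ℕ} [hpf : Fact p.Prime]

lemma hensel_quad (a b c : ℤ_[p]) (hb : IsUnit b) (ha : ‖a‖ < 1) : ∃ t : ℤ_[p], a + b * t + c * t ^ 2 = 0 ∧ ‖t‖ < 1 := by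
  let F : Polynomial ℤ_[p] := Polynomial.C a + Polynomial.C b * Polynomial.X + Polynomial.C c * Polynomial.X ^ 2
  have h1 : ∀ t, F.aeval t = a + b * t + c * t ^ 2 := by intro t; simp [F]
  have h2 : F.derivative.aeval (0 : ℤ_[p]) = b := by simp [F]
  have hbn : ‖b‖ = 1 := PadicInt.isUnit_iff.mp hb
  obtain ⟨z, hz, hz2, _⟩ := hensels_lemma (F := F) (a := (0 : ℤ_[p])) (by
    rw [h1, h2, hbn]; simpa using ha)
  rw [h1] at hz
  rw [h2, hbn, sub_zero] at hz2
  exact ⟨z, hz, hz2⟩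

lemma PadicIsomP.refl {k : ℕ} (M : Matrix (Fin k) (Fin k) ℤ_[p]) : PadicIsomP p M M := ⟨1, by simp, by simp⟩

lemma PadicIsomP.symm {k : ℕ} {M N : Matrix (Fin k) (Fin k) ℤ_[p]} (h : PadicIsomP p M N) : PadicIsomP p N M := by
  obtain ⟨U, hU, rfl⟩ := h
  refine ⟨U⁻¹, ?_, ?_⟩
  · exact (Matrix.isUnit_nonsing_inv_det_iff).mpr hU
  · have h1 : U * U⁻¹ = 1 := Matrix.mul_nonsing_inv U hU
    have h2 : U⁻¹ᵀ * Uᵀ = 1 := by rw [← transpose_mul, h1, transpose_one]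
    calc U⁻¹ᵀ * (Uᵀ * M * U) * U⁻¹ = (U⁻¹ᵀ * Uᵀ) * M * (U * U⁻¹) := by simp only [Matrix.mul_assoc]
      _ = M := by rw [h1, h2]; simp

lemma PadicIsomP.trans {k : ℕ} {M N K : Matrix (Fin k) (Fin k) ℤ_[p]} (h : PadicIsomP p M N) (h' : PadicIsomP p N K) : PadicIsomP p M K := by
  obtain ⟨U, hU, rfl⟩ := h
  obtain ⟨V, hV, rfl⟩ := h'
  exact ⟨U * V, by rw [det_mul]; exact hU.mul hV, by rw [transpose_mul]; simp only [Matrix.mul_assoc]⟩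

lemma padicMat_mul (A B : TernMat) : padicMat p (A * B) = padicMat p A * padicMat p B :=
  Matrix.map_mul (f := Int.castRingHom ℤ_[p])

lemma padicMat_det (A : TernMat) : (padicMat p A).det = (A.det : ℤ_[p]) :=
  ((Int.castRingHom ℤ_[p]).map_det A).symm

lemma padicMat_transpose (A : TernMat) : padicMat p Aᵀ = (padicMat p A)ᵀ := rfl

lemma padicMat_apply (A : TernMat) (i j) : padicMat p A i j = (A i j : ℤ_[p]) := rfl

lemma LatIsom.padicP {A B : TernMat} (h : LatIsom A B) : PadicIsomP p (padicMat p A) (padicMat p B) := by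
  obtain ⟨U, hU, rfl⟩ := h
  refine ⟨padicMat p U, ?_, ?_⟩
  · rw [padicMat_det]; exact hU.map (Int.castRingHom ℤ_[p])
  · rw [padicMat_mul, padicMat_mul, padicMat_transpose]

/-- 2-adic normal form -/
lemma normal_form {M : Matrix (Fin 3) (Fin 3) ℤ_[2]} (hs : M.IsSymm) {α β : ℤ_[2]} (h00 : M 0 0 = 4 * α)
    (h11 : M 1 1 = 2 * β) (h01 : IsUnit (M 0 1)) :
    PadicIsomP 2 M !![0, 1, 0; 1, 0, 0; 0, 0, -M.det] := by
  have s1 := hs.apply 0 1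
  have s2 := hs.apply 0 2
  have s3 := hs.apply 1 2
  have n2 : ‖(2 : ℤ_[2])‖ < 1 := by
    have := PadicInt.norm_p (p := 2)
    simp only [Nat.cast_ofNat] at this
    rw [this]; norm_num
  obtain ⟨t, ht, htn⟩ := hensel_quad (2 * α) (M 0 1) β h01 (by
    rw [norm_mul]
    calc ‖(2 : ℤ_[2])‖ * ‖α‖ ≤ ‖(2 : ℤ_[2])‖ * 1 := by gcongr; exact PadicInt.norm_le_one α
      _ < 1 := by simpa using n2)
  have hg : IsUnit (M 0 1 + 2 * t * β) := by
    rw [PadicInt.isUnit_iff] at h01 ⊢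
    have : ‖2 * t * β‖ < ‖M 0 1‖ := by
      rw [h01, norm_mul, norm_mul]
      calc ‖(2 : ℤ_[2])‖ * ‖t‖ * ‖β‖ ≤ ‖(2 : ℤ_[2])‖ * 1 * 1 := by
            gcongr
            exact PadicInt.norm_le_one β
        _ < 1 := by simpa using n2
    rw [PadicInt.norm_add_eq_max_of_ne this.ne', h01, max_eq_left]
    rw [h01] at this; exact this.le
  obtain ⟨h, hh⟩ := hg.exists_right_inv
  set g := M 0 1 + 2 * t * β with hgd
  -- step 1
  let U1 : Matrix (Fin 3) (Fin 3) ℤ_[2] := !![1, -h^2*β, 0; t, h - h^2*β*t, 0; 0, 0, 1]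
  have d1 : U1.det = h := by simp [U1, det_fin_three]
  obtain ⟨r, hr⟩ : ∃ r, r = M 1 2 * (h - h^2*β*t) - h^2*β* M 0 2 := ⟨_, rfl⟩
  obtain ⟨q, hq⟩ : ∃ q, q = M 0 2 + t * M 1 2 := ⟨_, rfl⟩
  have e1 : U1ᵀ * M * U1 = !![0, 1, q; 1, 0, r; q, r, M 2 2] := by
    ext i j
    simp only [Matrix.mul_apply, Fin.sum_univ_three, transpose_apply]
    fin_cases i <;> fin_cases j <;> simp [U1, s1, s2, s3, h00, h11]
    · linear_combination 2 * ht
    · linear_combination (-2 * h ^ 2 * β) * ht + hh 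
    · linear_combination (-1 : ℤ_[2]) * hq
    · linear_combination (-2 * h ^ 2 * β) * ht + hh 
    · linear_combination 2 * h ^ 4 * β ^ 2 * ht - 2 * h ^ 2 * β * hh
    · linear_combination (-1 : ℤ_[2]) * hr
    · linear_combination (-1 : ℤ_[2]) * hq
    · linear_combination (-1 : ℤ_[2]) * hr
  let U2 : Matrix (Fin 3) (Fin 3) ℤ_[2] := !![1, 0, -r * g; 0, 1, -q * g; 0, 0, g]
  have d2 : U2.det = g := by simp [U2, det_fin_three]
  have hdet : M.det * h ^ 2 = - M 2 2 + 2 * q * r := by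
    have := congrArg Matrix.det e1
    rw [det_mul, det_mul, det_transpose, d1] at this
    rw [det_fin_three (!![0, 1, q; 1, 0, r; q, r, M 2 2])] at this
    simp at this
    linear_combination this
  have e2 : U2ᵀ * !![0, 1, q; 1, 0, r; q, r, M 2 2] * U2 = !![0, 1, 0; 1, 0, 0; 0, 0, -M.det] := by
    ext i j
    simp only [Matrix.mul_apply, Fin.sum_univ_three, transpose_apply]
    fin_cases i <;> fin_cases j <;> simp [U2] <;> try ring
    linear_combination (g^2) * hdet - M.det * (g * h + 1) * hh
  exact PadicIsomP.trans ⟨U1, by rw [d1]; exact IsUnit.of_mul_eq_one_right _ hh, e1⟩ ⟨U2, by rw [d2]; exact hg, e2⟩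

lemma unit_of_odd {x : ℤ} (h : ¬ 2 ∣ x) : IsUnit (x : ℤ_[2]) := by
  rw [PadicInt.isUnit_iff]
  by_contra hn
  have h1 : ‖(x : ℤ_[2])‖ < 1 := lt_of_le_of_ne (PadicInt.norm_le_one _) hn
  have := (PadicInt.norm_int_lt_one_iff_dvd (p := 2) x).mp h1
  exact h (by exact_mod_cast this)

lemma padicMat_symm {A : TernMat} (h : A.IsSymm) : (padicMat p A).IsSymm := by
  unfold Matrix.IsSymm; rw [← padicMat_transpose, h.eq]

lemma NormL.nf {L : TernMat} (h : NormL L) : PadicIsomP 2 (padicMat 2 L) !![0, 1, 0; 1, 0, 0; 0, 0, -(L.det : ℤ_[2])] := by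
  obtain ⟨a, b, c, g, k, l, h1, h2, h3, h4, h5, h6, h7, h8, h9⟩ := normL_param h
  rw [← padicMat_det]
  refine normal_form (padicMat_symm h.1) (α := a) (β := 2 * b) ?_ ?_ ?_
  · rw [padicMat_apply, h1]; push_cast; ring
  · rw [padicMat_apply, h2]; push_cast; ring
  · rw [padicMat_apply]; exact unit_of_odd (by omega)

lemma NormE.nf {E : TernMat} (h : NormE E) {d : ℤ} (hd : E.det = 2 * d) (hod : ¬ 2 ∣ d) :
    PadicIsomP 2 (padicMat 2 E) !![0, 1, 0; 1, 0, 0; 0, 0, -(E.det : ℤ_[2])] := by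
  obtain ⟨a, b, c, g, k, l, h1, h2, h3, h4, h5, h6, h7, h8, h9⟩ := normE_param h
  have hc := normE_c_odd h hd hod h3
  let S : TernMat := !![1, 0, 0; 0, 1, 0; a, 0, 1]
  have dS : S.det = 1 := by simp [S, det_fin_three]
  have hiso : LatIsom E (Sᵀ * E * S) := ⟨S, by rw [dS]; exact isUnit_one, rfl⟩
  have hdet : (Sᵀ * E * S).det = E.det := by rw [det_mul, det_mul, det_transpose, dS]; ring
  refine hiso.padicP.trans ?_
  rw [← hdet, ← padicMat_det]
  obtain ⟨T, hT⟩ := tri a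
  obtain ⟨c1, hc1⟩ : ∃ c1, c = 2 * c1 + 1 := ⟨c / 2, by omega⟩
  refine normal_form (padicMat_symm (symm_comp h.1 S)) (α := ((a + T + c1 * (a * a) + 2 * k * a : ℤ) : ℤ_[2])) (β := b) ?_ ?_ ?_
  · rw [padicMat_apply]
    have : (Sᵀ * E * S) 0 0 = 4 * (a + T + c1 * (a * a) + 2 * k * a) := by
      simp [Matrix.mul_apply, Fin.sum_univ_three, S, h1, h2, h3, h4, h5, h6, h7, h8, h9]
      rw [hc1]
      linear_combination 2 * hT
    rw [this]; push_cast; ring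
  · rw [padicMat_apply]
    have : (Sᵀ * E * S) 1 1 = 2 * b := by
      simp [Matrix.mul_apply, Fin.sum_univ_three, S, h1, h2, h3, h4, h5, h6, h7, h8, h9]
    rw [this]; push_cast; ring
  · rw [padicMat_apply]
    apply unit_of_odd
    have : (Sᵀ * E * S) 0 1 = 2 * (g + 2 * a * l) + 1 := by
      simp [Matrix.mul_apply, Fin.sum_univ_three, S, h1, h2, h3, h4, h5, h6, h7, h8, h9]
      ring
    omega
end


lemma InGenus.refl {A : TernMat} (h : IsLat A) : InGenus A A := ⟨h, fun p hp => by
  haveI : Fact p.Prime := ⟨hp⟩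
  exact PadicIsomP.refl (p := p) _⟩

lemma InGenus.cl {A B C : TernMat} (h : InGenus A B) (h' : LatIsom B C) : InGenus A C := ⟨h'.isLat h.1, fun p hp => by
  haveI : Fact p.Prime := ⟨hp⟩
  exact PadicIsomP.trans (p := p) (h.2 p hp) h'.padicP⟩

lemma InGenus.trans' {A B C : TernMat} (h : InGenus A B) (h' : InGenus B C) : InGenus A C := ⟨h'.1, fun p hp => by
  haveI : Fact p.Prime := ⟨hp⟩
  exact PadicIsomP.trans (p := p) (h.2 p hp) (h'.2 p hp)⟩

lemma InGenus.det_eq {A B : TernMat} (hA : IsLat A) (h : InGenus A B) : B.det = A.det := by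
  have hp1 := hA.det_pos
  have hp2 := h.1.det_pos
  have key : ∀ p k : ℕ, p.Prime → ((p ^ k : ℕ) ∣ A.det.natAbs ↔ (p ^ k : ℕ) ∣ B.det.natAbs) := by
    intro p k hp
    haveI : Fact p.Prime := ⟨hp⟩
    obtain ⟨U, hU, e⟩ := h.2 p hp
    have := congrArg Matrix.det e
    rw [det_mul, det_mul, det_transpose, padicMat_det, padicMat_det] at this
    have h1 : ∀ x : ℤ, (p ^ k : ℕ) ∣ x.natAbs ↔ ((p : ℤ_[p]) ^ k ∣ (x : ℤ_[p])) := by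
      intro x
      rw [PadicInt.pow_p_dvd_int_iff, ← Int.natCast_dvd]; push_cast; rfl
    rw [h1, h1, ← this]
    rw [hU.dvd_mul_right, hU.dvd_mul_left]
  have : A.det.natAbs = B.det.natAbs := by
    apply Nat.dvd_antisymm
    · rw [Nat.dvd_iff_prime_pow_dvd_dvd]; intro p k hp; exact (key p k hp).mp
    · rw [Nat.dvd_iff_prime_pow_dvd_dvd]; intro p k hp; exact (key p k hp).mpr
  omega

lemma quadVal_add3 {R : Type*} [CommRing R] (M : Matrix (Fin 3) (Fin 3) R) (x y : Fin 3 → R) (c : R) :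
    c ∣ quadVal M (x + c • y) - quadVal M x := by
  simp only [quadVal, Fin.sum_univ_three, Pi.add_apply, Pi.smul_apply, smul_eq_mul]
  refine ⟨x 0 * M 0 0 * y 0 + y 0 * M 0 0 * (x 0 + c * y 0) + (x 0 * M 0 1 * y 1 + y 0 * M 0 1 * (x 1 + c * y 1)) + (x 0 * M 0 2 * y 2 + y 0 * M 0 2 * (x 2 + c * y 2)) +
   (x 1 * M 1 0 * y 0 + y 1 * M 1 0 * (x 0 + c * y 0) + (x 1 * M 1 1 * y 1 + y 1 * M 1 1 * (x 1 + c * y 1)) + (x 1 * M 1 2 * y 2 + y 1 * M 1 2 * (x 2 + c * y 2))) +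
   (x 2 * M 2 0 * y 0 + y 2 * M 2 0 * (x 0 + c * y 0) + (x 2 * M 2 1 * y 1 + y 2 * M 2 1 * (x 1 + c * y 1)) + (x 2 * M 2 2 * y 2 + y 2 * M 2 2 * (x 2 + c * y 2))), by ring⟩

lemma quadVal_cast {p : ℕ} [Fact p.Prime] (A : TernMat) (w : Fin 3 → ℤ) :
    quadVal (padicMat p A) (fun i => (w i : ℤ_[p])) = ((quadVal A w : ℤ) : ℤ_[p]) := by
  simp [quadVal, padicMat_apply]

lemma exists_int_vec {L : TernMat} {v : Fin 3 → ℤ_[2]} {i : Fin 3} (hi : IsUnit (v i))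
    (h4 : 4 ∣ quadVal (padicMat 2 L) v) : ∃ w : Fin 3 → ℤ, ∃ i, ¬ 2 ∣ w i ∧ 4 ∣ quadVal L w := by
  have hs : ∀ j, ∃ r, v j = ((PadicInt.appr (v j) 2 : ℤ) : ℤ_[2]) + 4 * r := by
    intro j
    have := PadicInt.appr_spec 2 (v j)
    rw [Ideal.mem_span_singleton] at this
    obtain ⟨r, hr⟩ := this
    refine ⟨r, ?_⟩
    push_cast at hr ⊢
    linear_combination hr
  choose r hr using hs
  let w : Fin 3 → ℤ := fun j => (PadicInt.appr (v j) 2 : ℤ)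
  have hv : v = (fun j => (w j : ℤ_[2])) + (4 : ℤ_[2]) • r := by ext1 j; rw [hr j]; simp [w]
  refine ⟨w, i, ?_, ?_⟩
  · rintro ⟨k, hk⟩
    rw [hr i] at hi
    have e : ((PadicInt.appr (v i) 2 : ℤ) : ℤ_[2]) = 2 * (k : ℤ_[2]) := by
      have : ((w i : ℤ) : ℤ_[2]) = ((2 * k : ℤ) : ℤ_[2]) := by rw [hk]
      simpa [w] using this
    rw [e] at hi
    have h2 : IsUnit (2 : ℤ_[2]) := isUnit_of_dvd_unit ⟨(k + 2 * r i : ℤ_[2]), by ring⟩ hi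
    have := PadicInt.isUnit_iff.mp h2
    have h3 := PadicInt.norm_p (p := 2)
    simp only [Nat.cast_ofNat] at h3
    rw [h3] at this; norm_num at this
  · have h1 := quadVal_add3 (padicMat 2 L) (fun j => (w j : ℤ_[2])) r 4
    rw [← hv, quadVal_cast] at h1
    have h2 : (4 : ℤ_[2]) ∣ ((quadVal L w : ℤ) : ℤ_[2]) := by
      have := dvd_sub h4 h1
      simpa using this
    have := (PadicInt.pow_p_dvd_int_iff (p := 2) 2 (quadVal L w)).mp (by norm_num; exact h2)
    simpa using this

lemma padic_dvd_of_norm {p : ℕ} [Fact p.Prime] {x y : ℤ_[p]} (hx : x ≠ 0) (h : ‖y‖ ≤ ‖x‖) : x ∣ y := by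
  have hx' : (x : ℚ_[p]) ≠ 0 := by simpa using hx
  refine ⟨⟨(y : ℚ_[p]) / x, ?_⟩, ?_⟩
  · rw [norm_div, div_le_one (norm_pos_iff.mpr hx')]
    simpa using h
  · apply PadicInt.ext
    change (y : ℚ_[p]) = (x : ℚ_[p]) * ((y : ℚ_[p]) / x)
    field_simp

lemma exists_primitive {p : ℕ} [Fact p.Prime] {x : Fin 3 → ℤ_[p]} (hx : x ≠ 0) :
    ∃ y : Fin 3 → ℤ_[p], ∃ i, y i = 1 ∧ ∃ c : ℤ_[p], c ≠ 0 ∧ x = c • y := by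
  obtain ⟨i, hi⟩ := Finite.exists_max (fun i => ‖x i‖)
  have h0 : x i ≠ 0 := by
    intro h
    apply hx
    ext1 j
    have := hi j
    rw [h, norm_zero] at this
    simpa using this
  have hd : ∀ j, x i ∣ x j := by
    intro j
    exact padic_dvd_of_norm h0 (hi j)
  choose y hy using hd
  refine ⟨y, i, ?_, x i, h0, ?_⟩
  · have := hy i
    exact (mul_left_cancel₀ h0 (by rw [mul_one]; exact this)).symm
  · ext1 j; rw [hy j]; simp

lemma isotropic_vec {A : TernMat} (h : SpStar 2 A = 1) : ∃ w : Fin 3 → ℤ, ∃ i, ¬ 2 ∣ w i ∧ 4 ∣ quadVal A w := by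
  unfold SpStar at h
  rw [dif_pos Nat.prime_two] at h
  by_cases hi : @IsotropicP 2 ⟨Nat.prime_two⟩ A
  · obtain ⟨x, hx, hq⟩ := hi
    obtain ⟨y, i, hy, c, hc, e⟩ := exists_primitive hx
    rw [e, quadVal_smul] at hq
    have : quadVal (padicMat 2 A) y = 0 := by
      rcases mul_eq_zero.mp hq with h | h
      · exact absurd (pow_eq_zero_iff (by norm_num) |>.mp h) hc
      · exact h
    exact exists_int_vec (v := y) (i := i) (by rw [hy]; exact isUnit_one) (by rw [this]; exact dvd_zero _)
  · simp [hi] at h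

lemma genus_iso {A B : TernMat} (h : InGenus A B) (hv : ∃ w : Fin 3 → ℤ, ∃ i, ¬ 2 ∣ w i ∧ 4 ∣ quadVal A w) :
    ∃ w : Fin 3 → ℤ, ∃ i, ¬ 2 ∣ w i ∧ 4 ∣ quadVal B w := by
  obtain ⟨w, i, hi, h4⟩ := hv
  obtain ⟨U, hU, e⟩ := h.2 2 Nat.prime_two
  let v : Fin 3 → ℤ_[2] := U⁻¹ *ᵥ (fun i => (w i : ℤ_[2]))
  have hUv : U *ᵥ v = fun i => (w i : ℤ_[2]) := by
    simp only [v]; rw [mulVec_mulVec, Matrix.mul_nonsing_inv U hU, one_mulVec]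
  have hq : quadVal (padicMat 2 B) v = ((quadVal A w : ℤ) : ℤ_[2]) := by
    rw [← e, quadVal_comp]
    rw [← quadVal_cast]; congr 1
  have hunit : ∃ j, IsUnit (v j) := by
    by_contra! hn
    have : ∀ j, (2 : ℤ_[2]) ∣ v j := by
      intro j
      have h1 : ‖v j‖ < 1 := lt_of_le_of_ne (PadicInt.norm_le_one _) (fun h => hn j (PadicInt.isUnit_iff.mpr h))
      have := PadicInt.norm_lt_one_iff_dvd (p := 2) (v j) |>.mp h1
      simpa using this
    have h2 : (2 : ℤ_[2]) ∣ (w i : ℤ_[2]) := by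
      rw [← congrFun hUv i, mulVec, dotProduct]
      exact Finset.dvd_sum fun j _ => Dvd.dvd.mul_left (this j) _
    have := (PadicInt.pow_p_dvd_int_iff (p := 2) 1 (w i)).mp (by simpa using h2)
    exact hi (by simpa using this)
  obtain ⟨j, hj⟩ := hunit
  refine exists_int_vec hj ?_
  rw [hq]
  obtain ⟨k, hk⟩ := h4
  rw [hk]; push_cast; exact dvd_mul_right _ _

section
variable {p : ℕ} [hpf : Fact p.Prime]

lemma padic_unit_of {x : ℤ} (hp : p ≠ 2) (h : x = 2 ∨ x = -2 ∨ x = 4 ∨ x = -4) : IsUnit (x : ℤ_[p]) := by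
  have h2 : IsUnit (2 : ℤ_[p]) := by
    rw [PadicInt.isUnit_iff]
    by_contra hn
    have h1 : ‖((2 : ℤ) : ℤ_[p])‖ < 1 := lt_of_le_of_ne (PadicInt.norm_le_one _) (by simpa using hn)
    have := (PadicInt.norm_int_lt_one_iff_dvd (p := p) 2).mp h1
    have h3 : p ∣ 2 := by exact_mod_cast this
    exact hp ((Nat.prime_dvd_prime_iff_eq hpf.out Nat.prime_two).mp h3)
  rcases h with rfl | rfl | rfl | rfl
  · simpa using h2
  · push_cast; exact h2.neg
  · have := h2.mul h2; push_cast; convert this using 1; norm_num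
  · have := (h2.mul h2).neg; push_cast; convert this using 1; norm_num

lemma padicMat_two_smul (A : TernMat) : padicMat p ((2 : ℤ) • A) = (2 : ℤ_[p]) • padicMat p A := by
  ext i j; simp only [padicMat_apply, Matrix.smul_apply, smul_eq_mul]; push_cast; rfl

lemma half_isom (hp : p ≠ 2) {E E0 L L0 P P0 : TernMat} (h : PadicIsomP p (padicMat p E0) (padicMat p E))
    (e : Pᵀ * E * P = (2 : ℤ) • L) (e0 : P0ᵀ * E0 * P0 = (2 : ℤ) • L0)
    (hP : P.det = 2 ∨ P.det = -2 ∨ P.det = 4 ∨ P.det = -4) (hP0 : P0.det = 2 ∨ P0.det = -2 ∨ P0.det = 4 ∨ P0.det = -4) :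
    PadicIsomP p (padicMat p L0) (padicMat p L) := by
  have h1 : PadicIsomP p (padicMat p E) ((2 : ℤ_[p]) • padicMat p L) := by
    refine ⟨padicMat p P, by rw [padicMat_det]; exact padic_unit_of hp hP, ?_⟩
    rw [← padicMat_transpose, ← padicMat_mul, ← padicMat_mul, e, padicMat_two_smul]
  have h2 : PadicIsomP p (padicMat p E0) ((2 : ℤ_[p]) • padicMat p L0) := by
    refine ⟨padicMat p P0, by rw [padicMat_det]; exact padic_unit_of hp hP0, ?_⟩
    rw [← padicMat_transpose, ← padicMat_mul, ← padicMat_mul, e0, padicMat_two_smul]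
  obtain ⟨U, hU, hUe⟩ := (h2.symm.trans h).trans h1
  refine ⟨U, hU, ?_⟩
  rw [Matrix.mul_smul, Matrix.smul_mul] at hUe
  have h2 : (2 : ℤ_[p]) ≠ 0 := by norm_num
  exact smul_right_injective _ h2 hUe
end

lemma iso2_L {L L0 : TernMat} {d : ℤ} (hs : L.IsSymm) (hs0 : L0.IsSymm) (hd : L.det = d) (hd0 : L0.det = d) (hod : ¬ 2 ∣ d)
    (hv : ∃ w : Fin 3 → ℤ, ∃ i, ¬ 2 ∣ w i ∧ 4 ∣ quadVal L w) (hv0 : ∃ w : Fin 3 → ℤ, ∃ i, ¬ 2 ∣ w i ∧ 4 ∣ quadVal L0 w) :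
    PadicIsomP 2 (padicMat 2 L0) (padicMat 2 L) := by
  obtain ⟨v, i, hi, h4⟩ := hv
  obtain ⟨v0, i0, hi0, h40⟩ := hv0
  obtain ⟨M, hM, nM⟩ := exists_normL hs (by rw [hd]; exact hod) hi h4
  obtain ⟨M0, hM0, nM0⟩ := exists_normL hs0 (by rw [hd0]; exact hod) hi0 h40
  have n1 := nM.nf
  have n0 := nM0.nf
  rw [hM.det_eq, hd] at n1
  rw [hM0.det_eq, hd0] at n0
  exact hM0.padicP.trans (n0.trans (n1.symm.trans hM.symm.padicP))

lemma iso2_E {E E0 : TernMat} {d : ℤ} (hs : E.IsSymm) (hs0 : E0.IsSymm) (hd : E.det = 2 * d) (hd0 : E0.det = 2 * d) (hod : ¬ 2 ∣ d)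
    (hv : IsEvenLat E) (hv0 : IsEvenLat E0) : PadicIsomP 2 (padicMat 2 E0) (padicMat 2 E) := by
  obtain ⟨M, hM, nM⟩ := exists_normE hs hv hd hod
  obtain ⟨M0, hM0, nM0⟩ := exists_normE hs0 hv0 hd0 hod
  have n1 := nM.nf (by rw [hM.det_eq, hd]) hod
  have n0 := nM0.nf (by rw [hM0.det_eq, hd0]) hod
  rw [hM.det_eq, hd] at n1
  rw [hM0.det_eq, hd0] at n0
  exact hM0.padicP.trans (n0.trans (n1.symm.trans hM.symm.padicP))

lemma even_genus {A B : TernMat} (hA : IsLat A) (h : InGenus A B) (he : IsEvenLat A) : IsEvenLat B := by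
  obtain ⟨U, hU, e⟩ := h.2 2 Nat.prime_two
  obtain ⟨⟨a, ha⟩, ⟨b, hb⟩, ⟨c, hc⟩⟩ := evD_of_even he
  intro x
  have h1 : (2 : ℤ_[2]) ∣ ((quadVal B x : ℤ) : ℤ_[2]) := by
    rw [← quadVal_cast, ← e, quadVal_comp, quadVal_expand _ (padicMat_symm hA.1)]
    simp only [padicMat_apply, ha, hb, hc]
    push_cast
    refine Dvd.dvd.add (Dvd.dvd.add (Dvd.dvd.add ?_ ?_) ?_) (dvd_mul_right _ _)
    all_goals rw [mul_assoc]; exact dvd_mul_right _ _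
  have := (PadicInt.pow_p_dvd_int_iff (p := 2) 1 (quadVal B x)).mp (by simpa using h1)
  simpa using this

lemma quadVal_two_smul (L : TernMat) (x : Fin 3 → ℤ) : quadVal ((2 : ℤ) • L) x = 2 * quadVal L x := by
  simp only [quadVal, Matrix.smul_apply, smul_eq_mul, Finset.mul_sum]
  refine Finset.sum_congr rfl fun i _ => Finset.sum_congr rfl fun j _ => by ring

lemma lat_of_two {L : TernMat} (h : IsLat ((2 : ℤ) • L)) : IsLat L := by
  refine ⟨?_, fun x hx => ?_⟩
  · apply two_smul_inj
    have := h.1.eq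
    rwa [transpose_smul] at this
  · have := h.2 x hx
    rw [quadVal_two_smul] at this
    omega

lemma det_of_half {E L P : TernMat} (e : Pᵀ * E * P = (2 : ℤ) • L) : P.det ^ 2 * E.det = 8 * L.det := by
  have h1 := congrArg Matrix.det e
  rw [det_mul, det_mul, det_transpose, det_smul] at h1
  simp at h1
  linarith

lemma link_iso {E L P : TernMat} {d : ℤ} (hd : ¬ 2 ∣ d) (hE : E.det = 2 * d) (hL : L.det = d) (he : IsEvenLat E)
    (e : Pᵀ * E * P = (2 : ℤ) • L) : ∃ w : Fin 3 → ℤ, ∃ i, ¬ 2 ∣ w i ∧ 4 ∣ quadVal L w := by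
  have hd0 : d ≠ 0 := by rintro rfl; exact hd (dvd_zero _)
  obtain ⟨P', h1, h2, h3⟩ := dual_exists hd0 hE hL e
  have hdet := det_of_half h3
  have h16 : P'.det ^ 2 = 16 := by
    rw [hE, hL] at hdet
    have : (P'.det ^ 2 - 16) * d = 0 := by linarith
    rcases mul_eq_zero.mp this with h | h
    · linarith
    · exact absurd h hd0
  have hodd : ∃ i j, ¬ 2 ∣ P' i j := by
    by_contra! hn
    obtain ⟨G, hG⟩ := exists_half hn
    rw [hG, det_smul] at h16
    simp at h16
    have : (4 * G.det ^ 2) = 1 := by nlinarith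
    omega
  obtain ⟨i, j, hij⟩ := hodd
  refine ⟨P' *ᵥ (Pi.single j 1), i, by simpa using hij, ?_⟩
  rw [← quadVal_comp, h3, quadVal_two_smul]
  obtain ⟨k, hk⟩ := he (Pi.single j 1)
  rw [hk]; exact ⟨k, by ring⟩

lemma mk_linked {E0 L0 P0 P0' : TernMat} {d : ℤ} (hE0 : IsLat E0) (hL0 : IsLat L0) (hev : IsEvenLat E0)
    (dE : E0.det = 2 * d) (dL : L0.det = d) (hd : ¬ 2 ∣ d) (e : P0ᵀ * E0 * P0 = (2 : ℤ) • L0)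
    (e' : P0'ᵀ * L0 * P0' = (2 : ℤ) • E0) : Linked (InGenus E0) (InGenus L0) d := by
  have hd0 : d ≠ 0 := by rintro rfl; exact hd (dvd_zero _)
  have iso0 := link_iso hd dE dL hev e
  have h4 : P0.det = 2 ∨ P0.det = -2 := by
    have := det_of_half e
    rw [dE, dL] at this
    have : (P0.det ^ 2 - 4) * d = 0 := by linarith
    rcases mul_eq_zero.mp this with h | h
    · have : (P0.det - 2) * (P0.det + 2) = 0 := by linarith
      rcases mul_eq_zero.mp this with h | h
      · left; linarith
      · right; linarith
    · exact absurd h hd0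
  have h16 : P0'.det = 4 ∨ P0'.det = -4 := by
    have := det_of_half e'
    rw [dE, dL] at this
    have : (P0'.det ^ 2 - 16) * d = 0 := by linarith
    rcases mul_eq_zero.mp this with h | h
    · have : (P0'.det - 4) * (P0'.det + 4) = 0 := by linarith
      rcases mul_eq_zero.mp this with h | h
      · left; linarith
      · right; linarith
    · exact absurd h hd0
  refine ⟨hd, fun E h => h.1, fun L h => h.1, fun E h => even_genus hE0 h hev, fun E h => (h.det_eq hE0).trans dE,
    fun L h => (h.det_eq hL0).trans dL, fun L h => genus_iso h iso0, ?_, ?_, fun B C h h' => h.cl h', fun B C h h' => h.cl h'⟩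
  · intro E P L hE hP eP
    have hP0 : P.det ≠ 0 := by rcases hP with h | h <;> rw [h] <;> norm_num
    have hL : IsLat L := lat_of_two (eP ▸ hE.1.comp hP0)
    have hEd : E.det = 2 * d := (hE.det_eq hE0).trans dE
    have hLd : L.det = d := by
      have := det_of_half eP
      rcases hP with h | h <;> rw [h, hEd] at this <;> linarith
    refine ⟨hL, fun p hp => ?_⟩
    haveI : Fact p.Prime := ⟨hp⟩
    by_cases h2 : p = 2
    · subst h2
      exact iso2_L hL.1 hL0.1 hLd dL hd (link_iso hd hEd hLd (even_genus hE0 hE hev) eP) iso0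
    · exact half_isom h2 (hE.2 p hp) eP e (by tauto) (by tauto)
  · intro L P E hL hP eP hEe
    have hP0 : P.det ≠ 0 := by rcases hP with h | h <;> rw [h] <;> norm_num
    have hE : IsLat E := lat_of_two (eP ▸ hL.1.comp hP0)
    have hLd : L.det = d := (hL.det_eq hL0).trans dL
    have hEd : E.det = 2 * d := by
      have := det_of_half eP
      rcases hP with h | h <;> rw [h, hLd] at this <;> linarith
    refine ⟨hE, fun p hp => ?_⟩
    haveI : Fact p.Prime := ⟨hp⟩
    by_cases h2 : p = 2
    · subst h2
      exact iso2_E hE.1 hE0.1 hEd dE hd hEe hev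
    · exact half_isom h2 (hL.2 p hp) eP e' (by tauto) (by tauto)

lemma linked_of_even {A : TernMat} {d : ℤ} (hA : IsLat A) (hev : IsEvenLat A) (hd : A.det = 2 * d) (hod : ¬ 2 ∣ d) :
    ∃ L0, IsLat L0 ∧ Linked (InGenus A) (InGenus L0) d := by
  have hd0 : d ≠ 0 := by rintro rfl; exact hod (dvd_zero _)
  obtain ⟨C, hC, nC⟩ := exists_normE hA.1 hev hd hod
  obtain ⟨hs, h00, h11, h22, h01, h02, h12⟩ := nC
  have hev' := hC.even hev
  have hs1 := hs.apply 0 1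
  have hs2 := hs.apply 0 2
  have hs3 := hs.apply 1 2
  have hhalf : ∀ i j, 2 ∣ ((TT 0)ᵀ * C * TT 0) i j := by
    intro i j
    fin_cases i <;> fin_cases j <;> simp [TT, Matrix.mul_apply, Fin.sum_univ_three] <;> omega
  obtain ⟨L0, e⟩ := exists_half hhalf
  have hCd : C.det = 2 * d := by rw [hC.det_eq, hd]
  have hCl := hC.isLat hA
  have hL : IsLat L0 := lat_of_two (e ▸ hCl.comp (by rcases TT_det 0 with h | h <;> rw [h] <;> norm_num))
  have hLd : L0.det = d := by
    have := det_of_half e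
    rcases TT_det 0 with h | h <;> rw [h, hCd] at this <;> linarith
  obtain ⟨P', _, _, e'⟩ := dual_exists hd0 hCd hLd e
  obtain ⟨W, hW⟩ := hC
  obtain ⟨W', hW'⟩ := LatIsom.symm ⟨W, hW⟩
  refine ⟨L0, hL, mk_linked (P0 := W * TT 0) (P0' := P' * W') hA hL hev hd hLd hod ?_ ?_⟩
  · rw [comp_comp, hW.2, e]
  · rw [comp_comp, e', Matrix.mul_smul, Matrix.smul_mul, hW'.2]

lemma linked_of_odd {A : TernMat} {d : ℤ} (hA : IsLat A) (hi : SpStar 2 A = 1) (hd : A.det = d) (hod : ¬ 2 ∣ d) :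
    ∃ E0, IsLat E0 ∧ Linked (InGenus E0) (InGenus A) d := by
  have hd0 : d ≠ 0 := by rintro rfl; exact hod (dvd_zero _)
  obtain ⟨v, i, hv, h4⟩ := isotropic_vec hi
  obtain ⟨C, hC, nC⟩ := exists_normL hA.1 (by rwa [hd]) hv h4
  obtain ⟨hs, h00, h11, h22, h01, h02, h12⟩ := nC
  have hs1 := hs.apply 0 1
  have hs2 := hs.apply 0 2
  have hs3 := hs.apply 1 2
  have hhalf : ∀ i j, 2 ∣ ((SS 0)ᵀ * C * SS 0) i j := by
    intro i j
    fin_cases i <;> fin_cases j <;> simp [SS, Matrix.mul_apply, Fin.sum_univ_three] <;> omega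
  obtain ⟨E0, e⟩ := exists_half hhalf
  have hCd : C.det = d := by rw [hC.det_eq, hd]
  have hCl := hC.isLat hA
  have hE : IsLat E0 := lat_of_two (e ▸ hCl.comp (by rcases SS_det 0 with h | h <;> rw [h] <;> norm_num))
  have hEd : E0.det = 2 * d := by
    have := det_of_half e
    rcases SS_det 0 with h | h <;> rw [h, hCd] at this <;> linarith
  have hEv : IsEvenLat E0 := by
    apply even_of_evD hE.1
    have a0 := congrFun (congrFun e 0) 0
    have a1 := congrFun (congrFun e 1) 1
    have a2 := congrFun (congrFun e 2) 2
    simp [SS, Matrix.mul_apply, Fin.sum_univ_three] at a0 a1 a2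
    refine ⟨?_, ?_, ?_⟩ <;> omega
  obtain ⟨P', hP'⟩ := SS_scal 0
  have e' := hom2_dual hP' e
  obtain ⟨W, hW⟩ := hC
  obtain ⟨W', hW'⟩ := LatIsom.symm ⟨W, hW⟩
  refine ⟨E0, hE, mk_linked (P0 := P' * W') (P0' := W * SS 0) hE hA hEv hEd hd hod ?_ ?_⟩
  · rw [comp_comp, e', Matrix.mul_smul, Matrix.smul_mul, hW'.2]
  · rw [comp_comp, hW.2, e]


abbrev SL2Z := Matrix.SpecialLinearGroup (Fin 2) ℤ

lemma sl_det (M : SL2Z) : M 0 0 * M 1 1 - M 0 1 * M 1 0 = 1 := by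
  have := M.2; rwa [Matrix.det_fin_two] at this

def mkSL (p q r s : ℤ) (h : p * s - q * r = 1) : SL2Z := ⟨!![p, q; r, s], by rw [Matrix.det_fin_two]; simpa using h⟩

section
variable (p q r s : ℤ) (h : p * s - q * r = 1)
@[simp] lemma mkSL00 : mkSL p q r s h 0 0 = p := rfl
@[simp] lemma mkSL01 : mkSL p q r s h 0 1 = q := rfl
@[simp] lemma mkSL10 : mkSL p q r s h 1 0 = r := rfl
@[simp] lemma mkSL11 : mkSL p q r s h 1 1 = s := rfl
end

lemma sl_mul (M N : SL2Z) (i j : Fin 2) : (M * N) i j = M i 0 * N 0 j + M i 1 * N 1 j := by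
  change (M.1 * N.1) i j = _
  rw [Matrix.mul_apply, Fin.sum_univ_two]

/-- action on forms -/
def fact (f : ℤ × ℤ × ℤ) (M : SL2Z) : ℤ × ℤ × ℤ :=
  (f.1 * M 0 0 ^ 2 + f.2.1 * M 0 0 * M 1 0 + f.2.2 * M 1 0 ^ 2,
    2 * f.1 * M 0 0 * M 0 1 + f.2.1 * (M 0 0 * M 1 1 + M 0 1 * M 1 0) +
        2 * f.2.2 * M 1 0 * M 1 1,
    f.1 * M 0 1 ^ 2 + f.2.1 * M 0 1 * M 1 1 + f.2.2 * M 1 1 ^ 2)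

lemma bqf_iff {f g : ℤ × ℤ × ℤ} : BQFEquiv f g ↔ ∃ M, g = fact f M := by
  unfold BQFEquiv fact
  refine exists_congr fun M => ?_
  rw [Prod.ext_iff, Prod.ext_iff]

lemma fact_mul (f) (M N : SL2Z) : fact f (M * N) = fact (fact f M) N := by
  simp only [fact, sl_mul]
  refine Prod.ext ?_ (Prod.ext ?_ ?_) <;> simp only [] <;> ring

lemma fact_one (f) : fact f 1 = f := by
  have h1 : (1 : SL2Z) 0 0 = 1 := rfl
  have h2 : (1 : SL2Z) 0 1 = 0 := rfl
  have h3 : (1 : SL2Z) 1 0 = 0 := rfl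
  have h4 : (1 : SL2Z) 1 1 = 1 := rfl
  simp only [fact, h1, h2, h3, h4]
  refine Prod.ext ?_ (Prod.ext ?_ ?_) <;> simp only [] <;> ring

lemma fact_disc (f) (M : SL2Z) : (fact f M).2.1 ^ 2 - 4 * (fact f M).1 * (fact f M).2.2 = f.2.1 ^ 2 - 4 * f.1 * f.2.2 := by
  have := sl_det M
  simp only [fact]
  have e : ∀ a b c p q r s : ℤ, (2 * a * p * q + b * (p * s + q * r) + 2 * c * r * s) ^ 2 - 4 * (a * p ^ 2 + b * p * r + c * r ^ 2) * (a * q ^ 2 + b * q * s + c * s ^ 2) = (p * s - q * r) ^ 2 * (b ^ 2 - 4 * a * c) := by intros; ring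
  rw [e, this]; ring

lemma gcd3 (a b c : ℤ) : Int.gcd a (Int.gcd b c) = 1 ↔ ∀ k : ℤ, k ∣ a → k ∣ b → k ∣ c → k ∣ 1 := by
  constructor
  · intro h k h1 h2 h3
    have := Int.dvd_coe_gcd h1 (Int.dvd_coe_gcd h2 h3)
    rw [h] at this; exact_mod_cast this
  · intro h
    have h1 := Int.gcd_dvd_left a (Int.gcd b c)
    have h2 := Int.gcd_dvd_right a (Int.gcd b c)
    have := h _ h1 (h2.trans (Int.gcd_dvd_left _ _)) (h2.trans (Int.gcd_dvd_right _ _))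
    have h3 : Int.gcd a (Int.gcd b c) ∣ 1 := by exact_mod_cast this
    exact Nat.dvd_one.mp h3

lemma dvd_fact {k : ℤ} {f : ℤ × ℤ × ℤ} (M : SL2Z) (h1 : k ∣ f.1) (h2 : k ∣ f.2.1) (h3 : k ∣ f.2.2) :
    k ∣ (fact f M).1 ∧ k ∣ (fact f M).2.1 ∧ k ∣ (fact f M).2.2 := by
  obtain ⟨a, ha⟩ := h1
  obtain ⟨b, hb⟩ := h2
  obtain ⟨c, hc⟩ := h3
  simp only [fact, ha, hb, hc]
  refine ⟨⟨a * M 0 0 ^ 2 + b * M 0 0 * M 1 0 + c * M 1 0 ^ 2, by ring⟩,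
   ⟨2 * a * M 0 0 * M 0 1 + b * (M 0 0 * M 1 1 + M 0 1 * M 1 0) + 2 * c * M 1 0 * M 1 1, by ring⟩, ⟨a * M 0 1 ^ 2 + b * M 0 1 * M 1 1 + c * M 1 1 ^ 2, by ring⟩⟩

lemma fact_inv (f) (M : SL2Z) : fact (fact f M) M⁻¹ = f := by
  rw [← fact_mul, mul_inv_cancel, fact_one]

lemma posd {a b c D x y : ℤ} (ha : 0 < a) (hD : 0 < D) (h : b ^ 2 - 4 * a * c = -D) (hxy : x ≠ 0 ∨ y ≠ 0) :
    0 < a * x ^ 2 + b * x * y + c * y ^ 2 := by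
  have e : 4 * a * (a * x ^ 2 + b * x * y + c * y ^ 2) = (2 * a * x + b * y) ^ 2 + D * y ^ 2 := by
    have : D = 4 * a * c - b ^ 2 := by linarith
    rw [this]; ring
  have : 0 < 4 * a * (a * x ^ 2 + b * x * y + c * y ^ 2) := by
    rw [e]
    by_cases hy : y = 0
    · subst hy
      have hx : x ≠ 0 := by tauto
      have : 0 < (2 * a * x) ^ 2 := by positivity
      nlinarith
    · have : 0 < D * y ^ 2 := by positivity
      nlinarith [sq_nonneg (2 * a * x + b * y)]
  by_contra hn
  push Not at hn
  nlinarith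

lemma fact_prim {D : ℤ} (hD : 0 < D) {f} (h : IsPrimPosDefBQF (-D) f) (M : SL2Z) : IsPrimPosDefBQF (-D) (fact f M) := by
  obtain ⟨h1, h2, h3⟩ := h
  refine ⟨by rw [fact_disc]; exact h1, ?_, ?_⟩
  · rw [gcd3] at h2 ⊢
    intro k k1 k2 k3
    obtain ⟨l1, l2, l3⟩ := dvd_fact M⁻¹ k1 k2 k3
    rw [fact_inv] at l1 l2 l3
    exact h2 k l1 l2 l3
  · have := sl_det M
    apply posd h3 hD h1
    by_contra! hn
    rw [hn.1, hn.2] at this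
    omega

abbrev XF (D : ℤ) := {f : ℤ × ℤ × ℤ // IsPrimPosDefBQF (-D) f}
abbrev ClF (D : ℤ) := Quot fun f g : XF D => BQFEquiv f.1 g.1

lemma bqf_equivalence (D : ℤ) : Equivalence (fun f g : XF D => BQFEquiv f.1 g.1) := by
  refine ⟨fun f => bqf_iff.mpr ⟨1, (fact_one _).symm⟩, fun {f g} h => ?_, fun {f g k} h h' => ?_⟩
  · obtain ⟨M, hM⟩ := bqf_iff.mp h
    exact bqf_iff.mpr ⟨M⁻¹, by rw [hM, fact_inv]⟩
  · obtain ⟨M, hM⟩ := bqf_iff.mp h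
    obtain ⟨N, hN⟩ := bqf_iff.mp h'
    exact bqf_iff.mpr ⟨M * N, by rw [fact_mul, ← hM, hN]⟩

lemma cl_eq {D : ℤ} {f g : XF D} : (Quot.mk _ f : ClF D) = Quot.mk _ g ↔ ∃ M, g.1 = fact f.1 M := by
  rw [(bqf_equivalence D).quot_mk_eq_iff, bqf_iff]

/-- automorphs are trivial -/
lemma aut_triv {D : ℤ} (hD : 4 < D) {f} (h : IsPrimPosDefBQF (-D) f) {M : SL2Z} (e : f = fact f M) :
    M 0 1 = 0 ∧ M 1 0 = 0 ∧ M 0 0 = M 1 1 := by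
  obtain ⟨a, b, c⟩ := f
  obtain ⟨h1, h2, h3⟩ := h
  simp only at h1 h2 h3
  rw [gcd3] at h2
  have hd := sl_det M
  simp only [fact, Prod.ext_iff] at e
  obtain ⟨e1, e2, e3⟩ := e
  generalize M 0 0 = p at *
  generalize M 0 1 = q at *
  generalize M 1 0 = r at *
  generalize M 1 1 = s at *
  have i1 : a * (s - p) = b * r := by
    have : 2 * (a * (s - p) - b * r) = 0 := by
      linear_combination (2 * s) * e1 - r * e2 + (-2 * a * p - b * r) * (-1) * (hd) * 1 
    linarith
  have i2 : a * q = - (c * r) := by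
    have : 2 * (a * q + c * r) = 0 := by
      linear_combination (2 * q) * e1 - p * e2 - (b * p + 2 * c * r) * hd
    linarith
  have i3 : a ^ 2 * ((p + s) ^ 2 - 4) = - (D * r ^ 2) := by
    have : D = 4 * a * c - b ^ 2 := by linarith
    rw [this]
    linear_combination (a * (s - p) + b * r) * i1 + 4 * a * r * i2 + 4 * a ^ 2 * hd
  have hr : a ∣ r := by
    have k1 : (a : ℤ) ∣ r * a := dvd_mul_left _ _
    have k2 : (a : ℤ) ∣ r * b := ⟨s - p, by linarith⟩
    have k3 : (a : ℤ) ∣ r * c := ⟨- q, by linarith⟩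
    have g := gcd3 a b c |>.mpr h2
    have : IsCoprime a (Int.gcd b c : ℤ) := by
      rw [Int.isCoprime_iff_gcd_eq_one]; exact g
    apply this.dvd_of_dvd_mul_right
    rw [Int.gcd_eq_gcd_ab, mul_add, ← mul_assoc, ← mul_assoc]
    exact Dvd.dvd.add (k2.mul_right _) (k3.mul_right _)
  obtain ⟨u, hu⟩ := hr
  have i4 : (p + s) ^ 2 + D * u ^ 2 = 4 := by
    have : a ^ 2 * ((p + s) ^ 2 + D * u ^ 2 - 4) = 0 := by rw [hu] at i3; linarith
    rcases mul_eq_zero.mp this with h | h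
    · exact absurd (pow_eq_zero_iff (by norm_num) |>.mp h) h3.ne'
    · linarith
  have u0 : u = 0 := by
    by_contra hne
    have : 1 ≤ u ^ 2 := by have := sq_pos_of_ne_zero hne; omega
    nlinarith [sq_nonneg (p + s)]
  subst u0
  have r0 : r = 0 := by rw [hu, mul_zero]
  subst r0
  refine ⟨?_, rfl, ?_⟩
  · have : a * q = 0 := by rw [i2]; ring
    rcases mul_eq_zero.mp this with h | h
    · omega
    · exact h
  · have : a * (s - p) = 0 := by rw [i1]; ring
    rcases mul_eq_zero.mp this with h | h
    · omega
    · linarith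


/-- forms with odd last coefficient up to lower congruence group -/
abbrev NF (D : ℤ) := {f : ℤ × ℤ × ℤ // IsPrimPosDefBQF (-D) f ∧ ¬ 2 ∣ f.2.2}
def nrel (D : ℤ) (f g : NF D) : Prop := ∃ M : SL2Z, 2 ∣ M 0 1 ∧ g.1 = fact f.1 M

lemma nrel_equivalence (D : ℤ) : Equivalence (nrel D) := by
  refine ⟨fun f => ⟨1, ⟨0, rfl⟩, (fact_one _).symm⟩, fun {f g} h => ?_, fun {f g k} h h' => ?_⟩
  · obtain ⟨M, h2, hM⟩ := h
    refine ⟨M⁻¹, ?_, by rw [hM, fact_inv]⟩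
    have : (M⁻¹) 0 1 = - M 0 1 := by
      rw [Matrix.SpecialLinearGroup.SL2_inv_expl]; rfl
    rw [this]; exact h2.neg_right
  · obtain ⟨M, h2, hM⟩ := h
    obtain ⟨N, h2', hN⟩ := h'
    refine ⟨M * N, ?_, by rw [fact_mul, ← hM, hN]⟩
    rw [sl_mul]
    exact Dvd.dvd.add (h2'.mul_left _) (h2.mul_right _)

abbrev NQ (D : ℤ) := Quot (nrel D)

lemma nq_eq {D : ℤ} {f g : NF D} : (Quot.mk _ f : NQ D) = Quot.mk _ g ↔ ∃ M : SL2Z, 2 ∣ M 0 1 ∧ g.1 = fact f.1 M := by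
  rw [(nrel_equivalence D).quot_mk_eq_iff]; rfl

def dbl (f : ℤ × ℤ × ℤ) : ℤ × ℤ × ℤ := (4 * f.1, 2 * f.2.1, f.2.2)

lemma coprime_two_of_odd {c : ℤ} (h : ¬ 2 ∣ c) : IsCoprime (2 : ℤ) c := by
  rw [Int.isCoprime_iff_gcd_eq_one]
  have := Int.emod_two_eq_zero_or_one c
  have h1 : c % 2 = 1 := by omega
  rw [← Int.isCoprime_iff_gcd_eq_one]
  exact ⟨-(c/2), 1, by omega⟩

lemma dbl_prim {D : ℤ} {f} (h : IsPrimPosDefBQF (-D) f) (h2 : ¬ 2 ∣ f.2.2) : IsPrimPosDefBQF (-(4 * D)) (dbl f) := by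
  obtain ⟨h1, h3, h4⟩ := h
  refine ⟨by simp only [dbl]; linarith, ?_, by simp only [dbl]; linarith⟩
  rw [gcd3] at h3 ⊢
  simp only [dbl]
  intro k k1 k2 k3
  have hc : IsCoprime k 2 := by
    have := coprime_two_of_odd h2
    exact (this.symm).of_isCoprime_of_dvd_left k3
  have hc4 : IsCoprime k 4 := by
    have := hc.mul_right hc
    norm_num at this; exact this
  exact h3 k (hc4.dvd_of_dvd_mul_left k1) (hc.dvd_of_dvd_mul_left k2) k3

lemma dbl_surj {D : ℤ} (hD : 0 < D) (hmod : D % 4 = 0 ∨ D % 4 = 3) {g} (h : IsPrimPosDefBQF (-(4 * D)) g) :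
    ∃ f M, IsPrimPosDefBQF (-D) f ∧ ¬ 2 ∣ f.2.2 ∧ fact g M = dbl f := by
  have step : ∃ M, 2 ∣ (fact g M).1 := by
    by_cases ha : 2 ∣ g.1
    · exact ⟨1, by rwa [fact_one]⟩
    by_cases hc : 2 ∣ g.2.2
    · exact ⟨mkSL 0 (-1) 1 0 (by norm_num), by simpa [fact] using hc⟩
    · refine ⟨mkSL 1 0 1 1 (by norm_num), ?_⟩
      obtain ⟨h1, -, -⟩ := h
      have hb : 2 ∣ g.2.1 := by
        have : (2:ℤ) ∣ g.2.1 ^ 2 := ⟨2 * (g.1 * g.2.2) - 2 * D, by linarith⟩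
        exact Int.prime_two.dvd_of_dvd_pow this
      simp [fact]
      omega
  obtain ⟨M, hM⟩ := step
  have hp := fact_prim (by linarith : 0 < 4 * D) h M
  generalize hg : fact g M = g' at *
  obtain ⟨A, B, C⟩ := g'
  obtain ⟨h1, h2, h3⟩ := hp
  simp only at h1 h2 h3 hM
  have hb : 2 ∣ B := by
    have : (2:ℤ) ∣ B ^ 2 := ⟨2 * (A * C) - 2 * D, by linarith⟩
    exact Int.prime_two.dvd_of_dvd_pow this
  obtain ⟨b, rfl⟩ := hb
  obtain ⟨a', rfl⟩ := hM
  rw [gcd3] at h2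
  have hC : ¬ 2 ∣ C := by
    intro hC
    have := h2 2 (dvd_mul_right _ _) (dvd_mul_right _ _) hC
    omega
  have e : b ^ 2 - 2 * (a' * C) = -D := by nlinarith
  have ha : 2 ∣ a' := by
    by_contra hn
    have : (a' * C) % 2 = 1 := by
      rw [Int.mul_emod]
      have e1 : a' % 2 = 1 := by omega
      have e2 : C % 2 = 1 := by omega
      rw [e1, e2]; rfl
    have hb : b ^ 2 % 4 = 0 ∨ b ^ 2 % 4 = 1 := by
      rcases Int.even_or_odd' b with ⟨k, rfl | rfl⟩
      · left; ring_nf; omega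
      · right; ring_nf; omega
    omega
  obtain ⟨a, rfl⟩ := ha
  refine ⟨(a, b, C), M, ⟨?_, ?_, ?_⟩, hC, ?_⟩
  · simp only; nlinarith
  · rw [gcd3]; intro k k1 k2 k3
    exact h2 k ((k1.mul_left _).mul_left _) (k2.mul_left _) k3
  · simp only; omega
  · rw [hg]; simp only [dbl]; ring_nf

lemma dbl_iff {D : ℤ} {f g : NF D} : (∃ U : SL2Z, dbl g.1 = fact (dbl f.1) U) ↔ ∃ M : SL2Z, 2 ∣ M 0 1 ∧ g.1 = fact f.1 M := by
  obtain ⟨⟨a, b, c⟩, h, ho⟩ := f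
  obtain ⟨⟨a', b', c'⟩, h', ho'⟩ := g
  simp only at ho ho'
  constructor
  · rintro ⟨U, hU⟩
    have hd := sl_det U
    simp only [dbl, fact, Prod.ext_iff] at hU ⊢
    obtain ⟨e1, e2, e3⟩ := hU
    have hr : 2 ∣ U 1 0 := by
      have : (2:ℤ) ∣ c * U 1 0 ^ 2 := ⟨2 * a' - 2 * a * U 0 0 ^ 2 - b * U 0 0 * U 1 0, by linarith⟩
      have := (coprime_two_of_odd ho).dvd_of_dvd_mul_left this
      exact Int.prime_two.dvd_of_dvd_pow this
    obtain ⟨r, hr⟩ := hr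
    rw [hr] at hd e1 e2
    refine ⟨mkSL (U 0 0) (2 * U 0 1) r (U 1 1) (by linarith), by simp, ?_, ?_, ?_⟩
    · simp only [mkSL00, mkSL10, mkSL01, mkSL11]; linarith
    · simp only [mkSL00, mkSL10, mkSL01, mkSL11]; linarith
    · simp only [mkSL00, mkSL10, mkSL01, mkSL11]; rw [e3]; ring
  · rintro ⟨M, ⟨q, hq⟩, hM⟩
    have hd := sl_det M
    simp only [dbl, fact, Prod.ext_iff] at hM ⊢
    obtain ⟨e1, e2, e3⟩ := hM
    rw [hq] at hd e2 e3
    refine ⟨mkSL (M 0 0) q (2 * M 1 0) (M 1 1) (by linarith), ?_, ?_, ?_⟩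
    · simp only [mkSL00, mkSL10, mkSL01, mkSL11]; rw [e1]; ring
    · simp only [mkSL00, mkSL10, mkSL01, mkSL11]; rw [e2]; ring
    · simp only [mkSL00, mkSL10, mkSL01, mkSL11]; rw [e3]; ring

lemma card_four {D : ℤ} (hD : 0 < D) (hmod : D % 4 = 0 ∨ D % 4 = 3) : Nat.card (NQ D) = classNum (-(4 * D)) := by
  refine Nat.card_congr (Equiv.ofBijective
    (Quot.lift (fun f : NF D => (Quot.mk _ ⟨dbl f.1, dbl_prim f.2.1 f.2.2⟩ : ClF (4 * D))) ?_) ⟨?_, ?_⟩)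
  · intro f g h
    exact cl_eq.mpr (dbl_iff.mpr h)
  · rintro ⟨f⟩ ⟨g⟩ h
    exact nq_eq.mpr (dbl_iff.mp (cl_eq.mp h))
  · rintro ⟨g, hg⟩
    obtain ⟨f, M, hf, ho, e⟩ := dbl_surj hD hmod hg
    refine ⟨Quot.mk _ ⟨f, hf, ho⟩, ?_⟩
    refine (cl_eq.mpr ⟨M, e.symm⟩).symm

def VV : Fin 3 → SL2Z := ![1, mkSL 0 1 (-1) 0 (by norm_num), mkSL 1 1 0 1 (by norm_num)]

/-- allowed indices -/
abbrev Alw (f : ℤ × ℤ × ℤ) := {a : Fin 3 // ¬ 2 ∣ (fact f (VV a)).2.2}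

lemma nq_card_of {D : ℤ} (hD : 4 < D) (k : ℕ) (hk : ∀ f : XF D, Nat.card (Alw f.1) = k) : Nat.card (NQ D) = k * classNum (-D) := by
  have hD0 : 0 < D := by linarith
  have e1 : ∀ c : ClF D, Nonempty (Alw (Quot.out c).1 ≃ Fin k) := by
    intro c
    have := hk (Quot.out c)
    exact ⟨(Finite.equivFin _).trans (finCongr this)⟩
  have e2 : (Σ c : ClF D, Alw (Quot.out c).1) ≃ NQ D := by
    refine Equiv.ofBijective (fun x => Quot.mk _ ⟨fact (Quot.out x.1).1 (VV x.2.1), fact_prim hD0 (Quot.out x.1).2 _, x.2.2⟩) ⟨?_, ?_⟩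
    · rintro ⟨c, a, ha⟩ ⟨c', b, hb⟩ h
      rw [nq_eq] at h
      obtain ⟨W, hW, e⟩ := h
      simp only at e
      rw [← fact_mul] at e
      have e' : (Quot.out c').1 = fact (Quot.out c).1 (VV a * W * (VV b)⁻¹) := by
        rw [fact_mul, ← e, fact_inv]
      have hcc : c = c' := by
        rw [← Quot.out_eq c, ← Quot.out_eq c']
        exact cl_eq.mpr ⟨_, e'⟩
      subst hcc
      obtain ⟨m1, m2, m3⟩ := aut_triv hD (Quot.out c).2 e'
      set M := VV a * W * (VV b)⁻¹ with hM
      have hMV : M * VV b = VV a * W := by rw [hM]; group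
      have q0 := congrArg (fun X : SL2Z => X 0 1) hMV
      have q1 := congrArg (fun X : SL2Z => X 1 1) hMV
      simp only [sl_mul, m1, m2, m3] at q0 q1
      have hdm := sl_det M
      rw [m1, m2, m3] at hdm
      have hmm : M 1 1 = 1 ∨ M 1 1 = -1 := by
        have : (M 1 1 - 1) * (M 1 1 + 1) = 0 := by linarith
        rcases mul_eq_zero.mp this with h | h
        · left; linarith
        · right; linarith
      have hdw := sl_det W
      have hw11 : ¬ 2 ∣ W 1 1 := by
        rintro ⟨k, hk⟩
        obtain ⟨l, hl⟩ := hW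
        rw [hk, hl] at hdw
        have : 2 * (W 0 0 * k - l * W 1 0) = 1 := by linarith
        omega
      have hab : a = b := by
        fin_cases a <;> fin_cases b <;> first | rfl | (exfalso; rcases hmm with h | h <;> rw [h] at q0 q1 <;> simp [VV] at q0 q1 <;> omega)
      subst hab
      rfl
    · rintro ⟨f, hf, ho⟩
      obtain ⟨M, hM⟩ := cl_eq.mp (Quot.out_eq (Quot.mk _ ⟨f, hf⟩ : ClF D))
      simp only at hM
      set F := Quot.out (Quot.mk _ ⟨f, hf⟩ : ClF D) with hF
      have hdm := sl_det M
      have hex : ∃ a : Fin 3, 2 ∣ ((VV a)⁻¹ * M) 0 1 := by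
        by_cases h1 : 2 ∣ M 0 1
        · refine ⟨0, ?_⟩
          simp only [VV, Matrix.cons_val_zero, inv_one, one_mul]; exact h1
        by_cases h2 : 2 ∣ M 1 1
        · refine ⟨1, ?_⟩
          rw [sl_mul, Matrix.SpecialLinearGroup.SL2_inv_expl]
          simp [VV]
          exact h2
        · refine ⟨2, ?_⟩
          rw [sl_mul, Matrix.SpecialLinearGroup.SL2_inv_expl]
          simp [VV]
          omega
      obtain ⟨a, ha⟩ := hex
      have key : f = fact (fact F.1 (VV a)) ((VV a)⁻¹ * M) := by
        rw [← fact_mul, mul_inv_cancel_left, hM]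
      have hodd : ¬ 2 ∣ (fact F.1 (VV a)).2.2 := by
        intro hh
        apply ho
        rw [key]
        generalize fact F.1 (VV a) = G at *
        obtain ⟨k, hk⟩ := hh
        obtain ⟨l, hl⟩ := ha
        simp only [fact, hk, hl]
        exact ⟨G.1 * 2 * l ^ 2 + G.2.1 * l * ((VV a)⁻¹ * M) 1 1 + k * ((VV a)⁻¹ * M) 1 1 ^ 2, by ring⟩
      refine ⟨⟨_, a, hodd⟩, ?_⟩
      exact nq_eq.mpr ⟨_, ha, key⟩
  rw [← Nat.card_congr e2]
  rw [Nat.card_congr ((Equiv.sigmaCongrRight fun c => (e1 c).some).trans (Equiv.sigmaEquivProd _ _)), Nat.card_prod, Nat.card_fin, mul_comm]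
  rfl

lemma alw_card {D : ℤ} (f : XF D) : Nat.card (Alw f.1) = (if ¬ 2 ∣ f.1.2.2 then 1 else 0) + (if ¬ 2 ∣ f.1.1 then 1 else 0) +
    (if ¬ 2 ∣ f.1.1 + f.1.2.1 + f.1.2.2 then 1 else 0) := by
  rw [Nat.card_eq_fintype_card, Fintype.card_subtype, Finset.card_filter, Fin.sum_univ_three]
  have h0 : (fact f.1 (VV 0)).2.2 = f.1.2.2 := by simp [VV, fact_one]
  have h1 : (fact f.1 (VV 1)).2.2 = f.1.1 := by simp [VV, fact]
  have h2 : (fact f.1 (VV 2)).2.2 = f.1.1 + f.1.2.1 + f.1.2.2 := by simp [VV, fact]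
  rw [h0, h1, h2]

lemma sq_mod8 (b : ℤ) : (b % 2 = 0 ∧ b ^ 2 % 4 = 0) ∨ (b % 2 = 1 ∧ b ^ 2 % 8 = 1) := by
  rcases Int.even_or_odd' b with ⟨k, rfl | rfl⟩
  · left; refine ⟨by omega, ?_⟩; ring_nf; omega
  · right; refine ⟨by omega, ?_⟩
    have := Int.even_mul_succ_self k
    obtain ⟨m, hm⟩ := this
    have : (2 * k + 1) ^ 2 = 8 * m + 1 := by linarith
    omega

lemma alw7 {D : ℤ} (h : D % 8 = 7) (f : XF D) : Nat.card (Alw f.1) = 1 := by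
  rw [alw_card]
  obtain ⟨⟨a, b, c⟩, h1, h2, h3⟩ := f
  simp only at *
  have hb := sq_mod8 b
  have : b ^ 2 - 4 * (a * c) = -D := by linarith
  have hac : (a * c) % 2 = 0 := by omega
  rw [Int.mul_emod] at hac
  rcases Int.emod_two_eq_zero_or_one a with ha | ha <;> rcases Int.emod_two_eq_zero_or_one c with hc | hc <;> rw [ha, hc] at hac <;> simp at hac <;> split_ifs <;> omega

lemma alw3 {D : ℤ} (h : D % 8 = 3) (f : XF D) : Nat.card (Alw f.1) = 3 := by
  rw [alw_card]
  obtain ⟨⟨a, b, c⟩, h1, h2, h3⟩ := f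
  simp only at *
  have hb := sq_mod8 b
  have : b ^ 2 - 4 * (a * c) = -D := by linarith
  have hac : (a * c) % 2 = 1 := by omega
  rw [Int.mul_emod] at hac
  rcases Int.emod_two_eq_zero_or_one a with ha | ha <;> rcases Int.emod_two_eq_zero_or_one c with hc | hc <;> rw [ha, hc] at hac <;> simp at hac <;> split_ifs <;> omega

lemma alw0 {D : ℤ} (h : D % 4 = 0) (f : XF D) : Nat.card (Alw f.1) = 2 := by
  rw [alw_card]
  obtain ⟨⟨a, b, c⟩, h1, h2, h3⟩ := f
  simp only at *
  have hb := sq_mod8 b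
  have : b ^ 2 - 4 * (a * c) = -D := by linarith
  rw [gcd3] at h2
  have h4 : ¬ (2 ∣ a ∧ 2 ∣ b ∧ 2 ∣ c) := by
    rintro ⟨ha, hb, hc⟩
    have := h2 2 ha hb hc
    omega
  split_ifs <;> omega

/-- reduction -/
lemma reduce {D : ℤ} (hD : 0 < D) (f : XF D) : ∃ g : XF D, (Quot.mk _ f : ClF D) = Quot.mk _ g ∧
    - g.1.1 < g.1.2.1 ∧ g.1.2.1 ≤ g.1.1 ∧ g.1.1 ≤ g.1.2.2 := by
  -- minimal first coefficient
  have hex : ∃ m : ℕ, ∃ g : XF D, (Quot.mk _ f : ClF D) = Quot.mk _ g ∧ g.1.1 = m :=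
    ⟨f.1.1.toNat, f, rfl, by have := f.2.2.2; omega⟩
  obtain ⟨g, hg, hm⟩ := Nat.find_spec hex
  have hmin := fun k => Nat.find_min hex (m := k)
  generalize Nat.find hex = m at *
  have hg0 := g.2.2.2
  obtain ⟨⟨a, b, c⟩, hgp⟩ := g
  simp only at hm hg0
  -- shear
  let k : ℤ := (a - b) / (2 * a)
  have hk1 : 2 * a * k ≤ a - b := Int.mul_ediv_self_le (by omega)
  have hk2 : a - b < 2 * a * k + 2 * a := Int.lt_mul_ediv_self_add (by omega)
  let M := mkSL 1 k 0 1 (by ring)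
  refine ⟨⟨fact (a, b, c) M, fact_prim hD hgp M⟩, hg.trans (cl_eq.mpr ⟨M, rfl⟩), ?_⟩
  have hcc : a ≤ (fact (a, b, c) M).2.2 := by
    by_contra hlt
    push Not at hlt
    let M' := M * mkSL 0 1 (-1) 0 (by norm_num)
    have e : (fact (a, b, c) M').1 = (fact (a, b, c) M).2.2 := by
      rw [fact_mul]; simp [fact]
    have hp := fact_prim hD hgp M'
    have hpos := hp.2.2
    rw [e] at hpos
    apply hmin ((fact (a, b, c) M).2.2.toNat) (by omega)
    refine ⟨⟨_, hp⟩, hg.trans (cl_eq.mpr ⟨M', rfl⟩), ?_⟩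
    simp only; rw [e]; omega
  have e1 : (fact (a, b, c) M).1 = a := by simp [fact, M]
  have e2 : (fact (a, b, c) M).2.1 = 2 * a * k + b := by simp [fact, M]
  simp only [e1, e2]
  exact ⟨by linarith, by linarith, hcc⟩

lemma card_one {D : ℤ} (hD : 0 < D) (f0 : ℤ × ℤ × ℤ) (h0 : IsPrimPosDefBQF (-D) f0)
    (h : ∀ a b c : ℤ, 0 < a → b ^ 2 - 4 * a * c = -D → (¬ (2 ∣ a ∧ 2 ∣ b ∧ 2 ∣ c)) → -a < b → b ≤ a → a ≤ c → (a, b, c) = f0) :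
    classNum (-D) = 1 := by
  have : ∀ x : ClF D, x = Quot.mk _ ⟨f0, h0⟩ := by
    rintro ⟨f⟩
    obtain ⟨g, hg, h1, h2, h3⟩ := reduce hD f
    refine hg.trans ?_
    congr 1
    ext1
    obtain ⟨⟨a, b, c⟩, g1, g2, g3⟩ := g
    refine h a b c g3 g1 ?_ h1 h2 h3
    rintro ⟨ha, hb, hc⟩
    rw [gcd3] at g2
    have := g2 2 ha hb hc
    omega
  unfold classNum
  rw [Nat.card_eq_one_iff_unique]
  exact ⟨⟨fun x y => (this x).trans (this y).symm⟩, ⟨Quot.mk _ ⟨f0, h0⟩⟩⟩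

lemma cn3 : classNum (-3) = 1 := by
  refine card_one (by norm_num) (1, 1, 1) ⟨by norm_num, by rfl, by norm_num⟩ ?_
  intro a b c h1 h2 h3 h4 h5 h6
  have ha : a < 2 := by nlinarith
  have : a = 1 := by omega
  subst this
  have : b = 0 ∨ b = 1 := by omega
  rcases this with rfl | rfl
  · omega
  · have : c = 1 := by omega
    subst this; rfl

lemma cn4 : classNum (-4) = 1 := by
  refine card_one (by norm_num) (1, 0, 1) ⟨by norm_num, by rfl, by norm_num⟩ ?_
  intro a b c h1 h2 h3 h4 h5 h6
  have ha : a < 2 := by nlinarith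
  have : a = 1 := by omega
  subst this
  have : b = 0 ∨ b = 1 := by omega
  rcases this with rfl | rfl
  · have : c = 1 := by omega
    subst this; rfl
  · omega

lemma cn12 : classNum (-12) = 1 := by
  refine card_one (by norm_num) (1, 0, 3) ⟨by norm_num, by rfl, by norm_num⟩ ?_
  intro a b c h1 h2 h3 h4 h5 h6
  have ha : a < 3 := by nlinarith
  have : a = 1 ∨ a = 2 := by omega
  rcases this with rfl | rfl
  · have : b = 0 ∨ b = 1 := by omega
    rcases this with rfl | rfl
    · have : c = 3 := by omega
      subst this; rfl
    · omega
  · have : b = -1 ∨ b = 0 ∨ b = 1 ∨ b = 2 := by omega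
    rcases this with rfl | rfl | rfl | rfl <;> omega

lemma cn16 : classNum (-16) = 1 := by
  refine card_one (by norm_num) (1, 0, 4) ⟨by norm_num, by rfl, by norm_num⟩ ?_
  intro a b c h1 h2 h3 h4 h5 h6
  have ha : a < 3 := by nlinarith
  have : a = 1 ∨ a = 2 := by omega
  rcases this with rfl | rfl
  · have : b = 0 ∨ b = 1 := by omega
    rcases this with rfl | rfl
    · have : c = 4 := by omega
      subst this; rfl
    · omega
  · have : b = -1 ∨ b = 0 ∨ b = 1 ∨ b = 2 := by omega
    rcases this with rfl | rfl | rfl | rfl <;> omega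

/-- weighted class number -/
noncomputable def hw (N : ℕ) : ℚ := (classNum (-(N : ℤ)) : ℚ) / ((wAut (-(N : ℤ)) : ℚ) / 2)

noncomputable def chi (N : ℕ) : ℚ := if N % 4 = 0 then 0 else if N % 8 = 7 then 1 else -1

lemma hw_four {N : ℕ} (hN : 0 < N) (hmod : N % 4 = 0 ∨ N % 4 = 3) : hw (4 * N) = (2 - chi N) * hw N := by
  by_cases h3 : N = 3
  · subst h3; simp [hw, chi, wAut, cn3, cn12]; norm_num
  by_cases h4 : N = 4
  · subst h4; simp [hw, chi, wAut, cn4, cn16]; norm_num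
  have hD : (4 : ℤ) < N := by omega
  have w1 : wAut (-(N : ℤ)) = 2 := by unfold wAut; rw [if_neg (by omega), if_neg (by omega)]
  have w2 : wAut (-((4 * N : ℕ) : ℤ)) = 2 := by unfold wAut; rw [if_neg (by omega), if_neg (by omega)]
  have c4 := card_four (D := (N : ℤ)) (by omega) (by omega)
  unfold hw
  rw [w1, w2]
  push_cast
  rw [← c4]
  rcases (by omega : N % 4 = 0 ∨ N % 8 = 7 ∨ N % 8 = 3) with h | h | h
  · rw [nq_card_of hD 2 (alw0 (by omega))]
    rw [chi, if_pos h]; push_cast; ring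
  · rw [nq_card_of hD 1 (alw7 (by omega))]
    rw [chi, if_neg (by omega), if_pos h]; push_cast; ring
  · rw [nq_card_of hD 3 (alw3 (by omega))]
    rw [chi, if_neg (by omega), if_neg (by omega)]; push_cast; ring

lemma hw_zero {N : ℕ} (h : N % 4 = 1 ∨ N % 4 = 2) : hw N = 0 := by
  have : IsEmpty (XF (N : ℤ)) := by
    constructor
    rintro ⟨⟨a, b, c⟩, h1, h2, h3⟩
    simp only at h1
    have := sq_mod8 b
    have : b ^ 2 - 4 * (a * c) = -N := by linarith
    omega
  have h0 : classNum (-(N : ℤ)) = 0 := by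
    unfold classNum
    have : IsEmpty (ClF (N : ℤ)) := by
      constructor; rintro ⟨f⟩; exact this.false f
    exact Nat.card_of_isEmpty
  simp [hw, h0]

lemma sum_sq (N : ℕ) (hN : 0 < N) : hurwitzNat N = ∑ f ∈ N.divisors.filter (fun f => f ^ 2 ∣ N), hw (N / f ^ 2) := by
  unfold hurwitzNat
  split_ifs with h
  · rfl
  · symm
    apply Finset.sum_eq_zero
    intro f hf
    rw [Finset.mem_filter, Nat.mem_divisors] at hf
    apply hw_zero
    have hmod : N % 4 = 1 ∨ N % 4 = 2 := by omega
    obtain ⟨k, hk⟩ := hf.2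
    have hf0 : 0 < f := Nat.pos_of_ne_zero (by rintro rfl; simp at hk; omega)
    have : N / f ^ 2 = k := by rw [hk]; exact Nat.mul_div_cancel_left _ (by positivity)
    rw [this]
    rcases Nat.even_or_odd' f with ⟨m, rfl | rfl⟩
    · exfalso
      have : N = 4 * (m ^ 2 * k) := by rw [hk]; ring
      omega
    · have : N = 4 * ((m ^ 2 + m) * k) + k := by rw [hk]; ring
      omega

/-- odd part sum -/
noncomputable def SO (N : ℕ) : ℚ := ∑ f ∈ N.divisors.filter (fun f => f ^ 2 ∣ N ∧ ¬ 2 ∣ f), hw (N / f ^ 2)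

lemma H_split_four (N : ℕ) (hN : 0 < N) : hurwitzNat (4 * N) = SO (4 * N) + hurwitzNat N := by
  rw [sum_sq _ (by omega), sum_sq _ hN, ← Finset.sum_filter_not_add_sum_filter _ (fun f => 2 ∣ f)]
  congr 1
  · rw [Finset.filter_filter]; rfl
  · symm
    rw [Finset.filter_filter]
    refine Finset.sum_bij (fun f _ => 2 * f) ?_ ?_ ?_ ?_
    · intro f hf
      rw [Finset.mem_filter, Nat.mem_divisors] at hf ⊢
      refine ⟨⟨?_, by omega⟩, ?_, by omega⟩
      · exact mul_dvd_mul (by norm_num) hf.1.1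
      · rw [mul_pow]; exact mul_dvd_mul (by norm_num) hf.2
    · intro a _ b _ h; omega
    · intro b hb
      rw [Finset.mem_filter, Nat.mem_divisors] at hb
      obtain ⟨hb1, hb2, k, rfl⟩ := hb
      have : k ^ 2 ∣ N := by
        rw [mul_pow] at hb2
        exact Nat.dvd_of_mul_dvd_mul_left (by norm_num) hb2
      refine ⟨k, ?_, rfl⟩
      rw [Finset.mem_filter, Nat.mem_divisors]
      exact ⟨⟨(Dvd.intro_left _ (by ring : k * k = k ^ 2)).trans this, by omega⟩, this⟩
    · intro f hf
      rw [mul_pow, show (2 : ℕ) ^ 2 = 4 by norm_num, Nat.mul_div_mul_left _ _ (by norm_num : 0 < 4)]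

lemma H_odd (N : ℕ) (hN : 0 < N) (h4 : ¬ 4 ∣ N) : hurwitzNat N = SO N := by
  rw [sum_sq _ hN]
  unfold SO
  congr 1
  ext f
  simp only [Finset.mem_filter, and_congr_right_iff]
  intro _
  constructor
  · intro h
    refine ⟨h, ?_⟩
    rintro ⟨k, rfl⟩
    apply h4
    rw [mul_pow] at h
    exact (Dvd.intro _ rfl).trans h
  · exact fun h => h.1

lemma SO_four (N : ℕ) (hN : 0 < N) (hmod : N % 4 = 0 ∨ N % 4 = 3) : SO (4 * N) = (2 - chi N) * SO N := by
  unfold SO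
  rw [Finset.mul_sum]
  have hset : (4 * N).divisors.filter (fun f => f ^ 2 ∣ 4 * N ∧ ¬ 2 ∣ f) = N.divisors.filter (fun f => f ^ 2 ∣ N ∧ ¬ 2 ∣ f) := by
    ext f
    simp only [Finset.mem_filter, Nat.mem_divisors]
    constructor
    · rintro ⟨⟨h1, h2⟩, h3, h4⟩
      have hc : Nat.Coprime (f ^ 2) 4 := by
        have : Nat.Coprime f 2 := (Nat.coprime_comm.mp ((Nat.Prime.coprime_iff_not_dvd Nat.prime_two).mpr h4))
        exact (this.pow 2 2)
      have h5 := hc.dvd_of_dvd_mul_left h3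
      exact ⟨⟨(Dvd.intro_left _ (by ring : f * f = f ^ 2)).trans h5, by omega⟩, h5, h4⟩
    · rintro ⟨⟨h1, h2⟩, h3, h4⟩
      exact ⟨⟨h1.mul_left _, by omega⟩, h3.mul_left _, h4⟩
  rw [hset]
  refine Finset.sum_congr rfl fun f hf => ?_
  rw [Finset.mem_filter, Nat.mem_divisors] at hf
  obtain ⟨-, ⟨k, hk⟩, hodd⟩ := hf
  have hf0 : 0 < f := Nat.pos_of_ne_zero (by rintro rfl; simp at hk; omega)
  have e1 : N / f ^ 2 = k := by rw [hk]; exact Nat.mul_div_cancel_left _ (by positivity)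
  have e2 : 4 * N / f ^ 2 = 4 * k := by
    rw [hk, show 4 * (f ^ 2 * k) = f ^ 2 * (4 * k) by ring]; exact Nat.mul_div_cancel_left _ (by positivity)
  obtain ⟨m, hm⟩ : ∃ m, f = 2 * m + 1 := ⟨f / 2, by omega⟩
  have hN8 : N % 8 = k % 8 := by
    obtain ⟨l, hl⟩ := Nat.even_mul_succ_self m
    have : N = 8 * (l * k) + k := by
      have : f ^ 2 = 8 * l + 1 := by rw [hm]; have : m * (m + 1) = l + l := hl; nlinarith
      rw [hk, this]; ring
    omega
  have hk0 : 0 < k := Nat.pos_of_ne_zero (by rintro rfl; simp at hk; omega)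
  rw [e1, e2, hw_four hk0 (by omega)]
  congr 2
  unfold chi
  have a1 : N % 4 = 0 ↔ k % 4 = 0 := by omega
  simp only [a1, hN8]

lemma H_rec0 (N : ℕ) (hN : 0 < N) : hurwitzNat (16 * N) = 3 * hurwitzNat (4 * N) - 2 * hurwitzNat N := by
  have h1 := H_split_four (4 * N) (by omega)
  have h2 := H_split_four N hN
  have h3 := SO_four (4 * N) (by omega) (by omega)
  rw [chi, if_pos (by omega)] at h3
  rw [show 4 * (4 * N) = 16 * N by ring] at h1 h3
  linarith

lemma H_rec3 (N : ℕ) (h : N % 8 = 3) : hurwitzNat (4 * N) = 4 * hurwitzNat N := by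
  have h1 := H_split_four N (by omega)
  have h2 := H_odd N (by omega) (by omega)
  have h3 := SO_four N (by omega) (by omega)
  rw [chi, if_neg (by omega), if_neg (by omega)] at h3
  linarith

lemma H_rec7 (N : ℕ) (h : N % 8 = 7) : hurwitzNat (4 * N) = 2 * hurwitzNat N := by
  have h1 := H_split_four N (by omega)
  have h2 := H_odd N (by omega) (by omega)
  have h3 := SO_four N (by omega) (by omega)
  rw [chi, if_neg (by omega), if_pos (by omega)] at h3
  linarith

lemma H_zero (N : ℕ) (h : N % 4 = 1 ∨ N % 4 = 2) : hurwitzNat N = 0 := by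
  unfold hurwitzNat
  rw [if_neg (by omega)]

lemma H_nonneg (N : ℕ) : 0 ≤ hurwitzNat N := by
  unfold hurwitzNat
  split_ifs
  · apply Finset.sum_nonneg; intro f _; positivity
  · exact le_rfl


def uPart (p : ℕ) (a : ℤ) : ℤ := a / (p : ℤ) ^ padicValInt p a

lemma uPart_spec (p : ℕ) (a : ℤ) : a = (p : ℤ) ^ padicValInt p a * uPart p a := by
  unfold uPart
  exact (Int.mul_ediv_cancel' (padicValInt_dvd a)).symm

lemma uPart_not_dvd {p : ℕ} (hp : p.Prime) {a : ℤ} (ha : a ≠ 0) : ¬ (p : ℤ) ∣ uPart p a := by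
  haveI := Fact.mk hp
  rintro ⟨c, hc⟩
  have h := uPart_spec p a
  have : (p : ℤ) ^ (padicValInt p a + 1) ∣ a := ⟨c, by rw [hc] at h; rw [pow_succ, mul_assoc]; exact h⟩
  rw [padicValInt_dvd_iff] at this
  rcases this with h | h
  · exact ha h
  · omega

lemma uPart_mul {p : ℕ} (hp : p.Prime) {a b : ℤ} (ha : a ≠ 0) (hb : b ≠ 0) :
    uPart p (a * b) = uPart p a * uPart p b := by
  haveI := Fact.mk hp
  have h1 := uPart_spec p a
  have h2 := uPart_spec p b
  have h3 := uPart_spec p (a * b)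
  rw [padicValInt.mul ha hb] at h3
  have : ((p : ℤ) ^ (padicValInt p a + padicValInt p b)) ≠ 0 := pow_ne_zero _ (by exact_mod_cast hp.ne_zero)
  apply mul_left_cancel₀ this
  rw [← h3]
  conv_lhs => rw [h1, h2]
  ring

lemma uPart_of_not_dvd {p : ℕ} {a : ℤ} (h : ¬ (p : ℤ) ∣ a) : uPart p a = a := by
  unfold uPart
  rw [padicValInt.eq_zero_of_not_dvd h]; simp

lemma uPart_self {p : ℕ} (hp : p.Prime) : uPart p p = 1 := by
  haveI := Fact.mk hp
  unfold uPart
  rw [padicValInt_self, pow_one, Int.ediv_self]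
  exact_mod_cast hp.ne_zero

noncomputable def ee (p : ℕ) (u v : ℤ) : ℤ := if p = 2 ∧ u % 4 = 3 ∧ v % 4 = 3 then -1 else 1
noncomputable def ww (p : ℕ) (u : ℤ) : ℤ := if p = 2 then ZMod.χ₈ u else jacobiSym u p

lemma ee_mul {p : ℕ} {u u' v : ℤ} (h : ¬ (p : ℤ) ∣ u) (h' : ¬ (p : ℤ) ∣ u') :
    ee p (u * u') v = ee p u v * ee p u' v := by
  unfold ee
  by_cases hp : p = 2
  · subst hp
    have e1 : u % 4 = 1 ∨ u % 4 = 3 := by push_cast at h; omega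
    have e2 : u' % 4 = 1 ∨ u' % 4 = 3 := by push_cast at h'; omega
    have hm := Int.mul_emod u u' 4
    rcases e1 with e1 | e1 <;> rcases e2 with e2 | e2 <;> rw [e1, e2] at hm <;>
      norm_num at hm <;> by_cases hv : v % 4 = 3 <;> simp [e1, e2, hm, hv]
  · simp [hp]

lemma ee_symm (p : ℕ) (u v : ℤ) : ee p u v = ee p v u := by
  unfold ee; simp only [and_comm, and_assoc]

lemma ee_neg (p : ℕ) (u : ℤ) : ee p u (-u) = 1 := by
  unfold ee; rw [if_neg]; omega

lemma ee_sq (p : ℕ) (u v : ℤ) : ee p u v = 1 ∨ ee p u v = -1 := by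
  unfold ee; split_ifs <;> simp

lemma ww_mul (p : ℕ) (u v : ℤ) : ww p (u * v) = ww p u * ww p v := by
  unfold ww; split_ifs
  · push_cast; exact map_mul _ _ _
  · exact jacobiSym.mul_left _ _ _

lemma gcd_of_not_dvd {p : ℕ} (hp : p.Prime) {u : ℤ} (h : ¬ (p : ℤ) ∣ u) : u.gcd p = 1 := by
  rw [Int.gcd_comm]
  exact Int.isCoprime_iff_gcd_eq_one.mp
    ((Nat.prime_iff_prime_int.mp hp).coprime_iff_not_dvd.mpr h)

lemma ww_pm {p : ℕ} (hp : p.Prime) {u : ℤ} (h : ¬ (p : ℤ) ∣ u) : ww p u = 1 ∨ ww p u = -1 := by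
  unfold ww; split_ifs with h2
  · subst h2
    rw [ZMod.χ₈_int_eq_if_mod_eight]
    push_cast at h
    split_ifs <;> omega
  · exact jacobiSym.eq_one_or_neg_one (gcd_of_not_dvd hp h)

lemma ww_one (p : ℕ) : ww p 1 = 1 := by
  unfold ww; split_ifs <;> simp

noncomputable def hil (p : ℕ) (a b : ℤ) : ℤ :=
  ww p (-1) ^ (padicValInt p a * padicValInt p b) * ee p (uPart p a) (uPart p b) *
    ww p (uPart p a) ^ padicValInt p b * ww p (uPart p b) ^ padicValInt p a

lemma hil_symm (p : ℕ) (a b : ℤ) : hil p a b = hil p b a := by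
  unfold hil; rw [ee_symm p (uPart p a)]; ring

lemma hil_mul_left {p : ℕ} (hp : p.Prime) {a a' : ℤ} (b : ℤ) (ha : a ≠ 0) (ha' : a' ≠ 0) :
    hil p (a * a') b = hil p a b * hil p a' b := by
  haveI := Fact.mk hp
  unfold hil
  rw [padicValInt.mul ha ha', uPart_mul hp ha ha', ww_mul,
    ee_mul (uPart_not_dvd hp ha) (uPart_not_dvd hp ha')]
  ring

lemma hil_mul_right {p : ℕ} (hp : p.Prime) {a a' : ℤ} (b : ℤ) (ha : a ≠ 0) (ha' : a' ≠ 0) :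
    hil p b (a * a') = hil p b a * hil p b a' := by
  rw [hil_symm, hil_mul_left hp b ha ha', hil_symm p a, hil_symm p a']

lemma pm_mul {x y : ℤ} (hx : x = 1 ∨ x = -1) (hy : y = 1 ∨ y = -1) : x * y = 1 ∨ x * y = -1 := by
  rcases hx with rfl | rfl <;> rcases hy with rfl | rfl <;> simp

lemma pm_pow {x : ℤ} (hx : x = 1 ∨ x = -1) (n : ℕ) : x ^ n = 1 ∨ x ^ n = -1 := by
  rcases hx with rfl | rfl
  · simp
  · exact neg_one_pow_eq_or ℤ n

lemma pm_sq {x : ℤ} (hx : x = 1 ∨ x = -1) : x * x = 1 := by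
  rcases hx with rfl | rfl <;> simp

lemma not_dvd_neg_one {p : ℕ} (hp : p.Prime) : ¬ (p : ℤ) ∣ -1 := by
  intro h
  have : (p : ℤ) ∣ 1 := by simpa using h
  have := Int.le_of_dvd one_pos this
  have := hp.two_le
  omega

lemma hil_pm {p : ℕ} (hp : p.Prime) {a b : ℤ} (ha : a ≠ 0) (hb : b ≠ 0) :
    hil p a b = 1 ∨ hil p a b = -1 := by
  unfold hil
  exact pm_mul (pm_mul (pm_mul (pm_pow (ww_pm hp (not_dvd_neg_one hp)) _) (ee_sq _ _ _))
    (pm_pow (ww_pm hp (uPart_not_dvd hp ha)) _)) (pm_pow (ww_pm hp (uPart_not_dvd hp hb)) _)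

lemma val_neg (p : ℕ) (a : ℤ) : padicValInt p (-a) = padicValInt p a := by
  simp [padicValInt]

lemma uPart_neg {p : ℕ} (hp : p.Prime) {a : ℤ} (ha : a ≠ 0) : uPart p (-a) = - uPart p a := by
  have := uPart_mul hp (a := -1) (b := a) (by norm_num) ha
  rw [uPart_of_not_dvd (not_dvd_neg_one hp)] at this
  simpa using this

lemma hil_neg_self {p : ℕ} (hp : p.Prime) {a : ℤ} (ha : a ≠ 0) : hil p a (-a) = 1 := by
  unfold hil
  rw [val_neg, uPart_neg hp ha, ee_neg]
  have h1 : ww p (-uPart p a) = ww p (-1) * ww p (uPart p a) := by rw [← ww_mul]; simp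
  rw [h1]
  have h2 := pm_sq (ww_pm hp (not_dvd_neg_one hp))
  have h3 := pm_sq (ww_pm hp (uPart_not_dvd hp ha))
  set v := padicValInt p a
  set w := ww p (uPart p a)
  set e := ww p (-1)
  have h4 : e ^ (v * v) * e ^ v = 1 := by
    rw [← pow_add]
    have : Even (v * v + v) := by
      have := Nat.even_mul_succ_self v
      have h : v * v + v = v * (v+1) := by ring
      rwa [h]
    obtain ⟨k, hk⟩ := this
    rw [hk, pow_add, ← mul_pow, h2, one_pow]
  have h5 : w ^ v * w ^ v = 1 := by rw [← mul_pow, h3, one_pow]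
  calc _ = (e ^ (v * v) * e ^ v) * (w ^ v * w ^ v) := by rw [mul_pow]; ring
    _ = 1 := by rw [h4, h5]; norm_num

lemma hil_self {p : ℕ} (hp : p.Prime) {a : ℤ} (ha : a ≠ 0) : hil p a a = hil p a (-1) := by
  have h := hil_neg_self hp ha
  have h2 := hil_mul_right hp a (a := -1) (a' := a) (by norm_num) ha
  rw [neg_one_mul, h] at h2
  rcases hil_pm hp ha ha with h3 | h3 <;> rcases hil_pm hp ha (b := -1) (by norm_num) with h4 | h4 <;>
    rw [h3, h4] at h2 ⊢ <;> norm_num at h2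

lemma hil_sq_right {p : ℕ} (hp : p.Prime) {a b c : ℤ} (ha : a ≠ 0) (hb : b ≠ 0) (hc : c ≠ 0) :
    hil p a (b * (c * c)) = hil p a b := by
  rw [hil_mul_right hp _ hb (mul_ne_zero hc hc), hil_mul_right hp _ hc hc, pm_sq (hil_pm hp ha hc), mul_one]

lemma hil_unit {p : ℕ} (hp : p.Prime) (h2 : p ≠ 2) {a b : ℤ} (ha : ¬ (p : ℤ) ∣ a) (hb : ¬ (p : ℤ) ∣ b) :
    hil p a b = 1 := by
  unfold hil
  rw [padicValInt.eq_zero_of_not_dvd ha, padicValInt.eq_zero_of_not_dvd hb]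
  simp [ee, h2]

lemma hil_prime_left {p : ℕ} (hp : p.Prime) (h2 : p ≠ 2) {b : ℤ} (hb : ¬ (p : ℤ) ∣ b) :
    hil p p b = jacobiSym b p := by
  haveI := Fact.mk hp
  unfold hil
  rw [padicValInt.eq_zero_of_not_dvd hb, padicValInt_self, uPart_of_not_dvd hb]
  simp [ee, ww, h2]

lemma hil_two_unit {u v : ℤ} (hu : ¬ (2:ℤ) ∣ u) (hv : ¬ (2 : ℤ) ∣ v) :
    hil 2 u v = ee 2 u v := by
  have hu' : ¬ ((2:ℕ):ℤ) ∣ u := by simpa using hu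
  have hv' : ¬ ((2:ℕ):ℤ) ∣ v := by simpa using hv
  unfold hil
  rw [padicValInt.eq_zero_of_not_dvd hu', padicValInt.eq_zero_of_not_dvd hv', uPart_of_not_dvd hu', uPart_of_not_dvd hv']
  simp

lemma hil_two_two {v : ℤ} (hv : ¬ (2 : ℤ) ∣ v) :
    hil 2 2 v = ZMod.χ₈ v := by
  haveI := Fact.mk Nat.prime_two
  have hv' : ¬ ((2:ℕ):ℤ) ∣ v := by simpa using hv
  unfold hil
  have h1 : padicValInt 2 2 = 1 := by exact_mod_cast padicValInt_self (p := 2)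
  have h2 : uPart 2 2 = 1 := by exact_mod_cast uPart_self Nat.prime_two
  rw [padicValInt.eq_zero_of_not_dvd hv', h1, h2, uPart_of_not_dvd hv']
  simp [ee, ww]

/-- generator principle -/
lemma gen_principle (T : Finset ℕ) (f : ℤ → ℤ) (hm : ∀ x y : ℤ, x ≠ 0 → y ≠ 0 → f (x * y) = f x * f y)
    (h1 : f 1 = 1) (hn : f (-1) = 1) (hq : ∀ q ∈ T, q.Prime → f q = 1) (a : ℤ) (ha : a ≠ 0)
    (hT : ∀ q : ℕ, q.Prime → (q : ℤ) ∣ a → q ∈ T) : f a = 1 := by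
  have key : ∀ m : ℕ, m ≠ 0 → (∀ q : ℕ, q.Prime → q ∣ m → q ∈ T) → f m = 1 := by
    intro m
    induction m using induction_on_primes with
    | zero => intro h; exact absurd rfl h
    | one => intro _ _; simpa using h1
    | prime_mul q m hq' ih =>
      intro hm0 hT
      have hm1 : m ≠ 0 := right_ne_zero_of_mul hm0
      push_cast
      rw [hm _ _ (by exact_mod_cast hq'.ne_zero) (by exact_mod_cast hm1),
        hq q (hT q hq' (dvd_mul_right _ _)) hq', ih hm1 (fun r hr hd => hT r hr (dvd_mul_of_dvd_right hd _)), one_mul]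
  have k2 := key a.natAbs (by simpa using ha) (fun q hq' hd => hT q hq' (Int.natCast_dvd.mpr hd))
  rcases Int.natAbs_eq a with h | h
  · rw [h]; exact k2
  · rw [h, ← neg_one_mul, hm _ _ (by norm_num) (by simpa using ha), hn, k2, one_mul]

noncomputable def sgnInf (a b : ℤ) : ℤ := if a < 0 ∧ b < 0 then -1 else 1

lemma sgnInf_symm (a b : ℤ) : sgnInf a b = sgnInf b a := by unfold sgnInf; simp only [and_comm]

lemma sgnInf_mul {a a' : ℤ} (b : ℤ) (ha : a ≠ 0) (ha' : a' ≠ 0) : sgnInf (a * a') b = sgnInf a b * sgnInf a' b := by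
  unfold sgnInf
  by_cases hb : b < 0
  · simp only [hb, and_true]
    rcases lt_or_gt_of_ne ha with h | h <;> rcases lt_or_gt_of_ne ha' with h' | h'
    · simp [h, h', (mul_pos_of_neg_of_neg h h').le]
    · simp [h, h'.le, mul_neg_of_neg_of_pos h h']
    · simp [h.le, h', mul_neg_of_pos_of_neg h h']
    · rw [if_neg (mul_pos h h').le.not_gt, if_neg h.le.not_gt, if_neg h'.le.not_gt]; rfl
  · simp [hb]

noncomputable def FF (T : Finset ℕ) (a b : ℤ) : ℤ := (∏ p ∈ T, hil p a b) * sgnInf a b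

lemma FF_symm (T : Finset ℕ) (a b : ℤ) : FF T a b = FF T b a := by
  unfold FF; rw [sgnInf_symm]; congr 1; exact Finset.prod_congr rfl (fun p _ => hil_symm _ _ _)

lemma FF_mul {T : Finset ℕ} (hT : ∀ p ∈ T, p.Prime) {a a' : ℤ} (b : ℤ) (ha : a ≠ 0) (ha' : a' ≠ 0) :
    FF T (a * a') b = FF T a b * FF T a' b := by
  unfold FF
  rw [sgnInf_mul b ha ha', Finset.prod_congr rfl (fun p hp => hil_mul_left (hT p hp) b ha ha'),
    Finset.prod_mul_distrib]
  ring

lemma hil_one_right {p : ℕ} (hp : p.Prime) {a : ℤ} (ha : a ≠ 0) : hil p a 1 = 1 := by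
  have := hil_mul_right hp a (a := 1) (a' := 1) (by norm_num) (by norm_num)
  rw [mul_one] at this
  rcases hil_pm hp ha (b := 1) (by norm_num) with h | h
  · exact h
  · rw [h] at this; norm_num at this

lemma prime_not_dvd {p q : ℕ} (hp : p.Prime) (hq : q.Prime) (h : p ≠ q) : ¬ (p : ℤ) ∣ (q : ℤ) := by
  intro hd
  exact h ((Nat.prime_dvd_prime_iff_eq hp hq).mp (by exact_mod_cast hd))

lemma FF_nn {T : Finset ℕ} (hT : ∀ p ∈ T, p.Prime) (h2 : 2 ∈ T) : FF T (-1) (-1) = 1 := by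
  unfold FF
  rw [Finset.prod_eq_single 2]
  · rw [hil_two_unit (by norm_num) (by norm_num)]; simp [ee, sgnInf]
  · intro p hp hp2
    exact hil_unit (hT p hp) hp2 (not_dvd_neg_one (hT p hp)) (not_dvd_neg_one (hT p hp))
  · intro h; exact absurd h2 h

lemma FF_nq {T : Finset ℕ} (hT : ∀ p ∈ T, p.Prime) (h2 : 2 ∈ T) {q : ℕ} (hq : q ∈ T) : FF T q (-1) = 1 := by
  have hs : sgnInf q (-1) = 1 := by unfold sgnInf; rw [if_neg]; omega
  unfold FF
  rw [hs, mul_one]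
  by_cases hq2 : q = 2
  · subst hq2
    rw [Finset.prod_eq_single 2]
    · push_cast; rw [hil_two_two (by norm_num)]; rfl
    · intro p hp hp2
      exact hil_unit (hT p hp) hp2 (prime_not_dvd (hT p hp) Nat.prime_two hp2) (not_dvd_neg_one (hT p hp))
    · intro h; exact absurd h2 h
  · have hqp := hT q hq
    have hodd : Odd q := hqp.odd_of_ne_two hq2
    rw [Finset.prod_eq_mul 2 q (fun h => hq2 h.symm)]
    · rw [hil_prime_left hqp hq2 (not_dvd_neg_one hqp), hil_two_unit
        (by have := prime_not_dvd Nat.prime_two hqp (fun h => hq2 h.symm); simpa using this) (by norm_num),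
        jacobiSym.at_neg_one hodd, ZMod.χ₄_nat_eq_if_mod_four]
      unfold ee
      obtain ⟨k, hk⟩ := hodd
      have : q % 4 = 1 ∨ q % 4 = 3 := by omega
      rcases this with h | h
      · have h' : (q : ℤ) % 4 = 1 := by omega
        have : q % 2 = 1 := by omega
        simp [h, h', this]
      · have h' : (q : ℤ) % 4 = 3 := by omega
        have : q % 2 = 1 := by omega
        simp [h, h', this]
    · intro p hp ⟨hp2, hpq⟩
      exact hil_unit (hT p hp) hp2 (prime_not_dvd (hT p hp) hqp hpq) (not_dvd_neg_one (hT p hp))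
    · intro h; exact absurd h2 h
    · intro h; exact absurd hq h

lemma FF_2q {T : Finset ℕ} (hT : ∀ p ∈ T, p.Prime) (h2 : 2 ∈ T) {q : ℕ} (hq : q ∈ T) (hq2 : q ≠ 2) :
    FF T q 2 = 1 := by
  have hs : sgnInf q 2 = 1 := by unfold sgnInf; rw [if_neg]; omega
  unfold FF
  rw [hs, mul_one]
  have hqp := hT q hq
  have hodd : Odd q := hqp.odd_of_ne_two hq2
  have hq2' : ¬ (q : ℤ) ∣ 2 := by simpa using prime_not_dvd hqp Nat.prime_two hq2
  rw [Finset.prod_eq_mul 2 q (fun h => hq2 h.symm)]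
  · rw [hil_prime_left hqp hq2 hq2', hil_symm, hil_two_two
        (by have := prime_not_dvd Nat.prime_two hqp (fun h => hq2 h.symm); simpa using this),
        jacobiSym.at_two hodd]
    push_cast
    apply pm_sq
    have := ww_pm Nat.prime_two (u := q) (prime_not_dvd Nat.prime_two hqp (fun h => hq2 h.symm))
    simpa [ww] using this
  · intro p hp ⟨hp2, hpq⟩
    exact hil_unit (hT p hp) hp2 (prime_not_dvd (hT p hp) hqp hpq)
      (by simpa using prime_not_dvd (hT p hp) Nat.prime_two hp2)
  · intro h; exact absurd h2 h
  · intro h; exact absurd hq h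

lemma FF_qr {T : Finset ℕ} (hT : ∀ p ∈ T, p.Prime) (h2 : 2 ∈ T) {q r : ℕ} (hq : q ∈ T) (hq2 : q ≠ 2)
    (hr : r ∈ T) (hr2 : r ≠ 2) (hqr : q ≠ r) : FF T q r = 1 := by
  have hs : sgnInf q r = 1 := by unfold sgnInf; rw [if_neg]; omega
  unfold FF
  rw [hs, mul_one]
  have hqp := hT q hq
  have hrp := hT r hr
  have hodd : Odd q := hqp.odd_of_ne_two hq2
  have hrodd : Odd r := hrp.odd_of_ne_two hr2
  have hsub : ({2, q, r} : Finset ℕ) ⊆ T := by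
    intro x hx; simp at hx; rcases hx with rfl | rfl | rfl <;> assumption
  rw [← Finset.prod_subset hsub]
  · rw [Finset.prod_insert (by simp [Ne.symm hq2, Ne.symm hr2]), Finset.prod_pair hqr]
    rw [hil_prime_left hqp hq2 (prime_not_dvd hqp hrp hqr), hil_symm r, hil_prime_left hrp hr2 (prime_not_dvd hrp hqp hqr.symm),
      hil_two_unit (by simpa using prime_not_dvd Nat.prime_two hqp (fun h => hq2 h.symm))
       (by simpa using prime_not_dvd Nat.prime_two hrp (fun h => hr2 h.symm))]
    have hpm := jacobiSym.eq_one_or_neg_one (gcd_of_not_dvd hqp (prime_not_dvd hqp hrp hqr))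
    have hrec := jacobiSym.quadratic_reciprocity_if (a := q) (b := r) (by obtain ⟨k, hk⟩ := hodd; omega)
      (by obtain ⟨k, hk⟩ := hrodd; omega)
    rw [← hrec]
    unfold ee
    have c1 : (q : ℤ) % 4 = 3 ↔ q % 4 = 3 := by omega
    have c2 : (r : ℤ) % 4 = 3 ↔ r % 4 = 3 := by omega
    simp only [c1, c2, true_and]
    have := pm_sq hpm
    split_ifs <;> linarith
  · intro p hp hp'
    simp only [Finset.mem_insert, Finset.mem_singleton, not_or] at hp'
    exact hil_unit (hT p hp) hp'.1 (prime_not_dvd (hT p hp) hqp hp'.2.1) (prime_not_dvd (hT p hp) hrp hp'.2.2)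

theorem product_formula {T : Finset ℕ} (hT : ∀ p ∈ T, p.Prime) (h2 : 2 ∈ T) {a b : ℤ} (ha : a ≠ 0) (hb : b ≠ 0)
    (hTa : ∀ q : ℕ, q.Prime → (q : ℤ) ∣ a → q ∈ T) (hTb : ∀ q : ℕ, q.Prime → (q : ℤ) ∣ b → q ∈ T) :
    (∏ p ∈ T, hil p a b) * sgnInf a b = 1 := by
  have one_l : ∀ b : ℤ, b ≠ 0 → FF T 1 b = 1 := by
    intro b hb
    unfold FF
    have hs : sgnInf 1 b = 1 := by unfold sgnInf; rw [if_neg]; omega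
    rw [hs, mul_one]
    apply Finset.prod_eq_one
    intro p hp; rw [hil_symm]; exact hil_one_right (hT p hp) hb
  have qs : ∀ q ∈ T, ∀ r ∈ T, FF T q r = 1 := by
    intro q hq r hr
    by_cases hqr : q = r
    · subst hqr
      have : FF T q q = FF T q (-1) := by
        unfold FF
        have h0 : (q : ℤ) ≠ 0 := by exact_mod_cast (hT q hq).ne_zero
        rw [Finset.prod_congr rfl (fun p hp => hil_self (hT p hp) h0)]
        congr 1
      rw [this, FF_nq hT h2 hq]
    · by_cases hq2 : q = 2
      · subst hq2
        rw [FF_symm]; exact_mod_cast FF_2q hT h2 hr (fun h => hqr h.symm)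
      · by_cases hr2 : r = 2
        · subst hr2; exact_mod_cast FF_2q hT h2 hq hq2
        · exact FF_qr hT h2 hq hq2 hr hr2 hqr
  have step : ∀ c : ℤ, c ≠ 0 → (FF T (-1) c = 1) → (∀ q ∈ T, FF T q c = 1) → FF T a c = 1 := by
    intro c hc h1 h3
    exact gen_principle T (fun x => FF T x c) (fun x y hx hy => FF_mul hT c hx hy) (one_l c hc) h1
      (fun q hq _ => h3 q hq) a ha hTa
  have fin : FF T a b = 1 := by
    refine gen_principle T (fun x => FF T a x) (fun x y hx hy => ?_) ?_ ?_ ?_ b hb hTb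
    · simp only [FF_symm T a]; exact FF_mul hT a hx hy
    · show FF T a 1 = 1
      rw [FF_symm]; exact one_l a ha
    · exact step (-1) (by norm_num) (FF_nn hT h2) (fun q hq => FF_nq hT h2 hq)
    · intro q hq _
      refine step q (by exact_mod_cast (hT q hq).ne_zero) ?_ (fun r hr => qs r hr q hq)
      rw [FF_symm]; exact FF_nq hT h2 hq
  exact fin


section
variable {p : ℕ} [hpf : Fact p.Prime]

lemma normal_form_p {M : Matrix (Fin 3) (Fin 3) ℤ_[p]} (hs : M.IsSymm) {β : ℤ_[p]} (h00 : M 0 0 = 0)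
    (h11 : M 1 1 = 2 * β) (h01 : IsUnit (M 0 1)) :
    PadicIsomP p M !![0, 1, 0; 1, 0, 0; 0, 0, -M.det] := by
  have s1 := hs.apply 0 1
  have s2 := hs.apply 0 2
  have s3 := hs.apply 1 2
  obtain ⟨h, hh⟩ := h01.exists_right_inv
  obtain ⟨g, hgd⟩ : ∃ g, g = M 0 1 := ⟨_, rfl⟩
  rw [← hgd] at hh
  let U1 : Matrix (Fin 3) (Fin 3) ℤ_[p] := !![1, -h^2*β, 0; 0, h, 0; 0, 0, 1]
  have d1 : U1.det = h := by simp [U1, det_fin_three]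
  obtain ⟨r, hr⟩ : ∃ r, r = M 1 2 * h - h^2*β* M 0 2 := ⟨_, rfl⟩
  obtain ⟨q, hq⟩ : ∃ q, q = M 0 2 := ⟨_, rfl⟩
  have e1 : U1ᵀ * M * U1 = !![0, 1, q; 1, 0, r; q, r, M 2 2] := by
    ext i j
    simp only [Matrix.mul_apply, Fin.sum_univ_three, transpose_apply]
    fin_cases i <;> fin_cases j <;> simp [U1, s1, s2, s3, h00, h11, ← hgd, hq, hr] <;> 
      first | linear_combination hh | linear_combination - 2 * h ^ 2 * β * hh | ring
  let U2 : Matrix (Fin 3) (Fin 3) ℤ_[p] := !![1, 0, -r * g; 0, 1, -q * g; 0, 0, g]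
  have d2 : U2.det = g := by simp [U2, det_fin_three]
  have hdet : M.det * h ^ 2 = - M 2 2 + 2 * q * r := by
    have := congrArg Matrix.det e1
    rw [det_mul, det_mul, det_transpose, d1] at this
    rw [det_fin_three (!![0, 1, q; 1, 0, r; q, r, M 2 2])] at this
    simp at this
    linear_combination this
  have e2 : U2ᵀ * !![0, 1, q; 1, 0, r; q, r, M 2 2] * U2 = !![0, 1, 0; 1, 0, 0; 0, 0, -M.det] := by
    ext i j
    simp only [Matrix.mul_apply, Fin.sum_univ_three, transpose_apply]
    fin_cases i <;> fin_cases j <;> simp [U2] <;> try ring1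
    linear_combination (g^2) * hdet - M.det * (g * h + 1) * hh
  exact PadicIsomP.trans ⟨U1, by rw [d1]; exact IsUnit.of_mul_eq_one_right _ hh, e1⟩ ⟨U2, by rw [d2, hgd]; exact h01, e2⟩

lemma exists_basis (y : Fin 3 → ℤ_[p]) (i : Fin 3) (hi : IsUnit (y i)) :
    ∃ U : Matrix (Fin 3) (Fin 3) ℤ_[p], IsUnit U.det ∧ ∀ j, U j 0 = y j := by
  fin_cases i
  · exact ⟨!![y 0, 0, 0; y 1, 1, 0; y 2, 0, 1], by simpa [det_fin_three] using hi, by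
      intro j; fin_cases j <;> simp⟩
  · exact ⟨!![y 0, 1, 0; y 1, 0, 0; y 2, 0, 1], by simpa [det_fin_three] using hi, by
      intro j; fin_cases j <;> simp⟩
  · exact ⟨!![y 0, 0, 1; y 1, 1, 0; y 2, 0, 0], by simpa [det_fin_three] using hi, by
      intro j; fin_cases j <;> simp⟩

lemma comp_00 (M U : Matrix (Fin 3) (Fin 3) ℤ_[p]) (y : Fin 3 → ℤ_[p]) (h : ∀ j, U j 0 = y j) :
    (Uᵀ * M * U) 0 0 = quadVal M y := by
  simp only [Matrix.mul_apply, transpose_apply, quadVal, h, Finset.sum_mul]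
  rw [Finset.sum_comm]

lemma symm_comp_p {M U : Matrix (Fin 3) (Fin 3) ℤ_[p]} (h : M.IsSymm) : (Uᵀ * M * U).IsSymm := by
  unfold Matrix.IsSymm
  rw [transpose_mul, transpose_mul, transpose_transpose, h.eq, Matrix.mul_assoc]

lemma nonunit_iff {x : ℤ_[p]} : ¬ IsUnit x ↔ (p : ℤ_[p]) ∣ x := by
  rw [PadicInt.isUnit_iff, ← PadicInt.norm_lt_one_iff_dvd]
  have := PadicInt.norm_le_one x
  constructor
  · intro h; exact lt_of_le_of_ne this h
  · intro h; exact h.ne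

lemma two_unit (hp : p ≠ 2) : IsUnit (2 : ℤ_[p]) := by
  have := padic_unit_of (p := p) (x := 2) hp (by simp)
  simpa using this

lemma perm12 {M : Matrix (Fin 3) (Fin 3) ℤ_[p]} : ∃ N : Matrix (Fin 3) (Fin 3) ℤ_[p], PadicIsomP p M N ∧
    N.det = M.det ∧ N 0 0 = M 0 0 ∧ N 0 1 = M 0 2 := by
  let U : Matrix (Fin 3) (Fin 3) ℤ_[p] := !![1,0,0;0,0,1;0,1,0]
  have hd : U.det = -1 := by simp [U, det_fin_three]
  refine ⟨Uᵀ * M * U, ⟨U, by rw [hd]; simp, rfl⟩, ?_, ?_, ?_⟩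
  · rw [det_mul, det_mul, det_transpose, hd]; ring
  · simp [U, Matrix.mul_apply, Fin.sum_univ_three]
  · simp [U, Matrix.mul_apply, Fin.sum_univ_three]

lemma PadicIsomP.symmMat {M N : Matrix (Fin 3) (Fin 3) ℤ_[p]} (h : PadicIsomP p M N) (hs : M.IsSymm) : N.IsSymm := by
  obtain ⟨U, hU, rfl⟩ := h
  exact symm_comp_p hs

/-- Chevalley-Warning for quadratic forms -/
lemma exists_zero_mod {M : Matrix (Fin 3) (Fin 3) (ZMod p)} : ∃ x : Fin 3 → ZMod p, x ≠ 0 ∧ quadVal M x = 0 := by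
  let F : MvPolynomial (Fin 3) (ZMod p) := ∑ i, ∑ j, MvPolynomial.X i * MvPolynomial.C (M i j) * MvPolynomial.X j
  have hF : ∀ x, MvPolynomial.eval x F = quadVal M x := by
    intro x; simp [F, quadVal]
  have hdeg : F.totalDegree < Fintype.card (Fin 3) := by
    rw [Fintype.card_fin]
    have : F.totalDegree ≤ 2 := by
      refine (MvPolynomial.totalDegree_finsetSum_le fun i _ => MvPolynomial.totalDegree_finsetSum_le fun j _ => ?_)
      refine (MvPolynomial.totalDegree_mul _ _).trans ?_
      have h1 := MvPolynomial.totalDegree_mul (MvPolynomial.X i) (MvPolynomial.C (M i j))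
      rw [MvPolynomial.totalDegree_X, MvPolynomial.totalDegree_C] at h1
      rw [MvPolynomial.totalDegree_X]
      omega
    omega
  have hc := char_dvd_card_solutions p hdeg
  by_contra hno
  push Not at hno
  have : Fintype.card { x : Fin 3 → ZMod p // MvPolynomial.eval x F = 0 } = 1 := by
    rw [Fintype.card_eq_one_iff]
    refine ⟨⟨0, by rw [hF]; simp [quadVal]⟩, ?_⟩
    rintro ⟨x, hx⟩
    rw [hF] at hx
    by_contra h
    exact hno x (fun h0 => h (Subtype.ext h0)) hx
  rw [this] at hc
  exact hpf.out.one_lt.ne' (Nat.dvd_one.mp hc)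

lemma toZMod_zero_iff {x : ℤ_[p]} : PadicInt.toZMod x = 0 ↔ (p : ℤ_[p]) ∣ x := by
  rw [← RingHom.mem_ker, PadicInt.ker_toZMod, PadicInt.maximalIdeal_eq_span_p, Ideal.mem_span_singleton]

/-- odd unimodular forms are isotropic -/
lemma unimod_isotropic (hp : p ≠ 2) {M : Matrix (Fin 3) (Fin 3) ℤ_[p]} (hs : M.IsSymm) (hd : IsUnit M.det) :
    ∃ x : Fin 3 → ℤ_[p], ∃ i, IsUnit (x i) ∧ quadVal M x = 0 := by
  obtain ⟨x0, hx0, hq0⟩ := exists_zero_mod (M := M.map (PadicInt.toZMod (p := p)))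
  let x : Fin 3 → ℤ_[p] := fun i => (x0 i).val
  have hx : ∀ i, PadicInt.toZMod (x i) = x0 i := by intro i; simp [x]
  clear_value x
  have hq : ‖quadVal M x‖ < 1 := by
    rw [PadicInt.norm_lt_one_iff_dvd, ← toZMod_zero_iff]
    rw [← hq0]
    simp [quadVal, hx]
  -- M x has a unit coordinate
  have hu : ∃ i, IsUnit ((M *ᵥ x) i) := by
    by_contra hno
    push Not at hno
    have h1 : ∀ i, (p : ℤ_[p]) ∣ (M *ᵥ x) i := fun i => nonunit_iff.mp (hno i)
    apply hx0
    funext i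
    have h2 : x = M⁻¹ *ᵥ (M *ᵥ x) := by
      rw [Matrix.mulVec_mulVec, Matrix.nonsing_inv_mul _ hd, Matrix.one_mulVec]
    have h3 : (p : ℤ_[p]) ∣ x i := by
      rw [h2]
      simp only [Matrix.mulVec, dotProduct] at h1 ⊢
      exact Finset.dvd_sum fun j _ => dvd_mul_of_dvd_right (h1 j) _
    rw [← hx i]; exact toZMod_zero_iff.mpr h3
  obtain ⟨i, hi⟩ := hu
  obtain ⟨t, ht, htn⟩ := hensel_quad (quadVal M x) (2 * (M *ᵥ x) i) (M i i) ((two_unit hp).mul hi) hq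
  have hdt : (p : ℤ_[p]) ∣ t := PadicInt.norm_lt_one_iff_dvd _ |>.mp htn
  obtain ⟨j, hj⟩ : ∃ j, x0 j ≠ 0 := by
    by_contra h; push Not at h; exact hx0 (funext h)
  refine ⟨fun k => x k + t * (if k = i then 1 else 0), j, ?_, ?_⟩
  · by_contra hn
    rw [nonunit_iff] at hn
    have : (p : ℤ_[p]) ∣ x j := (dvd_add_left (dvd_mul_of_dvd_left hdt _)).mp hn
    rw [← toZMod_zero_iff, hx] at this
    exact hj this
  · refine Eq.trans ?_ ht
    have s1 := hs.apply 0 1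
    have s2 := hs.apply 0 2
    have s3 := hs.apply 1 2
    rw [quadVal_expand M hs, quadVal_expand M hs]
    simp only [Matrix.mulVec, dotProduct, Fin.sum_univ_three]
    have i3 : i = 0 ∨ i = 1 ∨ i = 2 := by fin_cases i <;> simp
    rcases i3 with rfl | rfl | rfl
    · simp only [if_true, show (1 : Fin 3) ≠ 0 by decide, show (2 : Fin 3) ≠ 0 by decide, if_false]; ring
    · simp only [if_true, show (0 : Fin 3) ≠ 1 by decide, show (2 : Fin 3) ≠ 1 by decide, if_false, s1]; ring
    · simp only [if_true, show (0 : Fin 3) ≠ 2 by decide, show (1 : Fin 3) ≠ 2 by decide, if_false, s2, s3]; ring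

lemma unimod_nf (hp : p ≠ 2) {M : Matrix (Fin 3) (Fin 3) ℤ_[p]} (hs : M.IsSymm) (hd : IsUnit M.det) :
    ∃ c, IsUnit c ∧ PadicIsomP p M !![0, 1, 0; 1, 0, 0; 0, 0, -(M.det * c^2)] := by
  obtain ⟨x, i, hi, hq⟩ := unimod_isotropic hp hs hd
  obtain ⟨U, hU, hUx⟩ := exists_basis x i hi
  obtain ⟨N, hN⟩ : ∃ N, N = Uᵀ * M * U := ⟨_, rfl⟩
  have hMN : PadicIsomP p M N := ⟨U, hU, hN.symm⟩
  have hNs : N.IsSymm := hMN.symmMat hs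
  have h00 : N 0 0 = 0 := by rw [hN, comp_00 M U x hUx, hq]
  have hNd : N.det = M.det * U.det ^ 2 := by rw [hN, det_mul, det_mul, det_transpose]; ring
  have hNu : IsUnit N.det := by rw [hNd]; exact hd.mul (hU.pow 2)
  obtain ⟨h2, hh2⟩ := (two_unit hp).exists_right_inv
  by_cases h01 : IsUnit (N 0 1)
  · refine ⟨U.det, hU, hMN.trans ?_⟩
    rw [← hNd]
    exact normal_form_p hNs h00 (β := h2 * N 1 1) (by rw [← mul_assoc, hh2, one_mul]) h01
  · have h02 : IsUnit (N 0 2) := by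
      by_contra h02
      rw [nonunit_iff] at h01 h02
      have : ¬ IsUnit N.det := by
        rw [nonunit_iff, det_fin_three, hNs.apply 0 1, hNs.apply 0 2, hNs.apply 1 2, h00]
        obtain ⟨a, ha⟩ := h01
        obtain ⟨b, hb⟩ := h02
        rw [ha, hb]
        exact ⟨- a * (p * a * N 2 2) + a * N 1 2 * p * b + (p * b) * a * N 1 2 - b * N 1 1 * p * b, by ring⟩
      exact this hNu
    obtain ⟨N', hN', hd', h00', h01'⟩ := perm12 (M := N)
    refine ⟨U.det, hU, (hMN.trans hN').trans ?_⟩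
    rw [← hNd, ← hd']
    exact normal_form_p (hN'.symmMat hNs) (h00'.trans h00) (β := h2 * N' 1 1) (by rw [← mul_assoc, hh2, one_mul])
      (by rw [h01']; exact h02)

lemma scale_nf (e c : ℤ_[p]) (hc : IsUnit c) :
    PadicIsomP p !![0, 1, 0; 1, 0, 0; 0, 0, e] !![0, 1, 0; 1, 0, 0; 0, 0, e * c^2] := by
  refine ⟨!![1, 0, 0; 0, 1, 0; 0, 0, c], by simpa [det_fin_three] using hc, ?_⟩
  ext i j
  simp only [Matrix.mul_apply, Fin.sum_univ_three, transpose_apply]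
  fin_cases i <;> fin_cases j <;> simp
  ring

theorem unimod_class (hp : p ≠ 2) {M N : Matrix (Fin 3) (Fin 3) ℤ_[p]} (hM : M.IsSymm) (hN : N.IsSymm)
    (hd : IsUnit M.det) (he : M.det = N.det) : PadicIsomP p M N := by
  obtain ⟨c, hc, h1⟩ := unimod_nf hp hM hd
  obtain ⟨c', hc', h2⟩ := unimod_nf hp hN (he ▸ hd)
  have k1 := h1.trans (by rw [← neg_mul]; exact (scale_nf (-M.det) c hc).symm)
  have k2 := h2.trans (by rw [← neg_mul]; exact (scale_nf (-N.det) c' hc').symm)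
  rw [← he] at k2
  exact k1.trans k2.symm
end


section
variable {p : ℕ} [hpf : Fact p.Prime]

def Sol (a b : ℤ_[p]) : Prop := ∃ x y z : ℤ_[p], (x ≠ 0 ∨ y ≠ 0 ∨ z ≠ 0) ∧ a * x ^ 2 + b * y ^ 2 = z ^ 2

lemma Sol.symm {a b : ℤ_[p]} (h : Sol a b) : Sol b a := by
  obtain ⟨x, y, z, h, e⟩ := h
  exact ⟨y, x, z, by tauto, by linear_combination e⟩

lemma sol_sq {a b c : ℤ_[p]} (hc : c ≠ 0) : Sol (a * (c * c)) b ↔ Sol a b := by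
  constructor
  · rintro ⟨x, y, z, h, e⟩
    refine ⟨c * x, y, z, ?_, by linear_combination e⟩
    rcases h with h | h | h
    · exact Or.inl (mul_ne_zero hc h)
    · tauto
    · tauto
  · rintro ⟨x, y, z, h, e⟩
    refine ⟨x, c * y, c * z, ?_, by linear_combination c ^ 2 * e⟩
    rcases h with h | h | h
    · exact Or.inl h
    · exact Or.inr (Or.inl (mul_ne_zero hc h))
    · exact Or.inr (Or.inr (mul_ne_zero hc h))

lemma sol_symm {a b : ℤ_[p]} : Sol a b ↔ Sol b a := ⟨Sol.symm, Sol.symm⟩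

lemma sol_mul_aux {a b : ℤ_[p]} (ha : a ≠ 0) (h : Sol a b) : Sol a (-(a * b)) := by
  obtain ⟨x, y, z, h, e⟩ := h
  refine ⟨z, y, a * x, ?_, by linear_combination (-a) * e⟩
  rcases h with h | h | h
  · exact Or.inr (Or.inr (mul_ne_zero ha h))
  · tauto
  · tauto

lemma sol_mul {a b : ℤ_[p]} (ha : a ≠ 0) : Sol a b ↔ Sol a (-(a * b)) := by
  refine ⟨sol_mul_aux ha, fun h => ?_⟩
  have := sol_mul_aux ha h
  rw [show -(a * -(a * b)) = b * (a * a) by ring] at this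
  exact ((sol_sq ha).mp this.symm).symm

lemma sol_primitive {a b : ℤ_[p]} (h : Sol a b) : ∃ x y z : ℤ_[p], (x = 1 ∨ y = 1 ∨ z = 1) ∧
    a * x ^ 2 + b * y ^ 2 = z ^ 2 := by
  obtain ⟨x, y, z, h, e⟩ := h
  have hne : (![x, y, z] : Fin 3 → ℤ_[p]) ≠ 0 := by
    intro h0
    have h1 := congrFun h0 0
    have h2 := congrFun h0 1
    have h3 := congrFun h0 2
    simp at h1 h2 h3
    tauto
  obtain ⟨w, i, hi, c, hc, e2⟩ := exists_primitive hne
  have h1 := congrFun e2 0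
  have h2 := congrFun e2 1
  have h3 := congrFun e2 2
  simp at h1 h2 h3
  refine ⟨w 0, w 1, w 2, ?_, ?_⟩
  · have i3 : i = 0 ∨ i = 1 ∨ i = 2 := by fin_cases i <;> simp
    rcases i3 with rfl | rfl | rfl <;> tauto
  · rw [h1, h2, h3] at e
    apply mul_left_cancel₀ (pow_ne_zero 2 hc)
    linear_combination e

lemma int_unit {x : ℤ} (h : ¬ (p : ℤ) ∣ x) : IsUnit (x : ℤ_[p]) := by
  by_contra hn
  rw [nonunit_iff, ← PadicInt.norm_lt_one_iff_dvd, PadicInt.norm_int_lt_one_iff_dvd] at hn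
  exact h hn

lemma int_ne {x : ℤ} (h : x ≠ 0) : (x : ℤ_[p]) ≠ 0 := by exact_mod_cast h

/-- odd p, both units -/
lemma sol_unit (hp : p ≠ 2) {a b : ℤ_[p]} (ha : IsUnit a) (hb : IsUnit b) : Sol a b := by
  have hs : (!![a, 0, 0; 0, b, 0; 0, 0, -1] : Matrix (Fin 3) (Fin 3) ℤ_[p]).IsSymm := by
    ext i j; fin_cases i <;> fin_cases j <;> rfl
  obtain ⟨x, i, hi, hq⟩ := unimod_isotropic hp hs (by
    rw [det_fin_three]; simpa using ha.mul hb)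
  rw [quadVal_expand _ hs] at hq
  simp at hq
  refine ⟨x 0, x 1, x 2, ?_, by linear_combination hq⟩
  have i3 : i = 0 ∨ i = 1 ∨ i = 2 := by fin_cases i <;> simp
  rcases i3 with rfl | rfl | rfl <;> have := hi.ne_zero <;> tauto

/-- odd p, square roots of units -/
lemma sqrt_odd (hp : p ≠ 2) {v s : ℤ} (hv : ¬ (p : ℤ) ∣ v) (h : (p : ℤ) ∣ s ^ 2 - v) :
    ∃ t : ℤ_[p], t ^ 2 = v := by
  have hs : ¬ (p : ℤ) ∣ s := by
    intro hs
    apply hv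
    have := (dvd_sub_right (dvd_pow hs two_ne_zero)).mp h
    exact this
  obtain ⟨t, ht, _⟩ := hensel_quad ((s : ℤ_[p]) ^ 2 - (v : ℤ_[p])) (2 * (s : ℤ_[p])) 1 ((two_unit hp).mul (int_unit hs)) (by
    have := (PadicInt.norm_int_lt_one_iff_dvd (p := p) (s ^ 2 - v)).mpr h
    push_cast at this; exact this)
  exact ⟨s + t, by linear_combination ht⟩

lemma sol_one_zero (hp : p ≠ 2) {u v : ℤ} (hu : ¬ (p : ℤ) ∣ u) (hv : ¬ (p : ℤ) ∣ v) :
    Sol ((p : ℤ_[p]) * (u : ℤ_[p])) (v : ℤ_[p]) ↔ jacobiSym v p = 1 := by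
  rw [← jacobiSym.legendreSym.to_jacobiSym, legendreSym.eq_one_iff p (by
    rwa [Ne, ZMod.intCast_zmod_eq_zero_iff_dvd])]
  constructor
  · intro h
    obtain ⟨x, y, z, h1, e⟩ := sol_primitive h
    have hp0 : (p : ℤ_[p]) ≠ 0 := by exact_mod_cast hpf.out.ne_zero
    have hpp : Prime (p : ℤ_[p]) := PadicInt.prime_p
    have hy : ¬ (p : ℤ_[p]) ∣ y := by
      rintro ⟨y', rfl⟩
      have hz : (p : ℤ_[p]) ∣ z := hpp.dvd_of_dvd_pow (n := 2) (by
        rw [← e]; exact ⟨u * x ^ 2 + v * p * y' ^ 2, by ring⟩)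
      obtain ⟨z', rfl⟩ := hz
      have hx : (p : ℤ_[p]) ∣ x := by
        have : (p : ℤ_[p]) ∣ u * x ^ 2 := ⟨z' ^ 2 - v * y' ^ 2, by
          apply mul_left_cancel₀ hp0; linear_combination e⟩
        rcases hpp.dvd_or_dvd this with h | h
        · exact absurd h (fun h => (nonunit_iff.mpr h) (int_unit hu))
        · exact hpp.dvd_of_dvd_pow h
      have h1u : ¬ (p : ℤ_[p]) ∣ 1 := fun h => hpp.not_isUnit (isUnit_of_dvd_one h)
      rcases h1 with h | h | h
      · exact h1u (h ▸ hx)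
      · exact h1u (h ▸ dvd_mul_right _ _)
      · exact h1u (h ▸ dvd_mul_right _ _)
    have e2 := congrArg (PadicInt.toZMod (p := p)) e
    have hy2 : PadicInt.toZMod y ≠ 0 := fun h => hy (toZMod_zero_iff.mp h)
    simp only [map_add, map_mul, map_pow, map_natCast, map_intCast, CharP.cast_eq_zero, zero_mul, zero_add] at e2
    refine ⟨PadicInt.toZMod z / PadicInt.toZMod y, ?_⟩
    field_simp
    linear_combination e2
  · rintro ⟨s, hs⟩
    obtain ⟨t, ht⟩ := sqrt_odd hp (s := (s.val : ℤ)) hv (by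
      rw [← ZMod.intCast_zmod_eq_zero_iff_dvd]
      push_cast
      simp [hs, sq])
    refine ⟨0, 1, t, by simp, by linear_combination -ht⟩

end

lemma sqrt_two {v : ℤ} (h : v % 8 = 1) : ∃ t : ℤ_[2], t ^ 2 = v := by
  obtain ⟨k, hk⟩ : ∃ k, v = 8 * k + 1 := ⟨v / 8, by omega⟩
  -- (1+2t)^2 = 1+4t+4t^2 = 1 + 8k
  obtain ⟨t, ht, _⟩ := hensel_quad (p := 2) (-(2 * k : ℤ_[2])) 1 1 isUnit_one (by
    have := (PadicInt.norm_int_lt_one_iff_dvd (p := 2) (2 * k)).mpr ⟨k, by push_cast; ring⟩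
    push_cast at this; rw [norm_neg]; exact this)
  exact ⟨1 + 2 * t, by rw [hk]; push_cast; linear_combination 4 * ht⟩

lemma sq8 : ∀ x : ZMod 8, x ^ 2 = 0 ∨ x ^ 2 = 1 ∨ x ^ 2 = 4 := by decide

lemma sol_mod8 {a b : ℤ} (h : Sol (a : ℤ_[2]) (b : ℤ_[2])) : ∃ X Y Z : ZMod 8, (X = 0 ∨ X = 1 ∨ X = 4) ∧
    (Y = 0 ∨ Y = 1 ∨ Y = 4) ∧ (Z = 0 ∨ Z = 1 ∨ Z = 4) ∧ (X = 1 ∨ Y = 1 ∨ Z = 1) ∧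
    ((a % 8 : ℤ) : ZMod 8) * X + ((b % 8 : ℤ) : ZMod 8) * Y = Z := by
  obtain ⟨x, y, z, h1, e⟩ := sol_primitive h
  let f : ℤ_[2] →+* ZMod 8 := PadicInt.toZModPow 3
  have e2 := congrArg f e
  simp only [map_add, map_mul, map_pow, map_intCast] at e2
  refine ⟨f x ^ 2, f y ^ 2, f z ^ 2, sq8 _, sq8 _, sq8 _, ?_, ?_⟩
  · rcases h1 with h | h | h <;> rw [h] <;> simp
  · rw [← e2]
    congr 2
    · have := ZMod.intCast_mod a 8; exact_mod_cast this
    · have := ZMod.intCast_mod b 8; exact_mod_cast this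

lemma sol2_unit {u v : ℤ} (hu : ¬ (2 : ℤ) ∣ u) (hv : ¬ (2 : ℤ) ∣ v) :
    Sol (u : ℤ_[2]) (v : ℤ_[2]) ↔ ¬ (u % 4 = 3 ∧ v % 4 = 3) := by
  constructor
  · intro h ⟨h1, h2⟩
    obtain ⟨X, Y, Z, hX, hY, hZ, h0, e⟩ := sol_mod8 h
    have h1' : u % 8 = 3 ∨ u % 8 = 7 := by omega
    have h2' : v % 8 = 3 ∨ v % 8 = 7 := by omega
    rcases h1' with h1' | h1' <;> rcases h2' with h2' | h2' <;> rw [h1', h2'] at e <;> clear h1' h2' h h1 h2 <;>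
    rcases hX with rfl | rfl | rfl <;> rcases hY with rfl | rfl | rfl <;> rcases hZ with rfl | rfl | rfl <;>
    revert e h0 <;> decide
  · intro h
    have key : ∀ u v : ℤ, ¬ (2 : ℤ) ∣ v → u % 4 = 1 → Sol (u : ℤ_[2]) (v : ℤ_[2]) := by
      intro u v hv hu
      by_cases h1 : u % 8 = 1
      · obtain ⟨t, ht⟩ := sqrt_two h1
        exact ⟨1, 0, t, by simp, by linear_combination -ht⟩
      · obtain ⟨t, ht⟩ := sqrt_two (v := u + 4 * v) (by omega)
        push_cast at ht
        exact ⟨1, 2, t, by simp, by linear_combination -ht⟩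
    have : u % 4 = 1 ∨ v % 4 = 1 := by omega
    rcases this with h | h
    · exact key u v hv h
    · exact (key v u hu h).symm

lemma sol2_one {u v : ℤ} (hu : ¬ (2 : ℤ) ∣ u) (hv : ¬ (2 : ℤ) ∣ v) :
    Sol (2 * u : ℤ_[2]) (v : ℤ_[2]) ↔ (v % 8 = 1 ∨ (2 * u + v) % 8 = 1) := by
  constructor
  · intro h
    have h' : Sol (((2 * u : ℤ)) : ℤ_[2]) (v : ℤ_[2]) := by push_cast; exact h
    obtain ⟨X, Y, Z, hX, hY, hZ, h0, e⟩ := sol_mod8 h'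
    have h1' : (2 * u) % 8 = 2 ∨ (2 * u) % 8 = 6 := by omega
    have h2' : v % 8 = 1 ∨ v % 8 = 3 ∨ v % 8 = 5 ∨ v % 8 = 7 := by omega
    have key : (v % 8 = 1 ∨ ((2 * u) % 8 + v % 8) % 8 = 1) := by
      rcases h1' with h1' | h1' <;> rcases h2' with h2' | h2' | h2' | h2' <;> rw [h1', h2'] at e ⊢ <;>
      clear h1' h2' h h' <;>
      rcases hX with rfl | rfl | rfl <;> rcases hY with rfl | rfl | rfl <;> rcases hZ with rfl | rfl | rfl <;>
      revert e h0 <;> decide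
    omega
  · rintro (h | h)
    · obtain ⟨t, ht⟩ := sqrt_two h
      exact ⟨0, 1, t, by simp, by linear_combination -ht⟩
    · obtain ⟨t, ht⟩ := sqrt_two h
      push_cast at ht
      exact ⟨1, 1, t, by simp, by linear_combination -ht⟩

section
variable {p : ℕ} [hpf : Fact p.Prime]

lemma hil_prime_mul (hp2 : p ≠ 2) {u v : ℤ} (hu : ¬ (p : ℤ) ∣ u) (hv : ¬ (p : ℤ) ∣ v) :
    hil p (p * u) v = jacobiSym v p := by
  have hp := hpf.out
  rw [hil_mul_left hp _ (by exact_mod_cast hp.ne_zero) (by rintro rfl; simp at hu), hil_prime_left hp hp2 hv, hil_unit hp hp2 hu hv, mul_one]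

lemma hil_iff_00 {u v : ℤ} (hu : ¬ (p : ℤ) ∣ u) (hv : ¬ (p : ℤ) ∣ v) :
    hil p u v = 1 ↔ Sol (u : ℤ_[p]) (v : ℤ_[p]) := by
  by_cases hp : p = 2
  · subst hp
    push_cast at hu hv
    rw [hil_two_unit hu hv, sol2_unit hu hv]
    unfold ee; simp
  · exact iff_of_true (hil_unit hpf.out hp hu hv) (sol_unit hp (int_unit hu) (int_unit hv))

lemma hil_iff_10 {u v : ℤ} (hu : ¬ (p : ℤ) ∣ u) (hv : ¬ (p : ℤ) ∣ v) :
    hil p (p * u) v = 1 ↔ Sol ((p * u : ℤ) : ℤ_[p]) (v : ℤ_[p]) := by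
  by_cases hp : p = 2
  · subst hp
    push_cast at hu hv ⊢
    rw [hil_mul_left Nat.prime_two _ (by norm_num) (by rintro rfl; simp at hu), hil_two_two hv, hil_two_unit hu hv, sol2_one hu hv]
    unfold ee
    rw [ZMod.χ₈_int_eq_if_mod_eight]
    split_ifs <;> simp <;> omega
  · push_cast
    rw [hil_prime_mul hp hu hv, sol_one_zero hp hu hv]

theorem hil_iff {a b : ℤ} (ha : a ≠ 0) (hb : b ≠ 0) : hil p a b = 1 ↔ Sol (a : ℤ_[p]) (b : ℤ_[p]) := by
  have hp := hpf.out
  have hp0 : (p : ℤ) ≠ 0 := by exact_mod_cast hp.ne_zero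
  have red : ∀ a : ℤ, a ≠ 0 → ∃ c u : ℤ, c ≠ 0 ∧ ¬ (p : ℤ) ∣ u ∧ (a = u * (c * c) ∨ a = (p * u) * (c * c)) := by
    intro a ha
    have hs := uPart_spec p a
    refine ⟨(p : ℤ) ^ (padicValInt p a / 2), uPart p a, pow_ne_zero _ hp0, uPart_not_dvd hp ha, ?_⟩
    rcases Nat.mod_two_eq_zero_or_one (padicValInt p a) with h | h
    · left
      rw [← pow_add]
      have : padicValInt p a / 2 + padicValInt p a / 2 = padicValInt p a := by omega
      rw [this, mul_comm]; exact hs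
    · right
      rw [← pow_add]
      have : padicValInt p a = (padicValInt p a / 2 + padicValInt p a / 2) + 1 := by omega
      conv_lhs => rw [hs, this]
      ring
  obtain ⟨c, u, hc, hu, hau⟩ := red a ha
  obtain ⟨c', v, hc', hv, hbv⟩ := red b hb
  have hu0 : u ≠ 0 := by rintro rfl; simp at hu
  have hv0 : v ≠ 0 := by rintro rfl; simp at hv
  have hpu : (p : ℤ) * u ≠ 0 := mul_ne_zero hp0 hu0
  have hpv : (p : ℤ) * v ≠ 0 := mul_ne_zero hp0 hv0
  have gen : ∀ a0 b0 : ℤ, a0 ≠ 0 → b0 ≠ 0 → (hil p a0 b0 = 1 ↔ Sol (a0 : ℤ_[p]) (b0 : ℤ_[p])) →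
      a = a0 * (c * c) → b = b0 * (c' * c') → (hil p a b = 1 ↔ Sol (a : ℤ_[p]) (b : ℤ_[p])) := by
    intro a0 b0 h1 h2 h e1 e2
    rw [e2, hil_sq_right hp ha h2 hc', hil_symm, e1, hil_sq_right hp h2 h1 hc, hil_symm, h]
    push_cast
    rw [sol_sq (int_ne hc), sol_symm (b := (b0 : ℤ_[p]) * _), sol_sq (int_ne hc'), sol_symm]
  rcases hau with e1 | e1 <;> rcases hbv with e2 | e2
  · exact gen u v hu0 hv0 (hil_iff_00 hu hv) e1 e2
  · refine gen u (p * v) hu0 hpv ?_ e1 e2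
    rw [hil_symm, sol_symm]; exact hil_iff_10 hv hu
  · exact gen (p * u) v hpu hv0 (hil_iff_10 hu hv) e1 e2
  · refine gen (p * u) (p * v) hpu hpv ?_ e1 e2
    have huv : ¬ (p : ℤ) ∣ -(u * v) := by
      rw [dvd_neg]
      intro h
      rcases (Nat.prime_iff_prime_int.mp hp).dvd_or_dvd h with h | h
      · exact hu h
      · exact hv h
    have huv0 : -(u * v) ≠ 0 := by rw [neg_ne_zero]; exact mul_ne_zero hu0 hv0
    rw [sol_mul (int_ne hpu), sol_symm]
    rw [show -(((p * u : ℤ) : ℤ_[p]) * ((p * v : ℤ) : ℤ_[p])) = ((-(u * v) : ℤ) : ℤ_[p]) * (((p : ℤ) : ℤ_[p]) * ((p : ℤ) : ℤ_[p])) by push_cast; ring,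
      sol_sq (int_ne hp0), sol_symm, ← hil_iff_10 hu huv]
    have h1 : hil p (p * u) (p * v) = hil p (p * u) (-(p * u)) * hil p (p * u) (p * v) := by
      rw [hil_neg_self hp hpu, one_mul]
    rw [h1, ← hil_mul_right hp _ (neg_ne_zero.mpr hpu) hpv,
      show -((p : ℤ) * u) * (p * v) = -(u * v) * (p * p) by ring, hil_sq_right hp hpu huv0 hp0]
end


section
variable {p : ℕ} [hpf : Fact p.Prime]

lemma iso_diag {M : Matrix (Fin 3) (Fin 3) ℤ_[p]} (hs : M.IsSymm) (ha : M 0 0 ≠ 0)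
    (hD : M 0 0 * M 1 1 - M 0 1 ^ 2 ≠ 0) :
    (∃ x : Fin 3 → ℤ_[p], x ≠ 0 ∧ quadVal M x = 0) ↔
      Sol (-(M 0 0 * M 1 1 - M 0 1 ^ 2)) (-(M 0 0 * M.det)) := by
  have hdet := det_expand M hs
  obtain ⟨D, hDd⟩ : ∃ D, D = M 0 0 * M 1 1 - M 0 1 ^ 2 := ⟨_, rfl⟩
  obtain ⟨β, hβ⟩ : ∃ β, β = M 0 0 * M 1 2 - M 0 1 * M 0 2 := ⟨_, rfl⟩
  have key : ∀ x : Fin 3 → ℤ_[p], M 0 0 * D * quadVal M x = D * (M 0 0 * x 0 + M 0 1 * x 1 + M 0 2 * x 2) ^ 2 +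
      (D * x 1 + β * x 2) ^ 2 + M 0 0 * M.det * x 2 ^ 2 := by
    intro x
    rw [quadVal_expand M hs, hdet, hβ, hDd]; ring
  rw [← hDd] at hD ⊢
  constructor
  · rintro ⟨x, hx, hq⟩
    have k := key x
    rw [hq] at k
    refine ⟨M 0 0 * x 0 + M 0 1 * x 1 + M 0 2 * x 2, x 2, D * x 1 + β * x 2, ?_, by linear_combination k⟩
    by_contra hno
    push Not at hno
    obtain ⟨h1, h2, h3⟩ := hno
    rw [h2] at h1 h3
    have hx1 : x 1 = 0 := by
      have : D * x 1 = 0 := by linear_combination h3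
      exact (mul_eq_zero.mp this).resolve_left hD
    rw [hx1] at h1
    have hx0 : x 0 = 0 := by
      have : M 0 0 * x 0 = 0 := by linear_combination h1
      exact (mul_eq_zero.mp this).resolve_left ha
    apply hx; funext i
    have i3 : i = 0 ∨ i = 1 ∨ i = 2 := by fin_cases i <;> simp
    rcases i3 with rfl | rfl | rfl <;> simp [hx0, hx1, h2]
  · rintro ⟨X, Z, Y, h, e⟩
    obtain ⟨w, hw⟩ : ∃ w : Fin 3 → ℤ_[p], w = ![D * X - M 0 1 * (Y - β * Z) - M 0 2 * D * Z, M 0 0 * (Y - β * Z), M 0 0 * D * Z] := ⟨_, rfl⟩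
    have w0 : w 0 = D * X - M 0 1 * (Y - β * Z) - M 0 2 * D * Z := by rw [hw]; rfl
    have w1 : w 1 = M 0 0 * (Y - β * Z) := by rw [hw]; rfl
    have w2 : w 2 = M 0 0 * D * Z := by rw [hw]; rfl
    refine ⟨w, ?_, ?_⟩
    · rintro h0
      rw [h0] at w0 w1 w2
      simp only [Pi.zero_apply] at w0 w1 w2
      have hZ : Z = 0 := (mul_eq_zero.mp w2.symm).resolve_left (mul_ne_zero ha hD)
      rw [hZ] at w0 w1
      have hY : Y = 0 := by
        have := (mul_eq_zero.mp w1.symm).resolve_left ha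
        linear_combination this
      rw [hY] at w0
      have hX : X = 0 := by
        have : D * X = 0 := by linear_combination -w0
        exact (mul_eq_zero.mp this).resolve_left hD
      simp [hX, hY, hZ] at h
    · have k := key w
      have : M 0 0 * D * quadVal M w = M 0 0 * D * 0 := by
        rw [k, w0, w1, w2]
        linear_combination -(M 0 0 ^ 2 * D ^ 2) * e
      exact mul_left_cancel₀ (mul_ne_zero ha hD) this

lemma iso_congr {M N : Matrix (Fin 3) (Fin 3) ℤ_[p]} (h : PadicIsomP p M N)
    (hx : ∃ x : Fin 3 → ℤ_[p], x ≠ 0 ∧ quadVal N x = 0) : ∃ x : Fin 3 → ℤ_[p], x ≠ 0 ∧ quadVal M x = 0 := by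
  obtain ⟨U, hU, rfl⟩ := h
  obtain ⟨x, hx, hq⟩ := hx
  refine ⟨U *ᵥ x, ?_, by rw [← quadVal_comp]; exact hq⟩
  intro h0
  apply hx
  have : U⁻¹ *ᵥ (U *ᵥ x) = 0 := by rw [h0]; simp
  rwa [Matrix.mulVec_mulVec, Matrix.nonsing_inv_mul _ hU, Matrix.one_mulVec] at this

/-- a nonzero p-adic integer divides a power of p -/
lemma dvd_pow_p {x : ℤ_[p]} (hx : x ≠ 0) : ∃ k : ℕ, 1 ≤ k ∧ x ∣ (p : ℤ_[p]) ^ k := by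
  refine ⟨x.valuation + 1, by omega, ?_⟩
  rw [pow_succ]
  apply Dvd.dvd.mul_right
  obtain ⟨u, hu⟩ : ∃ u : ℤ_[p]ˣ, x = u * (p : ℤ_[p]) ^ x.valuation := ⟨_, PadicInt.unitCoeff_spec hx⟩
  generalize x.valuation = v at hu ⊢
  refine ⟨((u⁻¹ : ℤ_[p]ˣ) : ℤ_[p]), ?_⟩
  have h1 : (u : ℤ_[p]) * ((u⁻¹ : ℤ_[p]ˣ) : ℤ_[p]) = 1 := by simp
  rw [hu]; linear_combination (-(p : ℤ_[p]) ^ v) * h1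

lemma exists_int_approx (x : ℤ_[p]) (k : ℕ) : ∃ z : ℤ, (p : ℤ_[p]) ^ k ∣ x - z := by
  have := PadicInt.appr_spec k x
  rw [Ideal.mem_span_singleton] at this
  exact ⟨PadicInt.appr x k, by simpa using this⟩

lemma local_shape {M : Matrix (Fin 3) (Fin 3) ℤ_[p]} (hs : M.IsSymm) (hd : M.det ≠ 0) {n : ℤ_[p]} (hn : n ≠ 0)
    {x : Fin 3 → ℤ_[p]} {i : Fin 3} (hi : IsUnit (x i)) (hx : quadVal M x = n) :
    ∃ N : Matrix (Fin 3) (Fin 3) ℤ_[p], PadicIsomP p M N ∧ N.det = M.det ∧ N 0 0 = n ∧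
      N 0 0 * N 1 1 - N 0 1 ^ 2 ≠ 0 := by
  obtain ⟨U, hU, hUx⟩ := exists_basis x i hi
  obtain ⟨c, hc⟩ := hU.exists_right_inv
  let V : Matrix (Fin 3) (Fin 3) ℤ_[p] := U * !![1, 0, 0; 0, 1, 0; 0, 0, c]
  have hV : V.det = 1 := by
    have : (!![1, 0, 0; 0, 1, 0; 0, 0, c] : Matrix (Fin 3) (Fin 3) ℤ_[p]).det = c := by simp [det_fin_three]
    simp only [V]
    rw [det_mul, this, hc]
  have hVx : ∀ j, V j 0 = x j := by
    intro j; rw [← hUx j]; simp [V, Matrix.mul_apply, Fin.sum_univ_three]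
  obtain ⟨N, hN⟩ : ∃ N, N = Vᵀ * M * V := ⟨_, rfl⟩
  have hMN : PadicIsomP p M N := ⟨V, by rw [hV]; exact isUnit_one, hN.symm⟩
  have hNd : N.det = M.det := by rw [hN, det_mul, det_mul, det_transpose, hV]; ring
  have hN0 : N 0 0 = n := by rw [hN, comp_00 M V x hVx, hx]
  have hNs : N.IsSymm := hMN.symmMat hs
  have step : ∀ W : Matrix (Fin 3) (Fin 3) ℤ_[p], W.det ^ 2 = 1 → (Wᵀ * N * W) 0 0 = n →
      (Wᵀ * N * W) 0 0 * (Wᵀ * N * W) 1 1 - (Wᵀ * N * W) 0 1 ^ 2 ≠ 0 →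
      ∃ N : Matrix (Fin 3) (Fin 3) ℤ_[p], PadicIsomP p M N ∧ N.det = M.det ∧ N 0 0 = n ∧
      N 0 0 * N 1 1 - N 0 1 ^ 2 ≠ 0 := by
    intro W hW h0 h1
    refine ⟨Wᵀ * N * W, hMN.trans ⟨W, ?_, rfl⟩, ?_, h0, h1⟩
    · exact IsUnit.of_mul_eq_one W.det (by rw [← sq]; exact hW)
    · rw [det_mul, det_mul, det_transpose, ← hNd]; linear_combination N.det * hW
  have s1 := hNs.apply 0 1
  have s2 := hNs.apply 0 2
  have s3 := hNs.apply 1 2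
  by_cases h1 : N 0 0 * N 1 1 - N 0 1 ^ 2 = 0
  · by_cases h2 : N 0 0 * N 2 2 - N 0 2 ^ 2 = 0
    · have hdet := det_expand N hNs
      have hb : N 0 0 * N 1 2 - N 0 1 * N 0 2 ≠ 0 := by
        intro h3
        have : N 0 0 * N.det = 0 := by
          rw [hdet]
          linear_combination (N 0 0 * N 2 2 - N 0 2 ^ 2) * h1 - (N 0 0 * N 1 2 - N 0 1 * N 0 2) * h3
        rcases mul_eq_zero.mp this with h | h
        · rw [hN0] at h; exact hn h
        · rw [hNd] at h; exact hd h
      apply step !![1, 0, 0; 0, 1, 0; 0, 1, 1]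
      · simp [det_fin_three]
      · simp [Matrix.mul_apply, Fin.sum_univ_three, hN0]
      · simp [Matrix.mul_apply, Fin.sum_univ_three, s1, s2, s3]
        intro h
        have h2b : 2 * (N 0 0 * N 1 2 - N 0 1 * N 0 2) = 0 := by linear_combination h - h1 - h2
        rcases mul_eq_zero.mp h2b with h | h
        · exact two_ne_zero h
        · exact hb h
    · apply step !![1, 0, 0; 0, 0, 1; 0, 1, 0]
      · simp [det_fin_three]
      · simp [Matrix.mul_apply, Fin.sum_univ_three, hN0]
      · simp [Matrix.mul_apply, Fin.sum_univ_three, s1, s2, s3]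
        exact h2
  · exact ⟨N, hMN, hNd, hN0, h1⟩

/-- The local approximation lemma. -/
lemma local_good {M : Matrix (Fin 3) (Fin 3) ℤ_[p]} (hs : M.IsSymm) (hd : M.det ≠ 0) {n : ℤ_[p]} (hn : n ≠ 0)
    {x : Fin 3 → ℤ_[p]} {i : Fin 3} (hi : IsUnit (x i)) (hx : quadVal M x = n) :
    ∃ (k : ℕ) (b0 c0 e0 a0 : ℤ), ∀ b c e a : ℤ, (p : ℤ) ^ k ∣ b - b0 → (p : ℤ) ^ k ∣ c - c0 →
      (p : ℤ) ^ k ∣ e - e0 → (p : ℤ) ^ k ∣ a - a0 →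
      ∃ N : Matrix (Fin 3) (Fin 3) ℤ_[p], PadicIsomP p M N ∧ N.det = M.det ∧ N 0 0 = n ∧ N 0 1 = b ∧ N 0 2 = c ∧
        n * N 1 1 = a + b ^ 2 ∧ n * N 1 2 = e + b * c := by
  obtain ⟨C, hMC, hCd, hC0, hα⟩ := local_shape hs hd hn hi hx
  have hCs := hMC.symmMat hs
  have s1 := hCs.apply 0 1
  have s2 := hCs.apply 0 2
  have s3 := hCs.apply 1 2
  obtain ⟨α, hαd⟩ : ∃ α, α = C 0 0 * C 1 1 - C 0 1 ^ 2 := ⟨_, rfl⟩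
  obtain ⟨β, hβd⟩ : ∃ β, β = C 0 0 * C 1 2 - C 0 1 * C 0 2 := ⟨_, rfl⟩
  rw [← hαd] at hα
  have hp0 : (p : ℤ_[p]) ≠ 0 := by exact_mod_cast hpf.out.ne_zero
  have hz : 4 * p * n * α ^ 2 ≠ 0 :=
    mul_ne_zero (mul_ne_zero (mul_ne_zero (by exact_mod_cast (by norm_num : (4 : ℕ) ≠ 0)) hp0) hn) (pow_ne_zero 2 hα)
  obtain ⟨k, hk1, hk⟩ := dvd_pow_p hz
  obtain ⟨b0, hb0⟩ := exists_int_approx (C 0 1) k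
  obtain ⟨c0, hc0⟩ := exists_int_approx (C 0 2) k
  obtain ⟨e0, he0⟩ := exists_int_approx β k
  obtain ⟨a0, ha0⟩ := exists_int_approx α k
  refine ⟨k, b0, c0, e0, a0, ?_⟩
  intro b c e a hb hc he ha
  have comb : ∀ (y : ℤ_[p]) (z0 z : ℤ), (p : ℤ_[p]) ^ k ∣ y - z0 → (p : ℤ) ^ k ∣ z - z0 →
      ∃ s, (z : ℤ_[p]) = y + 4 * p * n * α ^ 2 * s := by
    intro y z0 z h1 h2
    have h2' : (p : ℤ_[p]) ^ k ∣ (z : ℤ_[p]) - z0 := by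
      obtain ⟨w, hw⟩ := h2
      exact ⟨(w : ℤ_[p]), by rw [← Int.cast_sub, hw]; push_cast; ring⟩
    obtain ⟨s, hs⟩ := hk.trans (dvd_sub h2' h1)
    exact ⟨s, by linear_combination hs⟩
  obtain ⟨t1, ht1⟩ := comb _ _ _ hb0 hb
  obtain ⟨t2, ht2⟩ := comb _ _ _ hc0 hc
  obtain ⟨t3, ht3⟩ := comb _ _ _ he0 he
  obtain ⟨t4, ht4⟩ := comb _ _ _ ha0 ha
  -- square root
  obtain ⟨τ, hτ, hτn⟩ := hensel_quad (-((p : ℤ_[p]) * t4)) 1 (n * α) isUnit_one (by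
    rw [norm_neg, PadicInt.norm_lt_one_iff_dvd]; exact dvd_mul_right _ _)
  obtain ⟨ε, hε⟩ : ∃ ε, ε = 1 + n * α * (2 * τ) := ⟨_, rfl⟩
  have hεα : ε ^ 2 * α = a := by
    rw [hε, ht4]; linear_combination 4 * n * α ^ 2 * hτ
  have hεu : IsUnit ε := by
    by_contra h
    rw [nonunit_iff] at h
    have h1 : (p : ℤ_[p]) ∣ n * α * (2 * τ) :=
      dvd_mul_of_dvd_right (dvd_mul_of_dvd_right ((PadicInt.norm_lt_one_iff_dvd _).mp hτn) _) _
    rw [hε] at h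
    have h2 := (dvd_add_left h1).mp h
    exact PadicInt.prime_p.not_isUnit (isUnit_of_dvd_one h2)
  obtain ⟨ε', hε'⟩ := hεu.exists_right_inv
  obtain ⟨r1, hr1⟩ : ∃ r, r = 4 * p * α * t1 := ⟨_, rfl⟩
  obtain ⟨r2, hr2⟩ : ∃ r, r = 4 * p * α * t2 := ⟨_, rfl⟩
  obtain ⟨r3, hr3⟩ : ∃ r, r = 4 * p * α * t3 := ⟨_, rfl⟩
  have hb' : (b : ℤ_[p]) = C 0 1 + n * α * r1 := by rw [ht1, hr1]; ring
  have hc' : (c : ℤ_[p]) = C 0 2 + n * α * r2 := by rw [ht2, hr2]; ring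
  have he' : (e : ℤ_[p]) = β + n * α * r3 := by rw [ht3, hr3]; ring
  obtain ⟨u01, hu01⟩ : ∃ u, u = α * r1 - α * (2 * τ) * C 0 1 := ⟨_, rfl⟩
  obtain ⟨u12, hu12⟩ : ∃ u, u = ε' * n * r3 := ⟨_, rfl⟩
  obtain ⟨u02, hu02⟩ : ∃ u, u = α * r2 + ε' * α * (2 * τ) * C 0 2 - ε' * C 0 1 * r3 := ⟨_, rfl⟩
  let U : Matrix (Fin 3) (Fin 3) ℤ_[p] := !![1, u01, u02; 0, ε, u12; 0, 0, ε']
  have hUd : U.det = 1 := by simp [U, det_fin_three, hε']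
  obtain ⟨N, hN⟩ : ∃ N, N = Uᵀ * C * U := ⟨_, rfl⟩
  have hCN : PadicIsomP p C N := ⟨U, by rw [hUd]; exact isUnit_one, hN.symm⟩
  have n00 : N 0 0 = n := by simp [hN, U, Matrix.mul_apply, Fin.sum_univ_three, hC0]
  have n01 : N 0 1 = n * u01 + ε * C 0 1 := by simp [hN, U, Matrix.mul_apply, Fin.sum_univ_three, hC0]; ring
  have n02 : N 0 2 = n * u02 + C 0 1 * u12 + ε' * C 0 2 := by
    simp [hN, U, Matrix.mul_apply, Fin.sum_univ_three, hC0]; ring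
  have n11 : N 1 1 = n * u01 ^ 2 + 2 * ε * u01 * C 0 1 + ε ^ 2 * C 1 1 := by
    simp [hN, U, Matrix.mul_apply, Fin.sum_univ_three, hC0, s1]; ring
  have n12 : N 1 2 = u01 * (n * u02 + C 0 1 * u12 + C 0 2 * ε') + ε * (C 0 1 * u02 + C 1 1 * u12 + C 1 2 * ε') := by
    simp [hN, U, Matrix.mul_apply, Fin.sum_univ_three, hC0, s1]; ring
  have m01 : N 0 1 = b := by rw [n01, hb', hu01, hε]; ring
  have m02 : N 0 2 = c := by
    rw [n02, hc', hu02, hu12]; linear_combination C 0 2 * hε' - ε' * C 0 2 * hε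
  rw [hC0] at hαd hβd
  refine ⟨N, hMC.trans hCN, ?_, n00, m01, m02, ?_, ?_⟩
  · rw [hN, det_mul, det_mul, det_transpose, hUd, ← hCd]; ring
  · rw [← m01, ← hεα, n11, n01, hαd]; ring
  · have : n * N 1 2 - N 0 1 * N 0 2 = e := by
      rw [n12, n01, n02, he']
      rw [hu12]
      linear_combination (-(ε * ε')) * hβd - (ε * ε' * n * r3) * hαd + (β + α * n * r3) * hε'
    rw [← m01, ← m02]; linear_combination this
end


lemma crt_int (S : Finset ℕ) (hS : ∀ p ∈ S, p.Prime) (k : ℕ → ℕ) (f : ℕ → ℤ) :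
    ∃ z : ℤ, ∀ p ∈ S, (p : ℤ) ^ k p ∣ z - f p := by
  induction S using Finset.induction_on with
  | empty => exact ⟨0, by simp⟩
  | insert q S hq ih =>
    obtain ⟨z, hz⟩ := ih (fun p hp => hS p (Finset.mem_insert_of_mem hp))
    have hqp := hS q (Finset.mem_insert_self _ _)
    have hc : IsCoprime (∏ p ∈ S, (p : ℤ) ^ k p) ((q : ℤ) ^ k q) := by
      apply IsCoprime.prod_left
      intro p hp
      apply IsCoprime.pow
      rw [Nat.isCoprime_iff_coprime]
      rw [Nat.coprime_primes (hS p (Finset.mem_insert_of_mem hp)) hqp]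
      rintro rfl; exact hq hp
    obtain ⟨u, v, huv⟩ := hc
    refine ⟨z + u * (∏ p ∈ S, (p : ℤ) ^ k p) * (f q - z), ?_⟩
    intro p hp
    rcases Finset.mem_insert.mp hp with rfl | hp
    · exact ⟨(z - f p) * v, by linear_combination (f p - z) * huv⟩
    · have h1 : (p : ℤ) ^ k p ∣ ∏ p ∈ S, (p : ℤ) ^ k p := Finset.dvd_prod_of_mem (fun p : ℕ => (p : ℤ) ^ k p) hp
      have h2 := hz p hp
      have : (p : ℤ) ^ k p ∣ (z - f p) + u * (∏ p ∈ S, (p : ℤ) ^ k p) * (f q - z) :=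
        dvd_add h2 (Dvd.dvd.mul_right (Dvd.dvd.mul_left h1 _) _)
      convert this using 1; ring

lemma int_dvd_of_padic {n m : ℤ} (h : ∀ (p : ℕ) (hp : p.Prime), (p : ℤ) ∣ n → haveI : Fact p.Prime := ⟨hp⟩; (n : ℤ_[p]) ∣ (m : ℤ_[p])) :
    n ∣ m := by
  rw [← Int.natAbs_dvd_natAbs, Nat.dvd_iff_prime_pow_dvd_dvd]
  intro p k hp hk
  rcases Nat.eq_zero_or_pos k with rfl | hk0
  · simp
  haveI : Fact p.Prime := ⟨hp⟩
  have h0 : ((p ^ k : ℕ) : ℤ) ∣ n := Int.natCast_dvd.mpr hk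
  have h3 : (p : ℤ) ∣ n := dvd_trans (by push_cast; exact dvd_pow_self _ hk0.ne') h0
  have h1 := h p hp h3
  have h2 : (p : ℤ_[p]) ^ k ∣ (n : ℤ_[p]) := (PadicInt.pow_p_dvd_int_iff k n).mpr (by exact_mod_cast h0)
  have h4 := (PadicInt.pow_p_dvd_int_iff k m).mp (h2.trans h1)
  exact Int.natCast_dvd.mp (by exact_mod_cast h4)

lemma exists_gl (P : ℕ) (hP : 0 < P) (a : ℤ) (B : ℕ) : ∃ g l : ℕ, l.Prime ∧ B < l ∧ 0 < g ∧ g ∣ P ∧ (P : ℤ) ∣ g * l - a := by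
  have hg : 0 < Int.gcd a P := Int.gcd_pos_of_ne_zero_right _ (by exact_mod_cast hP.ne')
  obtain ⟨a', ha'⟩ := Int.gcd_dvd_left a P
  obtain ⟨P', hP'⟩ : Int.gcd a P ∣ P := by exact_mod_cast Int.gcd_dvd_right a P
  have hP0 : P' ≠ 0 := by rintro rfl; simp at hP'; omega
  have hco : IsCoprime a' (P' : ℤ) := by
    have := Int.gcd_eq_gcd_ab a P
    generalize Int.gcd a P = g at *
    refine ⟨Int.gcdA a P, Int.gcdB a P, ?_⟩
    have hg' : (g : ℤ) ≠ 0 := by exact_mod_cast hg.ne'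
    have h2 : (P : ℤ) = g * P' := by exact_mod_cast hP'
    apply mul_left_cancel₀ hg'
    generalize Int.gcdA a P = x at *
    generalize Int.gcdB a P = y at *
    linear_combination (-this) - x * ha' - y * h2
  haveI : NeZero P' := ⟨hP0⟩
  obtain ⟨l, hl, hlp, hle⟩ := Nat.forall_exists_prime_gt_and_zmodEq B hP0 hco
  refine ⟨Int.gcd a P, l, hlp, hl, hg, ⟨P', hP'⟩, ?_⟩
  obtain ⟨w, hw⟩ := hle.symm.dvd
  clear hco
  generalize Int.gcd a P = g at *
  have h2 : (P : ℤ) = g * P' := by exact_mod_cast hP'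
  refine ⟨w, ?_⟩
  linear_combination (g : ℤ) * hw - ha' - w * h2

section
variable {p : ℕ} [hpf : Fact p.Prime]
lemma iso_hil {A : TernMat} (hs : A.IsSymm) (h0 : A 0 0 ≠ 0) (hD : A 0 0 * A 1 1 - A 0 1 ^ 2 ≠ 0) (hd : A.det ≠ 0) :
    hil p (-(A 0 0 * A 1 1 - A 0 1 ^ 2)) (-(A 0 0 * A.det)) = 1 ↔ IsotropicP p A := by
  rw [hil_iff (neg_ne_zero.mpr hD) (neg_ne_zero.mpr (mul_ne_zero h0 hd))]
  unfold IsotropicP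
  rw [iso_diag (padicMat_symm hs) (by rw [padicMat_apply]; exact int_ne h0)
    (by simp only [padicMat_apply]; exact_mod_cast int_ne (p := p) hD)]
  rw [padicMat_det]
  simp only [padicMat_apply]
  push_cast
  rfl

lemma hil_eq_of {A : TernMat} (hs : A.IsSymm) (h0 : A 0 0 ≠ 0) (hD : A 0 0 * A 1 1 - A 0 1 ^ 2 ≠ 0) (hd : A.det ≠ 0)
    {n α : ℤ} (hn : n ≠ 0) (hα : α ≠ 0) {N : Matrix (Fin 3) (Fin 3) ℤ_[p]} (hN : PadicIsomP p (padicMat p A) N)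
    (hNd : N.det = (padicMat p A).det) (hN0 : N 0 0 = n) (hNα : N 0 0 * N 1 1 - N 0 1 ^ 2 = α) :
    hil p (-α) (-(n * A.det)) = hil p (-(A 0 0 * A 1 1 - A 0 1 ^ 2)) (-(A 0 0 * A.det)) := by
  have hi := iso_hil (p := p) hs h0 hD hd
  have h1 := hil_pm hpf.out (neg_ne_zero.mpr hα) (neg_ne_zero.mpr (mul_ne_zero hn hd))
  have h2 := hil_pm hpf.out (neg_ne_zero.mpr hD) (neg_ne_zero.mpr (mul_ne_zero h0 hd))
  have h3 : hil p (-α) (-(n * A.det)) = 1 ↔ IsotropicP p A := by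
    rw [hil_iff (neg_ne_zero.mpr hα) (neg_ne_zero.mpr (mul_ne_zero hn hd))]
    have := iso_diag (hN.symmMat (padicMat_symm hs)) (by rw [hN0]; exact int_ne hn) (by rw [hNα]; exact int_ne hα)
    rw [hNα, hN0, hNd, padicMat_det] at this
    rw [Int.cast_neg, Int.cast_neg, Int.cast_mul, ← this]
    exact ⟨iso_congr hN, iso_congr hN.symm⟩
  rcases h1 with h1 | h1 <;> rcases h2 with h2 | h2 <;> rw [h1] at h3 ⊢ <;> rw [h2] at hi ⊢ <;> simp_all
end

lemma exists_r {A : TernMat} (hA : IsLat A) {n : ℤ} (hn : 0 < n) {S : Finset ℕ}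
    (hS : ∀ q : ℕ, q.Prime → ((q : ℤ) ∣ 2 * n * A.det → q ∈ S))
    {g l : ℕ} (hg : 0 < g) (hgS : ∀ q : ℕ, q.Prime → q ∣ g → q ∈ S) (hl : l.Prime)
    (hl0 : ¬ (l : ℤ) ∣ 2 * n * A.det * A 0 0 * (A 0 0 * A 1 1 - A 0 1 ^ 2) * g)
    (hSh : ∀ p ∈ S, p.Prime → hil p (-((g : ℤ) * l)) (-(n * A.det)) =
      hil p (-(A 0 0 * A 1 1 - A 0 1 ^ 2)) (-(A 0 0 * A.det))) :
    ∃ r : ℤ, (l : ℤ) ∣ r ^ 2 + n * A.det := by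
  have h0 := hA.pos00
  have hD := hA.pos2
  have hd := hA.det_pos
  have hs := hA.1
  have hiso : ∀ (p : ℕ) [Fact p.Prime], hil p (-(A 0 0 * A 1 1 - A 0 1 ^ 2)) (-(A 0 0 * A.det)) = 1 ↔ IsotropicP p A :=
    fun p _ => iso_hil hs h0.ne' hD.ne' hd.ne'
  generalize hDd : A 0 0 * A 1 1 - A 0 1 ^ 2 = D at *
  generalize hdd : A.det = d at *
  generalize hmm : A 0 0 = m at *
  have hl' : (0 : ℤ) < l := by exact_mod_cast hl.pos
  have hg' : (0 : ℤ) < g := by exact_mod_cast hg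
  obtain ⟨α, hα⟩ : ∃ α : ℤ, α = g * l := ⟨_, rfl⟩
  have hα0 : 0 < α := by rw [hα]; positivity
  obtain ⟨T, hT⟩ : ∃ T, T = (2 * n * d * m * D * α).natAbs.primeFactors := ⟨_, rfl⟩
  have hTp : ∀ p ∈ T, p.Prime := by intro p hp; rw [hT] at hp; exact Nat.prime_of_mem_primeFactors hp
  have hTm : ∀ q : ℕ, q.Prime → (q : ℤ) ∣ 2 * n * d * m * D * α → q ∈ T := by
    intro q hq h
    rw [hT, Nat.mem_primeFactors]
    refine ⟨hq, Int.natCast_dvd.mp h, ?_⟩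
    have : 2 * n * d * m * D * α ≠ 0 := by positivity
    exact Int.natAbs_ne_zero.mpr this
  have h2T : 2 ∈ T := hTm 2 Nat.prime_two ⟨n * d * m * D * α, by push_cast; ring⟩
  have hlT : l ∈ T := hTm l hl ⟨2 * n * d * m * D * g, by rw [hα]; ring⟩
  have hnd : 0 < n * d := by positivity
  have hmd : 0 < m * d := by positivity
  have P1 := product_formula hTp h2T (a := -α) (b := -(n * d)) (by omega) (by omega)
    (fun q hq h => hTm q hq (Dvd.dvd.mul_left ((dvd_neg).mp h) _))
    (fun q hq h => hTm q hq (by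
      obtain ⟨w, hw⟩ := dvd_neg.mp h
      exact ⟨2 * w * m * D * α, by linear_combination 2 * m * D * α * hw⟩))
  have P2 := product_formula hTp h2T (a := -D) (b := -(m * d)) (by omega) (by omega)
    (fun q hq h => hTm q hq (by
      obtain ⟨w, hw⟩ := dvd_neg.mp h
      exact ⟨2 * n * d * m * w * α, by linear_combination 2 * n * d * m * α * hw⟩))
    (fun q hq h => hTm q hq (by
      obtain ⟨w, hw⟩ := dvd_neg.mp h
      exact ⟨2 * w * n * D * α, by linear_combination 2 * n * D * α * hw⟩))
  rw [sgnInf, if_pos ⟨by omega, by omega⟩] at P1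
  rw [sgnInf, if_pos ⟨by omega, by omega⟩] at P2
  rw [← Finset.mul_prod_erase T _ hlT] at P1 P2
  have hE : ∏ p ∈ T.erase l, hil p (-α) (-(n * d)) = ∏ p ∈ T.erase l, hil p (-D) (-(m * d)) := by
    apply Finset.prod_congr rfl
    intro p hp
    obtain ⟨hpl, hpT⟩ := Finset.mem_erase.mp hp
    have hpp := hTp p hpT
    by_cases hpS : p ∈ S
    · rw [hα]; exact hSh p hpS hpp
    haveI : Fact p.Prime := ⟨hpp⟩
    have hpn : ¬ (p : ℤ) ∣ 2 * n * d := fun h => hpS (hS p hpp h)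
    have hp2 : p ≠ 2 := by rintro rfl; exact hpn ⟨n * d, by push_cast; ring⟩
    have hnd' : ¬ (p : ℤ) ∣ -(n * d) := by
      rw [dvd_neg]; rintro ⟨w, hw⟩; exact hpn ⟨2 * w, by linear_combination 2 * hw⟩
    have hdd' : ¬ (p : ℤ) ∣ d := by
      rintro ⟨w, hw⟩; exact hpn ⟨2 * w * n, by linear_combination 2 * n * hw⟩
    rw [hil_unit hpp hp2 _ hnd']
    · symm
      rw [hiso p]
      obtain ⟨x, i, hi, hx⟩ := unimod_isotropic hp2 (padicMat_symm (p := p) hs) (by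
        rw [padicMat_det, hdd]; exact int_unit hdd')
      refine ⟨x, ?_, hx⟩
      rintro rfl
      simp at hi
    · rw [dvd_neg, hα]
      intro h
      rcases (Nat.prime_iff_prime_int.mp hpp).dvd_or_dvd h with h | h
      · exact hpS (hgS p hpp (by exact_mod_cast h))
      · exact prime_not_dvd hpp hl hpl h
  rw [hE] at P1
  have hne : ∏ p ∈ T.erase l, hil p (-D) (-(m * d)) ≠ 0 := by
    intro h; rw [h] at P1; simp at P1
  have hl2 : l ≠ 2 := by rintro rfl; exact hl0 ⟨n * d * m * D * g, by push_cast; ring⟩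
  have hlnd : ¬ (l : ℤ) ∣ -(n * d) := by
    rw [dvd_neg]; rintro ⟨w, hw⟩; exact hl0 ⟨2 * w * m * D * g, by linear_combination 2 * m * D * g * hw⟩
  have hlD : ¬ (l : ℤ) ∣ -D := by
    rw [dvd_neg]; rintro ⟨w, hw⟩; exact hl0 ⟨2 * n * d * m * w * g, by linear_combination 2 * n * d * m * g * hw⟩
  have hlmd : ¬ (l : ℤ) ∣ -(m * d) := by
    rw [dvd_neg]; rintro ⟨w, hw⟩; exact hl0 ⟨2 * w * n * D * g, by linear_combination 2 * n * D * g * hw⟩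
  have hlg : ¬ (l : ℤ) ∣ -(g : ℤ) := by
    rw [dvd_neg]; intro h; exact hl0 (Dvd.dvd.mul_left h _)
  rw [hil_unit hl hl2 hlD hlmd] at P2
  have hk : hil l (-α) (-(n * d)) = 1 := by
    apply mul_right_cancel₀ hne
    linear_combination P2 - P1
  haveI : Fact l.Prime := ⟨hl⟩
  have e1 : -α = l * (-(g : ℤ)) := by rw [hα]; ring
  rw [e1, hil_prime_mul hl2 hlg hlnd] at hk
  have hsq := ZMod.isSquare_of_jacobiSym_eq_one hk
  obtain ⟨s, hs⟩ := hsq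
  obtain ⟨r, rfl⟩ := ZMod.intCast_surjective s
  refine ⟨r, ?_⟩
  rw [← Int.cast_mul, ZMod.intCast_eq_intCast_iff_dvd_sub] at hs
  convert hs using 1; ring


theorem global_prim {A : TernMat} (hA : IsLat A) {n : ℤ} (hn : 0 < n)
    (hloc : ∀ (p : ℕ) (hp : p.Prime), haveI : Fact p.Prime := ⟨hp⟩
      ∃ (x : Fin 3 → ℤ_[p]) (i : Fin 3), IsUnit (x i) ∧ quadVal (padicMat p A) x = (n : ℤ_[p])) :
    ∃ C : TernMat, InGenus A C ∧ C 0 0 = n := by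
  have h0 := hA.pos00
  have hD := hA.pos2
  have hd := hA.det_pos
  have hs := hA.1
  have hg0 : ∀ p : ℕ, ∃ (k : ℕ) (b0 c0 e0 a0 : ℤ), ∀ (hp : p.Prime), haveI : Fact p.Prime := ⟨hp⟩
      ∀ b c e a : ℤ, (p : ℤ) ^ k ∣ b - b0 → (p : ℤ) ^ k ∣ c - c0 →
      (p : ℤ) ^ k ∣ e - e0 → (p : ℤ) ^ k ∣ a - a0 →
      ∃ N : Matrix (Fin 3) (Fin 3) ℤ_[p], PadicIsomP p (padicMat p A) N ∧ N.det = (padicMat p A).det ∧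
        N 0 0 = (n : ℤ_[p]) ∧ N 0 1 = b ∧ N 0 2 = c ∧
        (n : ℤ_[p]) * N 1 1 = a + b ^ 2 ∧ (n : ℤ_[p]) * N 1 2 = e + b * c := by
    intro p
    by_cases hp : p.Prime
    · haveI : Fact p.Prime := ⟨hp⟩
      obtain ⟨x, i, hi, hx⟩ := hloc p hp
      obtain ⟨k, b0, c0, e0, a0, h⟩ := local_good (padicMat_symm hs)
        (by rw [padicMat_det]; exact int_ne hd.ne') (int_ne hn.ne') hi hx
      exact ⟨k, b0, c0, e0, a0, fun _ => h⟩
    · exact ⟨0, 0, 0, 0, 0, fun h => absurd h hp⟩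
  choose k b0 c0 e0 a0 hgood using hg0
  obtain ⟨S, hSd⟩ : ∃ S, S = (2 * n * A.det).natAbs.primeFactors := ⟨_, rfl⟩
  have hSp : ∀ p ∈ S, p.Prime := by intro p hp; rw [hSd] at hp; exact Nat.prime_of_mem_primeFactors hp
  have hS0 : 2 * n * A.det ≠ 0 := by positivity
  have hS : ∀ q : ℕ, q.Prime → (q : ℤ) ∣ 2 * n * A.det → q ∈ S := by
    intro q hq h
    rw [hSd, Nat.mem_primeFactors]
    exact ⟨hq, Int.natCast_dvd.mp h, Int.natAbs_ne_zero.mpr hS0⟩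
  have hSm : ∀ q ∈ S, (q : ℤ) ∣ 2 * n * A.det := by
    intro q hq; rw [hSd, Nat.mem_primeFactors] at hq; exact Int.natCast_dvd.mpr hq.2.1
  obtain ⟨b, hb⟩ := crt_int S hSp k b0
  obtain ⟨c, hc⟩ := crt_int S hSp k c0
  obtain ⟨a, ha⟩ := crt_int S hSp k a0
  obtain ⟨P, hPd⟩ : ∃ P : ℕ, P = ∏ p ∈ S, p ^ k p := ⟨_, rfl⟩
  have hP0 : 0 < P := by rw [hPd]; exact Finset.prod_pos (fun p hp => pow_pos (hSp p hp).pos _)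
  have hPS : ∀ p ∈ S, (p : ℤ) ^ k p ∣ (P : ℤ) := by
    intro p hp; rw [hPd]; exact_mod_cast Finset.dvd_prod_of_mem (fun p : ℕ => p ^ k p) hp
  obtain ⟨g, l, hl, hlB, hg, hgP, hgl⟩ := exists_gl P hP0 a
    (2 * n * A.det * A 0 0 * (A 0 0 * A 1 1 - A 0 1 ^ 2) * P).natAbs
  have hl0' : ¬ (l : ℤ) ∣ 2 * n * A.det * A 0 0 * (A 0 0 * A 1 1 - A 0 1 ^ 2) * P := by
    intro h
    have hP0' : (0 : ℤ) < P := by exact_mod_cast hP0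
    have h1 := Nat.le_of_dvd (Int.natAbs_pos.mpr (by positivity)) (Int.natCast_dvd.mp h)
    omega
  have hl0 : ¬ (l : ℤ) ∣ 2 * n * A.det * A 0 0 * (A 0 0 * A 1 1 - A 0 1 ^ 2) * g := by
    intro h; apply hl0'
    exact h.trans (mul_dvd_mul_left _ (by exact_mod_cast hgP))
  have hgS : ∀ q : ℕ, q.Prime → q ∣ g → q ∈ S := by
    intro q hq h
    have h1 := h.trans hgP
    rw [hPd, hq.prime.dvd_finsetProd_iff] at h1
    obtain ⟨r, hr, h2⟩ := h1
    have := (Nat.prime_dvd_prime_iff_eq hq (hSp r hr)).mp (hq.dvd_of_dvd_pow h2)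
    rwa [this]
  have hl' : (0 : ℤ) < l := by exact_mod_cast hl.pos
  have hg' : (0 : ℤ) < g := by exact_mod_cast hg
  have hα0 : (0 : ℤ) < g * l := by positivity
  have haS : ∀ p ∈ S, (p : ℤ) ^ k p ∣ (g : ℤ) * l - a0 p := by
    intro p hp
    have e : (g : ℤ) * l - a0 p = (g * l - a) + (a - a0 p) := by ring
    rw [e]; exact dvd_add ((hPS p hp).trans hgl) (ha p hp)
  have hSh : ∀ p ∈ S, p.Prime → hil p (-((g : ℤ) * l)) (-(n * A.det)) =
      hil p (-(A 0 0 * A 1 1 - A 0 1 ^ 2)) (-(A 0 0 * A.det)) := by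
    intro p hp hpp
    haveI : Fact p.Prime := ⟨hpp⟩
    obtain ⟨N, hN, hNd, hN0, hN1, hN2, hN3, hN4⟩ := hgood p hpp b c (e0 p) (g * l) (hb p hp) (hc p hp) (by simp) (haS p hp)
    exact hil_eq_of hs h0.ne' hD.ne' hd.ne' hn.ne' hα0.ne' hN hNd hN0
      (by rw [hN0, hN1]; linear_combination hN3)
  obtain ⟨r, hr⟩ := exists_r hA hn hS hg hgS hl hl0 hSh
  have hlS : l ∉ S := by
    intro h
    exact hl0 (Dvd.dvd.mul_right (Dvd.dvd.mul_right (Dvd.dvd.mul_right (hSm l h) _) _) _)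
  obtain ⟨β, hβ⟩ := crt_int (insert l S) (by
    intro p hp
    rcases Finset.mem_insert.mp hp with rfl | hp
    · exact hl
    · exact hSp p hp) (fun q => if q = l then 1 else k q) (fun q => if q = l then r else e0 q)
  have hβl : (l : ℤ) ∣ β - r := by simpa using hβ l (Finset.mem_insert_self _ _)
  have hβS : ∀ p ∈ S, (p : ℤ) ^ k p ∣ β - e0 p := by
    intro p hp
    have h := hβ p (Finset.mem_insert_of_mem hp)
    have hpl : p ≠ l := by rintro rfl; exact hlS hp
    simpa [hpl] using h
  clear hβ hSh
  obtain ⟨α, hα⟩ : ∃ α : ℤ, α = g * l := ⟨_, rfl⟩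
  rw [← hα] at haS hα0
  obtain ⟨d, hdd⟩ : ∃ d : ℤ, d = A.det := ⟨_, rfl⟩
  rw [← hdd] at hr hd hS0 hS hSm
  have hlβ : (l : ℤ) ∣ β ^ 2 + n * d := by
    obtain ⟨w, hw⟩ := hβl
    obtain ⟨v, hv⟩ := hr
    exact ⟨v + w * (β + r), by linear_combination hv + (β + r) * hw⟩
  have hN : ∀ p ∈ S, ∀ hp : p.Prime, haveI : Fact p.Prime := ⟨hp⟩
      ∃ N : Matrix (Fin 3) (Fin 3) ℤ_[p], PadicIsomP p (padicMat p A) N ∧ N.IsSymm ∧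
        N 0 0 = (n : ℤ_[p]) ∧ N 0 1 = b ∧ N 0 2 = c ∧
        (n : ℤ_[p]) * N 1 1 = α + b ^ 2 ∧ (n : ℤ_[p]) * N 1 2 = β + b * c ∧
        (n : ℤ_[p]) * α * N 2 2 = n * d + β ^ 2 + α * c ^ 2 := by
    intro p hpS hp
    haveI : Fact p.Prime := ⟨hp⟩
    obtain ⟨N, hN, hNd, hN0, hN1, hN2, hN3, hN4⟩ := hgood p hp b c β α (hb p hpS) (hc p hpS) (hβS p hpS) (haS p hpS)
    have hNs := hN.symmMat (padicMat_symm hs)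
    refine ⟨N, hN, hNs, hN0, hN1, hN2, hN3, hN4, ?_⟩
    rw [det_expand N hNs, padicMat_det, ← hdd, hN0, hN1, hN2] at hNd
    generalize N 1 1 = u at *
    generalize N 1 2 = v at *
    generalize N 2 2 = w at *
    linear_combination (n : ℤ_[p]) * hNd - (n * w - c ^ 2) * hN3 + (n * v - b * c + β) * hN4
  have d1 : n ∣ α + b ^ 2 := by
    apply int_dvd_of_padic
    intro p hp hpn
    haveI : Fact p.Prime := ⟨hp⟩
    obtain ⟨N, hN, hNs, hN0, hN1, hN2, hN3, hN4, hN5⟩ := hN p (hS p hp (Dvd.dvd.mul_right (Dvd.dvd.mul_left hpn _) _)) hp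
    exact ⟨N 1 1, by push_cast; exact hN3.symm⟩
  have d2 : n ∣ β + b * c := by
    apply int_dvd_of_padic
    intro p hp hpn
    haveI : Fact p.Prime := ⟨hp⟩
    obtain ⟨N, hN, hNs, hN0, hN1, hN2, hN3, hN4, hN5⟩ := hN p (hS p hp (Dvd.dvd.mul_right (Dvd.dvd.mul_left hpn _) _)) hp
    exact ⟨N 1 2, by push_cast; exact hN4.symm⟩
  have d3 : n * α ∣ n * d + β ^ 2 + α * c ^ 2 := by
    apply int_dvd_of_padic
    intro p hp hpn
    haveI : Fact p.Prime := ⟨hp⟩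
    by_cases hpS : p ∈ S
    · obtain ⟨N, hN, hNs, hN0, hN1, hN2, hN3, hN4, hN5⟩ := hN p hpS hp
      exact ⟨N 2 2, by push_cast; exact hN5.symm⟩
    · have hpn' : ¬ (p : ℤ) ∣ n := fun h => hpS (hS p hp (Dvd.dvd.mul_right (Dvd.dvd.mul_left h _) _))
      have hpg : ¬ (p : ℤ) ∣ g := fun h => hpS (hgS p hp (by exact_mod_cast h))
      have hpl : p = l := by
        rcases (Nat.prime_iff_prime_int.mp hp).dvd_or_dvd hpn with h | h
        · exact absurd h hpn'
        · rw [hα] at h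
          rcases (Nat.prime_iff_prime_int.mp hp).dvd_or_dvd h with h | h
          · exact absurd h hpg
          · by_contra hne; exact prime_not_dvd hp hl hne h
      subst hpl
      have hu : IsUnit ((n * g : ℤ) : ℤ_[p]) := by
        apply int_unit
        intro h
        rcases (Nat.prime_iff_prime_int.mp hp).dvd_or_dvd h with h | h
        · exact hpn' h
        · exact hpg h
      obtain ⟨w, hw⟩ := hlβ
      have e1 : ((n * α : ℤ) : ℤ_[p]) = ((n * g : ℤ) : ℤ_[p]) * (p : ℤ_[p]) := by rw [hα]; push_cast; ring
      have e2 : n * d + β ^ 2 + α * c ^ 2 = p * (w + g * c ^ 2) := by rw [hα]; linear_combination hw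
      rw [e1, hu.mul_left_dvd, e2]
      exact ⟨((w + g * c ^ 2 : ℤ) : ℤ_[p]), by push_cast; ring⟩
  obtain ⟨u, hu⟩ := d1
  obtain ⟨v, hv⟩ := d2
  obtain ⟨w, hw⟩ := d3
  obtain ⟨C, hC⟩ : ∃ C : TernMat, C = !![n, b, c; b, u, v; c, v, w] := ⟨_, rfl⟩
  have c00 : C 0 0 = n := by rw [hC]; rfl
  have c01 : C 0 1 = b := by rw [hC]; rfl
  have c02 : C 0 2 = c := by rw [hC]; rfl
  have c11 : C 1 1 = u := by rw [hC]; rfl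
  have c12 : C 1 2 = v := by rw [hC]; rfl
  have c22 : C 2 2 = w := by rw [hC]; rfl
  have hCs : C.IsSymm := by
    rw [hC]; apply Matrix.IsSymm.ext; intro i j
    fin_cases i <;> fin_cases j <;> rfl
  have hCd : C.det = d := by
    rw [det_expand C hCs, c00, c01, c02, c11, c12, c22]
    apply mul_left_cancel₀ hn.ne'
    linear_combination (-(n * w - c ^ 2)) * hu + (n * v - b * c + β) * hv - hw
  have hCL : IsLat C := by
    apply isLat_of_minors hCs
    · rw [c00]; exact hn
    · rw [c00, c01, c11, ← hu]; linarith
    · rw [hCd]; exact hd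
  refine ⟨C, ⟨hCL, ?_⟩, c00⟩
  intro p hp
  haveI : Fact p.Prime := ⟨hp⟩
  show PadicIsomP p (padicMat p A) (padicMat p C)
  by_cases hpS : p ∈ S
  · obtain ⟨N, hNi, hNs, hN0, hN1, hN2, hN3, hN4, hN5⟩ := hN p hpS hp
    have hn' : (n : ℤ_[p]) ≠ 0 := int_ne hn.ne'
    have hα' : (α : ℤ_[p]) ≠ 0 := int_ne hα0.ne'
    have e11 : N 1 1 = (u : ℤ_[p]) := by
      apply mul_left_cancel₀ hn'; rw [hN3]; exact_mod_cast congrArg (Int.cast : ℤ → ℤ_[p]) hu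
    have e12 : N 1 2 = (v : ℤ_[p]) := by
      apply mul_left_cancel₀ hn'; rw [hN4]; exact_mod_cast congrArg (Int.cast : ℤ → ℤ_[p]) hv
    have e22 : N 2 2 = (w : ℤ_[p]) := by
      apply mul_left_cancel₀ (mul_ne_zero hn' hα'); rw [hN5]; exact_mod_cast congrArg (Int.cast : ℤ → ℤ_[p]) hw
    have : padicMat p C = N := by
      have s1 := hNs.apply 0 1
      have s2 := hNs.apply 0 2
      have s3 := hNs.apply 1 2
      ext i j
      rw [padicMat_apply, hC]
      have i3 : i = 0 ∨ i = 1 ∨ i = 2 := by fin_cases i <;> simp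
      have j3 : j = 0 ∨ j = 1 ∨ j = 2 := by fin_cases j <;> simp
      rcases i3 with rfl | rfl | rfl <;> rcases j3 with rfl | rfl | rfl <;> simp [s1, s2, s3, hN0, hN1, hN2, e11, e12, e22]
    rw [this]; exact hNi
  · have hpn : ¬ (p : ℤ) ∣ 2 * n * d := fun h => hpS (hS p hp h)
    have hp2 : p ≠ 2 := by rintro rfl; exact hpn ⟨n * d, by push_cast; ring⟩
    apply unimod_class hp2 (padicMat_symm hs) (padicMat_symm hCs)
    · rw [padicMat_det, ← hdd]; exact int_unit (fun h => hpn (Dvd.dvd.mul_left h _))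
    · rw [padicMat_det, padicMat_det, hCd, hdd]


theorem global_rep {A : TernMat} (hA : IsLat A) : ∀ n : ℕ, 0 < n → LocallyRepresented n A →
    ∃ C : TernMat, InGenus A C ∧ ∃ x : Fin 3 → ℤ, quadVal C x = n := by
  intro n
  induction n using Nat.strong_induction_on with
  | _ n ih =>
  intro hn hloc
  by_cases hprim : ∀ (p : ℕ) (hp : p.Prime), haveI : Fact p.Prime := ⟨hp⟩
      ∃ (x : Fin 3 → ℤ_[p]) (i : Fin 3), IsUnit (x i) ∧ quadVal (padicMat p A) x = ((n : ℤ) : ℤ_[p])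
  · obtain ⟨C, hC, hC0⟩ := global_prim hA (by exact_mod_cast hn : (0 : ℤ) < n) hprim
    refine ⟨C, hC, ![1, 0, 0], ?_⟩
    rw [quadVal_expand C hC.1.1]
    simp [hC0]
  · push Not at hprim
    obtain ⟨p, hp, hno⟩ := hprim
    haveI : Fact p.Prime := ⟨hp⟩
    obtain ⟨x, hx⟩ := hloc p hp
    have hdv : ∀ i, ∃ y, x i = (p : ℤ_[p]) * y := by
      intro i
      have : ¬ IsUnit (x i) := fun h => hno x i h hx
      exact nonunit_iff.mp this
    choose y hy using hdv
    have hxy : x = (p : ℤ_[p]) • y := by funext i; rw [hy i]; rfl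
    rw [hxy, quadVal_smul] at hx
    have h1 : (p : ℤ_[p]) ^ 2 ∣ ((n : ℤ) : ℤ_[p]) := ⟨_, hx.symm⟩
    rw [PadicInt.pow_p_dvd_int_iff] at h1
    obtain ⟨m, hm⟩ : p ^ 2 ∣ n := by exact_mod_cast h1
    have hm0 : 0 < m := by rcases Nat.eq_zero_or_pos m with rfl | h; · simp at hm; omega
                           · exact h
    have hmn : m < n := by
      rw [hm]
      have := hp.two_le
      have h4 : 4 ≤ p ^ 2 := by nlinarith
      nlinarith
    have hp0 : (p : ℤ_[p]) ≠ 0 := by exact_mod_cast hp.ne_zero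
    have hml : LocallyRepresented m A := by
      intro q hq
      by_cases hqp : q = p
      · subst hqp
        refine ⟨y, ?_⟩
        apply mul_left_cancel₀ (pow_ne_zero 2 hp0)
        refine hx.trans ?_
        rw [hm]; push_cast; ring
      · haveI : Fact q.Prime := ⟨hq⟩
        obtain ⟨z, hz⟩ := hloc q hq
        have hu : IsUnit (((p : ℤ)) : ℤ_[q]) := int_unit (prime_not_dvd hq hp hqp)
        obtain ⟨u, hu⟩ := hu.exists_right_inv
        refine ⟨u • z, ?_⟩
        rw [quadVal_smul]
        refine (congrArg (u ^ 2 * ·) hz).trans ?_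
        rw [hm]
        push_cast at hu ⊢
        linear_combination (m : ℤ_[q]) * (p * u + 1) * hu
    obtain ⟨C, hC, z, hz⟩ := ih m hmn hm0 hml
    refine ⟨C, hC, (p : ℤ) • z, ?_⟩
    rw [quadVal_smul, hz, hm]; push_cast; ring

lemma sum_pos_of_rep {A : TernMat} {ι : Type*} [Fintype ι] {E : ι → TernMat} (hE : RepSys (InGenus A) E)
    {n : ℤ} {C : TernMat} (hC : InGenus A C) {x : Fin 3 → ℤ} (hx : quadVal C x = n) :
    (0 : ℝ) < ∑ c, (rRep n (E c) : ℝ) / (numAut (E c) : ℝ) := by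
  obtain ⟨i, hi⟩ := hE.2.1 C hC
  apply Finset.sum_pos'
  · intro c _; positivity
  · refine ⟨i, Finset.mem_univ _, ?_⟩
    have h1 := numAut_pos (hE.1 i).1
    have h2 : 0 < rRep n (E i) := by
      rw [rRep_congr n hi]
      have : Finite {x : Fin 3 → ℤ // quadVal C x = n} := hC.1.finite_eq n
      have : Nonempty {x : Fin 3 → ℤ // quadVal C x = n} := ⟨⟨x, hx⟩⟩
      exact Nat.card_pos
    positivity

/-- comparison with class numbers -/
lemma rho_H {d : ℤ} {R ρ e : ℤ → ℝ} (hd : ¬ 2 ∣ d)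
    (h : ∀ m : ℤ, 2 * e m = R m + 2 * ρ m ∧ R (4 * m) = 3 * R m - 2 * ρ m ∧ ρ (4 * m) = R m ∧
    (¬ 4 ∣ m → ¬ 4 ∣ d * m + 1 → ρ m = 0) ∧ (4 ∣ d * m + 1 → ¬ 8 ∣ d * m + 1 → R m = 4 * ρ m) ∧
    (8 ∣ d * m + 1 → R m = 2 * ρ m)) {f : ℕ} (hf : ¬ 2 ∣ f) :
    ∀ m : ℕ, 0 < m → ∀ M : ℕ, d * m = M * (f : ℤ) ^ 2 →
      ρ m * (hurwitzNat (4 * M) : ℝ) = R m * (hurwitzNat M : ℝ) := by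
  have hf8 : ((f : ℤ) ^ 2) % 8 = 1 := by
    have : (f : ℤ) % 8 = 1 ∨ (f : ℤ) % 8 = 3 ∨ (f : ℤ) % 8 = 5 ∨ (f : ℤ) % 8 = 7 := by omega
    rcases this with h | h | h | h <;> simp [pow_two, Int.mul_emod, h]
  obtain ⟨t, ht⟩ : ∃ t : ℤ, (f : ℤ) ^ 2 = 8 * t + 1 := ⟨(f : ℤ) ^ 2 / 8, by omega⟩
  intro m
  induction m using Nat.strong_induction_on with
  | _ m ih =>
  intro hm M hM
  have hM8 : d * m = M + 8 * (M * t) := by rw [hM, ht]; ring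
  by_cases h4 : 4 ∣ m
  · obtain ⟨m', rfl⟩ := h4
    have h4M : 4 ∣ M := by
      have : (4 : ℤ) ∣ M + 8 * (M * t) := ⟨d * m', by rw [← hM8]; push_cast; ring⟩
      omega
    obtain ⟨M', rfl⟩ := h4M
    have hM' : d * m' = M' * (f : ℤ) ^ 2 := by push_cast at hM; linarith
    have hm' : 0 < m' := by omega
    have hi := ih m' (by omega) hm' M' hM'
    have hM0 : 0 < M' := by
      rcases Nat.eq_zero_or_pos M' with rfl | h
      · simp at hM'
        rcases hM' with rfl | rfl
        · simp at hd
        · omega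
      · exact h
    obtain ⟨_, g1, g2, _⟩ := h m'
    have e1 : ((4 * m' : ℕ) : ℤ) = 4 * (m' : ℤ) := by push_cast; ring
    have e2 : 4 * (4 * M') = 16 * M' := by ring
    rw [e1, g1, g2, e2, H_rec0 M' hM0]
    push_cast
    linear_combination 2 * hi
  · obtain ⟨_, _, _, g3, g4, g5⟩ := h m
    have h4' : ¬ (4 : ℤ) ∣ m := by omega
    by_cases k1 : (8 : ℤ) ∣ d * m + 1
    · rw [H_rec7 M (by omega), g5 k1]; push_cast; ring
    by_cases k2 : (4 : ℤ) ∣ d * m + 1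
    · rw [H_rec3 M (by omega), g4 k2 k1]; push_cast; ring
    · rw [g3 h4' k2]
      have : ¬ (4 : ℤ) ∣ d * m := by
        intro h
        apply h4'
        have hc : IsCoprime (4 : ℤ) d := by
          rw [show (4 : ℤ) = 2 ^ 2 by norm_num]
          exact IsCoprime.pow_left ((Int.prime_two.coprime_iff_not_dvd).mpr hd)
        exact hc.dvd_of_dvd_mul_left h
      rw [H_zero M (by omega)]; simp

lemma R_H {d : ℤ} {R ρ e : ℤ → ℝ} (hd : ¬ 2 ∣ d)
    (h : ∀ m : ℤ, 2 * e m = R m + 2 * ρ m ∧ R (4 * m) = 3 * R m - 2 * ρ m ∧ ρ (4 * m) = R m ∧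
    (¬ 4 ∣ m → ¬ 4 ∣ d * m + 1 → ρ m = 0) ∧ (4 ∣ d * m + 1 → ¬ 8 ∣ d * m + 1 → R m = 4 * ρ m) ∧
    (8 ∣ d * m + 1 → R m = 2 * ρ m)) {f : ℕ} (hf : ¬ 2 ∣ f) (m : ℕ) (hm : 0 < m) (M : ℕ) (hM0 : 0 < M)
    (hM : d * m = M * (f : ℤ) ^ 2) :
      R (4 * m) * (hurwitzNat (4 * M) : ℝ) = R m * (hurwitzNat (16 * M) : ℝ) := by
  have := rho_H hd h hf m hm M hM
  rw [(h m).2.1, H_rec0 M hM0]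
  push_cast
  linear_combination (-2) * this

lemma hur_int {K : ℕ} {x : ℚ} (h : x = K) : hurwitz x = hurwitzNat K := by
  rw [h]; simp [hurwitz]

lemma hur_args {d : ℤ} {m f : ℕ} (hd : 0 < d) (hm : 0 < m) (hf0 : 0 < f) (hf : ¬ 2 ∣ f)
    (h : hurwitz ((4 * (d : ℚ) * (m : ℚ)) / (f : ℚ) ^ 2) ≠ 0) :
    ∃ M : ℕ, 0 < M ∧ d * m = M * (f : ℤ) ^ 2 ∧
      hurwitz ((16 * (d : ℚ) * (m : ℚ)) / (f : ℚ) ^ 2) = hurwitzNat (16 * M) ∧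
      hurwitz ((4 * (d : ℚ) * (m : ℚ)) / (f : ℚ) ^ 2) = hurwitzNat (4 * M) ∧
      hurwitz (((d : ℚ) * (m : ℚ)) / (f : ℚ) ^ 2) = hurwitzNat M := by
  have hfq : (f : ℚ) ^ 2 ≠ 0 := by positivity
  have h1 : ∃ K : ℤ, (4 * (d : ℚ) * (m : ℚ)) / (f : ℚ) ^ 2 = K := by
    unfold hurwitz at h
    split_ifs at h with hc
    · exact ⟨_, ((Rat.den_eq_one_iff _).mp hc.1).symm⟩
    · simp at h
  obtain ⟨K, hK⟩ := h1
  rw [div_eq_iff hfq] at hK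
  have hK' : 4 * d * m = K * (f : ℤ) ^ 2 := by exact_mod_cast hK
  have hc : IsCoprime (4 : ℤ) ((f : ℤ) ^ 2) := by
    rw [show (4 : ℤ) = 2 ^ 2 by norm_num]
    exact IsCoprime.pow ((Int.prime_two.coprime_iff_not_dvd).mpr (by omega))
  have h4K : (4 : ℤ) ∣ K := hc.dvd_of_dvd_mul_right ⟨d * m, by rw [← hK']; ring⟩
  obtain ⟨J, rfl⟩ := h4K
  have hJ : d * m = J * (f : ℤ) ^ 2 := by linarith
  have hJ0 : 0 < J := by
    have h1 : 0 < d * m := by positivity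
    rw [hJ] at h1
    have h2 : (0 : ℤ) < (f : ℤ) ^ 2 := by positivity
    exact pos_of_mul_pos_left h1 h2.le
  obtain ⟨M, rfl⟩ := Int.eq_ofNat_of_zero_le hJ0.le
  have hq : (d : ℚ) * m = M * (f : ℚ) ^ 2 := by exact_mod_cast hJ
  refine ⟨M, by exact_mod_cast hJ0, hJ, hur_int ?_, hur_int ?_, hur_int ?_⟩
  · rw [div_eq_iff hfq]; push_cast; linear_combination 16 * hq
  · rw [div_eq_iff hfq]; push_cast; linear_combination 4 * hq
  · rw [div_eq_iff hfq]; exact hq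


lemma aniso_H : ∀ M : ℕ, 0 < M → (¬ ∃ t : ℤ_[2], t ^ 2 = ((-(M : ℤ) : ℤ) : ℤ_[2])) → hurwitzNat (4 * M) ≠ 0 →
    hurwitzNat (4 * M) - 2 * hurwitzNat M ≠ 0 := by
  intro M
  induction M using Nat.strong_induction_on with
  | _ M ih =>
  intro hM ht hH
  by_cases h4 : 4 ∣ M
  · obtain ⟨M', rfl⟩ := h4
    have e2 : 4 * (4 * M') = 16 * M' := by ring
    have hM' : 0 < M' := by omega
    rw [e2, H_rec0 M' hM'] at hH ⊢
    by_cases hz : hurwitzNat (4 * M') = 0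
    · have h1 := H_nonneg M'
      have h2 := H_nonneg (16 * M')
      rw [H_rec0 M' hM', hz] at h2
      rw [hz] at hH
      exfalso; apply hH; linarith
    · have := ih M' (by omega) hM' (by
        rintro ⟨t, h⟩
        apply ht
        refine ⟨2 * t, ?_⟩
        rw [mul_pow, h]; push_cast; ring) hz
      intro h; apply this; linarith
  · have h8 : M % 4 = 1 ∨ M % 4 = 2 ∨ M % 8 = 3 ∨ M % 8 = 7 := by omega
    rcases h8 with h | h | h | h
    · rw [H_zero M (Or.inl h)]; simpa using hH
    · rw [H_zero M (Or.inr h)]; simpa using hH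
    · rw [H_rec3 M h] at hH ⊢
      intro h0; apply hH; linarith
    · exact absurd (sqrt_two (v := -(M : ℤ)) (by omega)) ht

lemma aniso_nosq {A : TernMat} (hA : IsLat A) (ha : ¬ IsotropicP 2 A) {n : ℤ} (hn : 0 < n)
    {x : Fin 3 → ℤ_[2]} (hx : quadVal (padicMat 2 A) x = (n : ℤ_[2])) :
    ¬ ∃ t : ℤ_[2], t ^ 2 = ((-(A.det * n) : ℤ) : ℤ_[2]) := by
  rintro ⟨t, ht⟩
  apply ha
  have hn' : (n : ℤ_[2]) ≠ 0 := int_ne hn.ne'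
  have hx0 : x ≠ 0 := by
    rintro rfl
    apply hn'
    rw [← hx]; simp [quadVal]
  obtain ⟨y, i, hyi, c, hc, rfl⟩ := exists_primitive hx0
  rw [quadVal_smul] at hx
  have hq : quadVal (padicMat 2 A) y ≠ 0 := by
    intro h; rw [h] at hx; apply hn'; rw [← hx]; ring
  have hs := padicMat_symm (p := 2) hA.1
  obtain ⟨N, hN, hNd, hN0, hNα⟩ := local_shape hs (by rw [padicMat_det]; exact int_ne hA.det_pos.ne') hq
    (i := i) (by rw [hyi]; exact isUnit_one) rfl
  apply iso_congr hN
  rw [iso_diag (hN.symmMat hs) (by rw [hN0]; exact hq) hNα]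
  refine ⟨0, c, t, by simp [hc], ?_⟩
  rw [ht, hN0, hNd, padicMat_det]
  rw [Int.cast_neg, Int.cast_mul]
  linear_combination (-(A.det : ℤ_[2])) * hx

lemma aniso_rRep {B : TernMat} (hB : IsLat B) (hod : ¬ 2 ∣ B.det) (ha : ¬ IsotropicP 2 B) (n : ℤ) :
    rRep (4 * n) B = rRep n B := by
  have key : ∀ x : Fin 3 → ℤ, 4 ∣ quadVal B x → ∀ i, 2 ∣ x i := by
    intro x hx i
    by_contra hi
    obtain ⟨C, hC, hCn⟩ := exists_normL hB.1 hod hi hx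
    apply ha
    apply iso_congr (LatIsom.padicP hC)
    apply iso_congr hCn.nf
    refine ⟨![1, 0, 0], ?_, ?_⟩
    · intro h; have := congrFun h 0; simp at this
    · simp [quadVal, Fin.sum_univ_three]
  unfold rRep
  symm
  refine Nat.card_congr (Equiv.ofBijective (fun x => ⟨(2 : ℤ) • x.1, by rw [quadVal_smul, x.2]; ring⟩) ⟨?_, ?_⟩)
  · intro x y h
    simp only [Subtype.mk.injEq] at h
    apply Subtype.ext
    funext i
    have := congrFun h i
    simp only [Pi.smul_apply, smul_eq_mul] at this
    omega
  · rintro ⟨x, hx⟩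
    have h2 := key x ⟨n, hx⟩
    choose y hy using h2
    have hxy : x = (2 : ℤ) • y := by funext i; rw [hy i]; rfl
    refine ⟨⟨y, ?_⟩, by apply Subtype.ext; exact hxy.symm⟩
    rw [hxy, quadVal_smul] at hx
    linarith

lemma iso_of_genus {A B : TernMat} (h : InGenus A B) (hB : IsotropicP 2 B) : IsotropicP 2 A :=
  iso_congr (h.2 2 Nat.prime_two) hB

lemma spStar_iso {A : TernMat} (h : IsotropicP 2 A) : SpStar 2 A = 1 := by
  unfold SpStar; rw [dif_pos Nat.prime_two]; exact if_pos h

lemma spStar_aniso {A : TernMat} (h : ¬ IsotropicP 2 A) : SpStar 2 A = -1 := by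
  unfold SpStar; rw [dif_pos Nat.prime_two]; exact if_neg h

/-- the core analytic identities for a linked pair -/
lemma linked_sums {p q : TernMat → Prop} {d : ℤ} (h : Linked p q d) [Fintype (ClassQuot p)] [Fintype (ClassQuot q)] :
    ∃ (E : ClassQuot p → TernMat) (L : ClassQuot q → TernMat) (ρ : ℤ → ℝ), RepSys p E ∧ RepSys q L ∧
      (∀ c, LatIsom (Quot.out c).1 (E c)) ∧ (∀ c, LatIsom (Quot.out c).1 (L c)) ∧
      ∀ (R e : ℤ → ℝ), (∀ m, R m = ∑ i, (rRep (2 * m) (E i) : ℝ) / (numAut (E i) : ℝ)) →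
      (∀ m, e m = ∑ j, (rRep m (L j) : ℝ) / (numAut (L j) : ℝ)) → ∀ m : ℤ,
      2 * e m = R m + 2 * ρ m ∧ R (4 * m) = 3 * R m - 2 * ρ m ∧ ρ (4 * m) = R m ∧
    (¬ 4 ∣ m → ¬ 4 ∣ d * m + 1 → ρ m = 0) ∧ (4 ∣ d * m + 1 → ¬ 8 ∣ d * m + 1 → R m = 4 * ρ m) ∧
    (8 ∣ d * m + 1 → R m = 2 * ρ m) := by
  obtain ⟨E, hE, nE, iE⟩ := exists_repSys (N := NormE) h.pcl (fun B hB =>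
    exists_normE (h.pLat B hB).1 (h.pEven B hB) (h.pdet B hB) h.dodd)
  obtain ⟨L, hL, nL, iL⟩ := exists_repSys (N := NormL) h.qcl (fun B hB => by
    obtain ⟨v, i, hi, hq⟩ := h.qiso B hB
    exact exists_normL (h.qLat B hB).1 (by rw [h.qdet B hB]; exact h.dodd) hi hq)
  refine ⟨E, L, fun m => ∑ i, cnt (E i) (2 * m) (radE (E i)) / (numAut (E i) : ℝ), hE, hL, iE, iL, ?_⟩
  intro R e hR he m
  exact core_all h hE hL nE nL R _ e hR (fun _ => rfl) he m

lemma genus_finite {A : TernMat} (hA : IsLat A) : Finite (ClassQuot (InGenus A)) :=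
  finite_quot_of_det (d := A.det) (fun B hB => ⟨hB.1, hB.det_eq hA⟩)



/-- Ratio `r(4n, gen(L))/r(n, gen(L))` for a ternary lattice stable at `2`. -/
theorem rGenus_ratio_at_two (A : TernMat) (hA : IsLat A) (hprim : IsPrimitiveLat A)
    (hst : StableAt A 2) (n : ℕ) (hn : 0 < n) (hloc : LocallyRepresented n A) :
    (¬IsEvenLat A → ∀ f : ℕ, 0 < f → ¬2 ∣ f →
      hurwitz ((4 * (A.det : ℚ) * (n : ℚ)) / (f : ℚ) ^ 2) ≠ 0 →
      rGenus (4 * (n : ℤ)) A / rGenus (n : ℤ) A =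
        ((hurwitz ((16 * (A.det : ℚ) * (n : ℚ)) / (f : ℚ) ^ 2) : ℝ) +
            (SpStar 2 A : ℝ) * 2 *
              (hurwitz ((4 * (A.det : ℚ) * (n : ℚ)) / (f : ℚ) ^ 2) : ℝ)) /
          ((hurwitz ((4 * (A.det : ℚ) * (n : ℚ)) / (f : ℚ) ^ 2) : ℝ) +
            (SpStar 2 A : ℝ) * 2 *
              (hurwitz (((A.det : ℚ) * (n : ℚ)) / (f : ℚ) ^ 2) : ℝ))) ∧
    (IsEvenLat A → ∀ f : ℕ, 0 < f → ¬2 ∣ f →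
      hurwitz (((A.det : ℚ) * (n : ℚ)) / (f : ℚ) ^ 2) ≠ 0 →
      rGenus (4 * (n : ℤ)) A / rGenus (n : ℤ) A =
        (hurwitz ((4 * (A.det : ℚ) * (n : ℚ)) / (f : ℚ) ^ 2) : ℝ) /
          (hurwitz (((A.det : ℚ) * (n : ℚ)) / (f : ℚ) ^ 2) : ℝ)) := by
  have hd := hA.det_pos
  have hn' : (0 : ℤ) < n := by exact_mod_cast hn
  have hAA := InGenus.refl hA
  haveI : Finite (ClassQuot (InGenus A)) := genus_finite hA
  haveI : Fintype (ClassQuot (InGenus A)) := Fintype.ofFinite _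
  obtain ⟨C, hC, x, hx⟩ := global_rep hA n hn hloc
  constructor
  · intro hodd f hf0 hf hH
    have hod : ¬ 2 ∣ A.det := by
      intro h2
      have h3 : padicValInt 2 A.det ≠ 1 := fun h => hodd ((hst.2 rfl).mp h)
      have h4 := hst.1
      have h5 : padicValInt 2 A.det = 0 := by omega
      haveI : Fact (Nat.Prime 2) := ⟨Nat.prime_two⟩
      rcases (padicValInt_dvd_iff (p := 2) 1 A.det).mp (by simpa using h2) with h | h
      · exact hd.ne' h
      · omega
    obtain ⟨M, hM0, hM, e16, e4, e1⟩ := hur_args hd hn hf0 hf hH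
    rw [e4] at hH
    rw [e16, e4, e1]
    have hH' : (hurwitzNat (4 * M) : ℝ) ≠ 0 := by exact_mod_cast hH
    by_cases hi : IsotropicP 2 A
    · rw [spStar_iso hi]
      obtain ⟨E0, hE0, hlk⟩ := linked_of_odd hA (spStar_iso hi) rfl hod
      haveI : Finite (ClassQuot (InGenus E0)) := genus_finite hE0
      haveI : Fintype (ClassQuot (InGenus E0)) := Fintype.ofFinite _
      obtain ⟨E, L, ρ, hE, hL, iE, iL, hcore⟩ := linked_sums hlk
      rw [rGenus_ratio_sum hAA iL]
      obtain ⟨R, hR⟩ : ∃ R : ℤ → ℝ, ∀ m, R m = ∑ i, (rRep (2 * m) (E i) : ℝ) / (numAut (E i) : ℝ) := ⟨_, fun _ => rfl⟩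
      obtain ⟨e, he⟩ : ∃ e : ℤ → ℝ, ∀ m, e m = ∑ j, (rRep m (L j) : ℝ) / (numAut (L j) : ℝ) := ⟨_, fun _ => rfl⟩
      have hc := hcore R e hR he
      have hpos := sum_pos_of_rep hL hC hx
      rw [← he, ← he]
      rw [← he] at hpos
      have k1 := rho_H hlk.dodd hc hf n hn M hM
      have k2 := R_H hlk.dodd hc hf n hn M hM0 hM
      have k3 := (hc n).1
      have k4 := (hc (4 * n)).1
      have k5 := (hc n).2.2.1
      rw [k5] at k4
      generalize e (4 * n) = e4 at *
      generalize e n = en at *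
      generalize R (4 * n) = R4 at *
      generalize R n = Rn at *
      generalize ρ n = ρn at *
      generalize (hurwitzNat (16 * M) : ℝ) = h16 at *
      generalize (hurwitzNat (4 * M) : ℝ) = h4 at *
      generalize (hurwitzNat M : ℝ) = h1 at *
      have hne : h4 + 2 * h1 ≠ 0 := by
        intro h0
        have : 2 * en * h4 = 0 := by rw [k3]; linear_combination Rn * h0 + 2 * k1
        rcases mul_eq_zero.mp this with h | h
        · linarith
        · exact hH' h
      have hne' : h4 + ((1 : ℤ) : ℝ) * 2 * h1 ≠ 0 := by simpa using hne
      rw [div_eq_div_iff hpos.ne' hne']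
      apply mul_left_cancel₀ hH'
      push_cast
      linear_combination (1 / 2 : ℝ) * h4 * (h4 + 2 * h1) * k4 - (1 / 2 : ℝ) * h4 * (h16 + 2 * h4) * k3 +
        (1 / 2 : ℝ) * (h4 + 2 * h1) * k2 - (h16 + 2 * h4) * k1
    · rw [spStar_aniso hi]
      obtain ⟨L, hL, _, iL⟩ := exists_repSys (p := InGenus A) (N := fun _ => True) (fun B C h h' => h.cl h')
        (fun B hB => ⟨B, LatIsom.refl B, trivial⟩)
      rw [rGenus_ratio_sum hAA iL]
      have hpos := sum_pos_of_rep hL hC hx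
      have hsum : (∑ c, (rRep (4 * (n : ℤ)) (L c) : ℝ) / (numAut (L c) : ℝ)) =
          ∑ c, (rRep (n : ℤ) (L c) : ℝ) / (numAut (L c) : ℝ) := by
        apply Finset.sum_congr rfl
        intro c _
        have hc := hL.1 c
        rw [aniso_rRep hc.1 (by rw [hc.det_eq hA]; exact hod) (fun h => hi (iso_of_genus hc h))]
      rw [hsum, div_self hpos.ne']
      obtain ⟨y, hy⟩ := hloc 2 Nat.prime_two
      have hns := aniso_nosq hA hi hn' hy
      have hD := aniso_H M hM0 (by
        rintro ⟨t, ht⟩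
        apply hns
        refine ⟨f * t, ?_⟩
        rw [hM, mul_pow, ht]; push_cast; ring) hH
      have hD' : (hurwitzNat (4 * M) : ℝ) - 2 * (hurwitzNat M : ℝ) ≠ 0 := by exact_mod_cast hD
      symm
      rw [H_rec0 M hM0]
      have hD'' : (hurwitzNat (4 * M) : ℝ) + ((-1 : ℤ) : ℝ) * 2 * (hurwitzNat M : ℝ) ≠ 0 := by
        intro h; apply hD'; push_cast at h; linarith
      rw [div_eq_one_iff_eq hD'']
      push_cast
      ring
  · intro hev f hf0 hf hH
    have h1 : padicValInt 2 A.det = 1 := (hst.2 rfl).mpr hev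
    haveI : Fact (Nat.Prime 2) := ⟨Nat.prime_two⟩
    obtain ⟨d, hdd⟩ : (2 : ℤ) ∣ A.det := by
      have := (padicValInt_dvd_iff (p := 2) 1 A.det).mpr (Or.inr h1.ge)
      simpa using this
    have hod : ¬ 2 ∣ d := by
      rintro ⟨w, rfl⟩
      rcases (padicValInt_dvd_iff (p := 2) 2 A.det).mp ⟨w, by rw [hdd]; push_cast; ring⟩ with h | h
      · exact hd.ne' h
      · omega
    have hd0 : 0 < d := by omega
    obtain ⟨m, rfl⟩ : 2 ∣ n := by
      have := even_genus hA hC hev x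
      rw [hx] at this
      exact_mod_cast this
    have hm : 0 < m := by omega
    have a1 : ((A.det : ℚ) * ((2 * m : ℕ) : ℚ)) / (f : ℚ) ^ 2 = (4 * (d : ℚ) * (m : ℚ)) / (f : ℚ) ^ 2 := by
      rw [hdd, Int.cast_mul, Nat.cast_mul, Int.cast_ofNat, Nat.cast_ofNat]; ring
    have a4 : (4 * (A.det : ℚ) * ((2 * m : ℕ) : ℚ)) / (f : ℚ) ^ 2 = (16 * (d : ℚ) * (m : ℚ)) / (f : ℚ) ^ 2 := by
      rw [hdd, Int.cast_mul, Nat.cast_mul, Int.cast_ofNat, Nat.cast_ofNat]; ring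
    rw [a1] at hH
    rw [a1, a4]
    obtain ⟨M, hM0, hM, e16, e4, e1⟩ := hur_args hd0 hm hf0 hf hH
    rw [e4] at hH
    rw [e16, e4]
    have hH' : (hurwitzNat (4 * M) : ℝ) ≠ 0 := by exact_mod_cast hH
    obtain ⟨L0, hL0, hlk⟩ := linked_of_even hA hev hdd hod
    haveI : Finite (ClassQuot (InGenus L0)) := genus_finite hL0
    haveI : Fintype (ClassQuot (InGenus L0)) := Fintype.ofFinite _
    obtain ⟨E, L, ρ, hE, hL, iE, iL, hcore⟩ := linked_sums hlk
    rw [rGenus_ratio_sum hAA iE]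
    obtain ⟨R, hR⟩ : ∃ R : ℤ → ℝ, ∀ m, R m = ∑ i, (rRep (2 * m) (E i) : ℝ) / (numAut (E i) : ℝ) := ⟨_, fun _ => rfl⟩
    obtain ⟨e, he⟩ : ∃ e : ℤ → ℝ, ∀ m, e m = ∑ j, (rRep m (L j) : ℝ) / (numAut (L j) : ℝ) := ⟨_, fun _ => rfl⟩
    have hc := hcore R e hR he
    have hpos := sum_pos_of_rep hE hC hx
    have b1 : ((2 * m : ℕ) : ℤ) = 2 * (m : ℤ) := by push_cast; ring
    have b2 : 4 * (2 * (m : ℤ)) = 2 * (4 * (m : ℤ)) := by ring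
    rw [b1] at hpos ⊢
    rw [b2, ← hR, ← hR]
    rw [← hR] at hpos
    have k2 := R_H hlk.dodd hc hf m hm M hM0 hM
    rw [div_eq_div_iff hpos.ne' hH']
    linear_combination k2
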